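/- Let n ≥ 2 and m ≥ 1, and let T = D̄^n(1/2) × S^1(1) ⊂ ℝ^n × ℝ^2 = ℝ^{n+1} be the closed solid torus, the product of the closed n-ball of radius 1/2 and the unit circle, with boundary ∂T = S^{n-1}(1/2) × S^1(1). Let f be a C² map defined on an open neighborhood of ∂T in ℝ^{n+1} with values in ℝ^{m+1} such that: (i) the image N = f(∂T) is simply connected and path-connected (as a subspace of ℝ^{m+1}); (ii) there exist ε₀ > 0 and a continuous retraction ρ from the open ε₀-neighborhood of N in ℝ^{m+1} onto N with ρ(y) = y for y ∈ N; (iii) rank(df_x) ≤ l for all x ∈ ∂T for some integer l < n (conditions (ii) and (iii) hold when N is a simply connected compact embedded submanifold of dimension l < n); and (iv) f|_{∂T} is not null-homotopic as a map from ∂T to N. Then there exists R_f > 0 such that for every R ≥ R_f there is no solution of the Dirichlet problem for the minimal surface system on the interior of T with boundary data R·f|_{∂T}. -/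

import Mathlib

open MeasureTheory

/-- The induced metric `g_{ij} = δ_{ij} + Σ_α ∂_i F^α ∂_j F^α` of the graph of `F`
(using the a.e.-defined total `fderiv`). -/
noncomputable def mssMetric {n m : ℕ}
    (F : EuclideanSpace ℝ (Fin (n+1)) → EuclideanSpace ℝ (Fin (m+1)))
    (x : EuclideanSpace ℝ (Fin (n+1))) : Matrix (Fin (n+1)) (Fin (n+1)) ℝ :=
  fun i j => (if i = j then (1:ℝ) else 0) +
    ∑ α : Fin (m+1),
      fderiv ℝ F x (EuclideanSpace.single i 1) α * fderiv ℝ F x (EuclideanSpace.single j 1) α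

/-- `F` is a solution of the Dirichlet problem for the minimal surface system on `Ω`
with boundary data `f`: continuous on `closure Ω`, Lipschitz on `Ω`, equal to `f` on `∂Ω`,
and weakly satisfying the minimal surface system. -/
def IsMSSolution (n m : ℕ) (Ω : Set (EuclideanSpace ℝ (Fin (n+1))))
    (f F : EuclideanSpace ℝ (Fin (n+1)) → EuclideanSpace ℝ (Fin (m+1))) : Prop :=
  ContinuousOn F (closure Ω) ∧
  (∃ K : NNReal, LipschitzOnWith K F Ω) ∧
  (∀ x ∈ frontier Ω, F x = f x) ∧
  (∀ φ : EuclideanSpace ℝ (Fin (n+1)) → ℝ, ContDiff ℝ (⊤ : ℕ∞) φ → HasCompactSupport φ →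
     tsupport φ ⊆ Ω →
     (∀ j : Fin (n+1),
        ∫ x in Ω, (∑ i : Fin (n+1),
          Real.sqrt (mssMetric F x).det * (mssMetric F x)⁻¹ i j *
            fderiv ℝ φ x (EuclideanSpace.single i 1)) = 0) ∧
     (∀ α : Fin (m+1),
        ∫ x in Ω, (∑ i : Fin (n+1), ∑ j : Fin (n+1),
          Real.sqrt (mssMetric F x).det * (mssMetric F x)⁻¹ i j *
            fderiv ℝ F x (EuclideanSpace.single j 1) α *
            fderiv ℝ φ x (EuclideanSpace.single i 1)) = 0))

/-- The defining function of the standard solid torus `D̄ⁿ(1/2) × S¹(1) ⊂ ℝ^{n+1}`: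
the squared distance to the unit circle lying in the last two coordinates.
The solid torus is `{torusFun ≤ 1/4}`, its interior `{torusFun < 1/4}` and its boundary
`∂T = S^{n-1}(1/2) × S¹(1)` is `{torusFun = 1/4}`. -/
noncomputable def torusFun (n : ℕ) (p : EuclideanSpace ℝ (Fin (n+1))) : ℝ :=
  (∑ i : Fin (n-1), p (Fin.castLE (by omega) i) ^ 2) +
    (Real.sqrt (p ⟨n-1, by omega⟩ ^ 2 + p ⟨n, by omega⟩ ^ 2) - 1) ^ 2

set_option linter.unusedSectionVars false

open MeasureTheory


section GraphMatrices

open Matrix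

variable {α β γ : Type*} [Fintype α] [DecidableEq α] [Fintype β] [DecidableEq β]
  [Fintype γ] [DecidableEq γ]

/-- The Gram matrix of the graph of the linear map with matrix `A`. -/
def graphGram (A : Matrix β α ℝ) : Matrix α α ℝ := 1 + Aᵀ * A

/-- The parametrization `v ↦ (v, A v)` of the graph of `A`. -/
def graphMap (A : Matrix β α ℝ) : Matrix (α ⊕ β) α ℝ := fromRows 1 A

/-- The orthogonal projection onto the graph of `A`. -/
noncomputable def graphProj (A : Matrix β α ℝ) : Matrix (α ⊕ β) (α ⊕ β) ℝ :=
  graphMap A * (graphGram A)⁻¹ * (graphMap A)ᵀ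

lemma graphGram_posDef (A : Matrix β α ℝ) : (graphGram A).PosDef := by
  have h : (Aᵀ * A).PosSemidef := by
    simpa using posSemidef_conjTranspose_mul_self A
  exact PosDef.add_posSemidef PosDef.one h

lemma isUnit_det_graphGram (A : Matrix β α ℝ) : IsUnit (graphGram A).det :=
  (graphGram_posDef A).det_pos.ne'.isUnit

lemma graphMap_transpose_mul (A : Matrix β α ℝ) : (graphMap A)ᵀ * graphMap A = graphGram A := by
  simp [graphMap, graphGram, transpose_fromRows, fromCols_mul_fromRows]

lemma graphGram_transpose (A : Matrix β α ℝ) : (graphGram A)ᵀ = graphGram A := by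
  simp [graphGram]

lemma graphGram_inv_transpose (A : Matrix β α ℝ) : ((graphGram A)⁻¹)ᵀ = (graphGram A)⁻¹ := by
  rw [transpose_nonsing_inv, graphGram_transpose]

lemma graphProj_transpose (A : Matrix β α ℝ) : (graphProj A)ᵀ = graphProj A := by
  simp [graphProj, graphGram_inv_transpose, Matrix.mul_assoc]

lemma graphProj_mul_graphMap (A : Matrix β α ℝ) : graphProj A * graphMap A = graphMap A := by
  rw [graphProj, Matrix.mul_assoc, graphMap_transpose_mul, Matrix.mul_assoc,
    nonsing_inv_mul _ (isUnit_det_graphGram A), Matrix.mul_one]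

lemma graphProj_mul_self (A : Matrix β α ℝ) : graphProj A * graphProj A = graphProj A := by
  have h := graphProj_mul_graphMap A
  calc graphProj A * graphProj A
      = (graphProj A * graphMap A) * (graphGram A)⁻¹ * (graphMap A)ᵀ := by
        simp only [graphProj, Matrix.mul_assoc]
    _ = graphProj A := by rw [h, graphProj]

lemma trace_graphProj (A : Matrix β α ℝ) : (graphProj A).trace = Fintype.card α := by
  rw [graphProj, trace_mul_comm, ← Matrix.mul_assoc, graphMap_transpose_mul,
    mul_nonsing_inv _ (isUnit_det_graphGram A), trace_one]

lemma dotProduct_sq_le (x y : γ → ℝ) : (x ⬝ᵥ y) ^ 2 ≤ (x ⬝ᵥ x) * (y ⬝ᵥ y) := by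
  have := Finset.sum_mul_sq_le_sq_mul_sq Finset.univ x y
  simpa [dotProduct, sq] using this

lemma dotProduct_mulVec_proj {P : Matrix γ γ ℝ} (hs : Pᵀ = P) (hi : P * P = P) (x : γ → ℝ) :
    x ⬝ᵥ (P *ᵥ x) = (P *ᵥ x) ⬝ᵥ (P *ᵥ x) := by
  conv_lhs => rw [← hi, ← mulVec_mulVec, dotProduct_mulVec, ← mulVec_transpose, hs]

lemma dotProduct_self_nonneg' (x : γ → ℝ) : 0 ≤ x ⬝ᵥ x :=
  Finset.sum_nonneg fun i _ => mul_self_nonneg (x i)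

lemma dotProduct_mulVec_proj_le {P : Matrix γ γ ℝ} (hs : Pᵀ = P) (hi : P * P = P) (x : γ → ℝ) :
    x ⬝ᵥ (P *ᵥ x) ≤ x ⬝ᵥ x := by
  have h1 := dotProduct_mulVec_proj hs hi x
  have h2 := dotProduct_self_nonneg' (x - P *ᵥ x)
  rw [sub_dotProduct, dotProduct_sub, dotProduct_sub, ← h1, dotProduct_comm (P *ᵥ x) x] at h2
  linarith

/-- Tangential gradient: `a · g⁻¹ Tᵀ y`. -/
lemma graph_bilin_eq (A : Matrix β α ℝ) (a : α → ℝ) (y : α ⊕ β → ℝ) :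
    a ⬝ᵥ (((graphGram A)⁻¹ * (graphMap A)ᵀ) *ᵥ y) =
      ((graphMap A * (graphGram A)⁻¹) *ᵥ a) ⬝ᵥ y := by
  rw [dotProduct_mulVec, ← mulVec_transpose, transpose_mul, transpose_transpose,
    graphGram_inv_transpose]

lemma graph_lift_dot_self (A : Matrix β α ℝ) (a : α → ℝ) :
    ((graphMap A * (graphGram A)⁻¹) *ᵥ a) ⬝ᵥ ((graphMap A * (graphGram A)⁻¹) *ᵥ a) =
      a ⬝ᵥ ((graphGram A)⁻¹ *ᵥ a) := by
  rw [← graph_bilin_eq, mulVec_mulVec]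
  congr 2
  rw [Matrix.mul_assoc, ← Matrix.mul_assoc _ (graphMap A), graphMap_transpose_mul,
    mul_nonsing_inv _ (isUnit_det_graphGram A), Matrix.mul_one]

lemma graph_bilin_sq_le (A : Matrix β α ℝ) (a : α → ℝ) (y : α ⊕ β → ℝ) :
    (a ⬝ᵥ (((graphGram A)⁻¹ * (graphMap A)ᵀ) *ᵥ y)) ^ 2 ≤
      (a ⬝ᵥ ((graphGram A)⁻¹ *ᵥ a)) * (y ⬝ᵥ y) := by
  rw [graph_bilin_eq, ← graph_lift_dot_self]
  exact dotProduct_sq_le _ _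

lemma graphGram_inv_quad_le (A : Matrix β α ℝ) (a : α → ℝ) :
    a ⬝ᵥ ((graphGram A)⁻¹ *ᵥ a) ≤ a ⬝ᵥ a := by
  set b := (graphGram A)⁻¹ *ᵥ a with hb
  have h1 := graph_lift_dot_self A a
  have h2 : (graphMap A * (graphGram A)⁻¹) *ᵥ a = Sum.elim b (A *ᵥ b) := by
    rw [← mulVec_mulVec, ← hb, graphMap, fromRows_mulVec, one_mulVec]
  rw [h2, ← hb] at h1
  have h3 : b ⬝ᵥ b ≤ a ⬝ᵥ b := by
    rw [← h1]
    simp only [dotProduct, Fintype.sum_sum_type, Sum.elim_inl, Sum.elim_inr]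
    have : 0 ≤ ∑ x, (A *ᵥ b) x * (A *ᵥ b) x := dotProduct_self_nonneg' (A *ᵥ b)
    linarith
  have h4 := dotProduct_sq_le a b
  have h5 := dotProduct_self_nonneg' a
  have h6 := dotProduct_self_nonneg' b
  by_contra! hlt
  nlinarith

lemma graphGram_inv_quad_nonneg (A : Matrix β α ℝ) (a : α → ℝ) :
    0 ≤ a ⬝ᵥ ((graphGram A)⁻¹ *ᵥ a) := by
  rw [← graph_lift_dot_self]; exact dotProduct_self_nonneg' _

lemma graph_bilin_sq_le' (A : Matrix β α ℝ) (a : α → ℝ) (y : α ⊕ β → ℝ) :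
    (a ⬝ᵥ (((graphGram A)⁻¹ * (graphMap A)ᵀ) *ᵥ y)) ^ 2 ≤ (a ⬝ᵥ a) * (y ⬝ᵥ y) :=
  (graph_bilin_sq_le A a y).trans
    (mul_le_mul_of_nonneg_right (graphGram_inv_quad_le A a) (dotProduct_self_nonneg' y))

/-- Squared Frobenius norm. -/
def frobSq (M : Matrix β α ℝ) : ℝ := ∑ i, ∑ j, M i j ^ 2

lemma frobSq_nonneg (M : Matrix β α ℝ) : 0 ≤ frobSq M := by unfold frobSq; positivity

lemma frobSq_eq_trace (M : Matrix β α ℝ) : frobSq M = (Mᵀ * M).trace := by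
  simp only [frobSq, trace, diag, mul_apply, transpose_apply]
  rw [Finset.sum_comm]
  simp [sq]

lemma sq_le_frobSq (M : Matrix β α ℝ) (i : β) (j : α) : M i j ^ 2 ≤ frobSq M := by
  unfold frobSq
  calc M i j ^ 2 ≤ ∑ j, M i j ^ 2 :=
        Finset.single_le_sum (f := fun j => M i j ^ 2) (fun _ _ => sq_nonneg _) (Finset.mem_univ j)
    _ ≤ _ := Finset.single_le_sum (f := fun i => ∑ j, M i j ^ 2)
        (fun _ _ => Finset.sum_nonneg fun _ _ => sq_nonneg _) (Finset.mem_univ i)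

lemma frobSq_mul_le (M : Matrix β α ℝ) (N : Matrix α γ ℝ) :
    frobSq (M * N) ≤ frobSq M * frobSq N := by
  unfold frobSq
  rw [Finset.sum_mul]
  refine Finset.sum_le_sum fun i _ => ?_
  rw [Finset.sum_comm (s := (Finset.univ : Finset α)), Finset.mul_sum]
  refine Finset.sum_le_sum fun k _ => ?_
  rw [mul_apply]
  exact Finset.sum_mul_sq_le_sq_mul_sq Finset.univ _ _

lemma frobSq_sub_le (M N : Matrix β α ℝ) : frobSq (M - N) ≤ 2 * (frobSq M + frobSq N) := by
  unfold frobSq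
  rw [← Finset.sum_add_distrib, Finset.mul_sum]
  refine Finset.sum_le_sum fun i _ => ?_
  rw [← Finset.sum_add_distrib, Finset.mul_sum]
  refine Finset.sum_le_sum fun j _ => ?_
  rw [Matrix.sub_apply]; nlinarith [sq_nonneg (M i j + N i j)]

lemma frobSq_fromRows (M : Matrix β α ℝ) (N : Matrix γ α ℝ) :
    frobSq (fromRows M N) = frobSq M + frobSq N := by
  simp [frobSq, Fintype.sum_sum_type]

/-- The excess of the trace of a projection of corank `card α - 1` over the graph. -/
lemma trace_proj_sub_one (A : Matrix β α ℝ) {P : Matrix (α ⊕ β) (α ⊕ β) ℝ} (hs : Pᵀ = P)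
    (hi : P * P = P) (ht : (1 - P).trace = Fintype.card α - 1) :
    ((graphGram A)⁻¹ * (graphMap A)ᵀ * (P * graphMap A)).trace - 1 =
      frobSq ((1 - graphProj A) * (1 - P)) := by
  have e1 : ((graphGram A)⁻¹ * (graphMap A)ᵀ * (P * graphMap A)).trace = (P * graphProj A).trace := by
    rw [← Matrix.mul_assoc, trace_mul_comm, graphProj, ← Matrix.mul_assoc, ← Matrix.mul_assoc,
      trace_mul_comm]
  have hq : (1 - P) * (1 - P) = 1 - P := by
    simp [Matrix.mul_sub, Matrix.sub_mul, hi]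
  have hq2 : (1 - graphProj A) * (1 - graphProj A) = 1 - graphProj A := by
    simp [Matrix.mul_sub, Matrix.sub_mul, graphProj_mul_self]
  rw [e1, frobSq_eq_trace, transpose_mul]
  have e2 : (1 - P)ᵀ = 1 - P := by simp [hs]
  have e3 : (1 - graphProj A)ᵀ = 1 - graphProj A := by simp [graphProj_transpose]
  rw [e2, e3, Matrix.mul_assoc, ← Matrix.mul_assoc (1 - graphProj A), hq2, trace_mul_comm (1 - P),
    Matrix.mul_assoc, hq]
  have := trace_graphProj A
  simp only [Matrix.mul_sub, Matrix.sub_mul, Matrix.one_mul, Matrix.mul_one, trace_sub] at ht ⊢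
  rw [trace_mul_comm (graphProj A)]
  linarith

lemma frobSq_tilt_le (A H : Matrix β α ℝ) (Q : Matrix α α ℝ) {P : Matrix (α ⊕ β) (α ⊕ β) ℝ}
    (hB : P * fromRows Q (H * Q) = 0) :
    frobSq ((A - H) * Q) ≤ 2 * (1 + frobSq A) * frobSq (fromRows Q (H * Q)) *
      frobSq ((1 - graphProj A) * (1 - P)) := by
  set B := fromRows Q (H * Q) with hBdef
  set Y := (graphGram A)⁻¹ * (graphMap A)ᵀ * B with hY
  have h1 : (1 - graphProj A) * (1 - P) * B = fromRows (Q - Y) (H * Q - A * Y) := by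
    rw [Matrix.mul_assoc, Matrix.sub_mul 1 P, hB, sub_zero, Matrix.one_mul, Matrix.sub_mul, Matrix.one_mul,
      graphProj, Matrix.mul_assoc (graphMap A), Matrix.mul_assoc (graphMap A), ← hY, graphMap,
      fromRows_mul, Matrix.one_mul]
    ext i j
    rcases i with i | i <;> simp [hBdef]
  have h2 : (A - H) * Q = A * (Q - Y) - (H * Q - A * Y) := by
    simp only [Matrix.mul_sub, Matrix.sub_mul]; abel
  have h3 := frobSq_mul_le ((1 - graphProj A) * (1 - P)) B
  rw [h1, frobSq_fromRows] at h3
  rw [h2]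
  have h4 := frobSq_sub_le (A * (Q - Y)) (H * Q - A * Y)
  have h5 := frobSq_mul_le A (Q - Y)
  have h6 := frobSq_nonneg (Q - Y)
  have h7 := frobSq_nonneg (H * Q - A * Y)
  have h8 := frobSq_nonneg A
  nlinarith [mul_nonneg h8 h7, mul_le_mul_of_nonneg_left h3 h8]

lemma det_mul_inv_quad (A : Matrix β α ℝ) (ν : α → ℝ) (hν : ν ⬝ᵥ ν = 1) :
    (graphGram A).det * (ν ⬝ᵥ ((graphGram A)⁻¹ *ᵥ ν)) =
      (1 + (A * (1 - vecMulVec ν ν)) * (A * (1 - vecMulVec ν ν))ᵀ).det := by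
  set Q : Matrix α α ℝ := 1 - vecMulVec ν ν with hQ
  set M := graphGram A with hM
  have hQt : Qᵀ = Q := by simp [hQ, transpose_vecMulVec]
  have hQQ : Q * Q = Q := by
    simp only [hQ, Matrix.mul_sub, Matrix.sub_mul, Matrix.one_mul, Matrix.mul_one, vecMulVec_mul_vecMulVec]
    simp [hν]
  have h1 : (Q + vecMulVec ν ν * M⁻¹) * M = 1 + Q * (Aᵀ * A) := by
    rw [add_mul, Matrix.mul_assoc, nonsing_inv_mul _ (isUnit_det_graphGram A), Matrix.mul_one, hM,
      graphGram, mul_add, Matrix.mul_one, hQ]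
    abel
  have h2 : Q + vecMulVec ν ν * M⁻¹ = 1 + vecMulVec ν (ν ᵥ* M⁻¹ - ν) := by
    rw [vecMulVec_mul, hQ, vecMulVec_sub]; abel
  have h3 : (1 + vecMulVec ν (ν ᵥ* M⁻¹ - ν)).det = ν ⬝ᵥ (M⁻¹ *ᵥ ν) := by
    rw [vecMulVec_eq Unit, det_one_add_replicateCol_mul_replicateRow, sub_dotProduct, hν,
      dotProduct_mulVec]
    ring
  rw [mul_comm, ← h3, ← h2, ← det_mul, h1, ← Matrix.mul_assoc, det_one_add_mul_comm, transpose_mul,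
    hQt, ← Matrix.mul_assoc (A * Q), Matrix.mul_assoc A Q Q, hQQ, Matrix.mul_assoc]

end GraphMatrices

open MeasureTheory

section GraphDensity

open Matrix

variable {α β γ : Type*} [Fintype α] [DecidableEq α] [Fintype β] [DecidableEq β]
  [Fintype γ] [DecidableEq γ]

lemma frobSq_le_of_entries {M : Matrix β α ℝ} {e : ℝ} (h : ∀ i j, |M i j| ≤ e) :
    frobSq M ≤ Fintype.card β * Fintype.card α * e ^ 2 := by
  unfold frobSq
  calc ∑ i, ∑ j, M i j ^ 2 ≤ ∑ _i : β, ∑ _j : α, e ^ 2 := by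
        refine Finset.sum_le_sum fun i _ => Finset.sum_le_sum fun j _ => ?_
        exact sq_le_sq.2 ((h i j).trans (le_abs_self e))
    _ = _ := by simp [mul_assoc]

lemma mulVec_dot_self_le (M : Matrix β α ℝ) (x : α → ℝ) :
    (M *ᵥ x) ⬝ᵥ (M *ᵥ x) ≤ frobSq M * (x ⬝ᵥ x) := by
  have := frobSq_mul_le M (replicateCol Unit x)
  rw [← replicateCol_mulVec] at this
  simpa [frobSq, dotProduct, sq] using this

lemma abs_trace_graph_le (A : Matrix β α ℝ) {Z : Matrix (α ⊕ β) α ℝ} {e : ℝ} (he : 0 ≤ e)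
    (h : ∀ i j, |Z i j| ≤ e) :
    |((graphGram A)⁻¹ * (graphMap A)ᵀ * Z).trace| ≤ (Fintype.card (α ⊕ β) : ℝ) ^ 2 * e := by
  set N : ℝ := (Fintype.card (α ⊕ β) : ℝ) with hN
  have hN0 : 0 ≤ N := Nat.cast_nonneg _
  have hNN : N ≤ N ^ 2 := by
    rw [hN]; exact_mod_cast Nat.le_self_pow two_ne_zero _
  have hαN : (Fintype.card α : ℝ) ≤ N := by
    rw [hN]; exact_mod_cast (by simp : Fintype.card α ≤ Fintype.card (α ⊕ β))
  have key : ∀ i : α, |((graphGram A)⁻¹ * (graphMap A)ᵀ * Z) i i| ≤ N * e := by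
    intro i
    have h1 : ((graphGram A)⁻¹ * (graphMap A)ᵀ * Z) i i =
        (Pi.single i 1) ⬝ᵥ (((graphGram A)⁻¹ * (graphMap A)ᵀ) *ᵥ (fun k => Z k i)) := by
      rw [single_one_dotProduct]; rfl
    have h2 := graph_bilin_sq_le' A (Pi.single i 1) (fun k => Z k i)
    rw [← h1] at h2
    have h3 : (fun k => Z k i) ⬝ᵥ (fun k => Z k i) ≤ N * e ^ 2 := by
      calc ∑ k, Z k i * Z k i ≤ ∑ _k : α ⊕ β, e ^ 2 := by
            gcongr with k _
            have := sq_le_sq.2 ((h k i).trans (le_abs_self e))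
            nlinarith
        _ = _ := by simp [hN]
    have h4 : (Pi.single i 1 : α → ℝ) ⬝ᵥ Pi.single i 1 = 1 := by simp
    rw [h4, one_mul] at h2
    refine abs_le_of_sq_le_sq (h2.trans (h3.trans ?_)) (by positivity)
    nlinarith [sq_nonneg e]
  calc |((graphGram A)⁻¹ * (graphMap A)ᵀ * Z).trace|
      ≤ ∑ i, |((graphGram A)⁻¹ * (graphMap A)ᵀ * Z) i i| := Finset.abs_sum_le_sum_abs _ _
    _ ≤ ∑ _i : α, N * e := Finset.sum_le_sum fun i _ => key i
    _ = Fintype.card α * (N * e) := by simp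
    _ ≤ N * (N * e) := by gcongr
    _ = N ^ 2 * e := by ring

lemma abs_quad_graph_le (A : Matrix β α ℝ) {Z : Matrix (α ⊕ β) α ℝ} {e : ℝ} (he : 0 ≤ e)
    (h : ∀ i j, |Z i j| ≤ e) (y : α ⊕ β → ℝ) :
    |y ⬝ᵥ (Z *ᵥ (((graphGram A)⁻¹ * (graphMap A)ᵀ) *ᵥ y))| ≤
      (Fintype.card (α ⊕ β) : ℝ) * e * (y ⬝ᵥ y) := by
  have hy := dotProduct_self_nonneg' y
  rw [dotProduct_mulVec, ← mulVec_transpose]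
  refine abs_le_of_sq_le_sq ((graph_bilin_sq_le' A _ y).trans ?_) (by positivity)
  have h1 := mulVec_dot_self_le Zᵀ y
  have h2 : frobSq Zᵀ ≤ (Fintype.card (α ⊕ β) : ℝ) ^ 2 * e ^ 2 := by
    refine (frobSq_le_of_entries (e := e) fun i j => h j i).trans ?_
    gcongr
    rw [sq]
    gcongr
    simp
  calc _ ≤ ((Fintype.card (α ⊕ β) : ℝ) ^ 2 * e ^ 2 * (y ⬝ᵥ y)) * (y ⬝ᵥ y) := by
        gcongr
        exact h1.trans (by gcongr)
    _ = _ := by ring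

/-- The density of the first variation of the area of the graph of `A` (up to the area factor)
along the vector field `θ φ(|X|²) X`, where `y`, `Z` are the value and the derivative of `X`,
and `a` is the gradient of `θ`. -/
noncomputable def testDensity (A : Matrix β α ℝ) (φ φ' θ : ℝ) (a : α → ℝ) (y : α ⊕ β → ℝ)
    (Z : Matrix (α ⊕ β) α ℝ) : ℝ :=
  φ * (a ⬝ᵥ (((graphGram A)⁻¹ * (graphMap A)ᵀ) *ᵥ y)) +
    θ * (2 * φ' * (y ⬝ᵥ (Z *ᵥ (((graphGram A)⁻¹ * (graphMap A)ᵀ) *ᵥ y))) +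
      φ * ((graphGram A)⁻¹ * (graphMap A)ᵀ * Z).trace)

lemma quad_graphMap_le (A : Matrix β α ℝ) (y : α ⊕ β → ℝ) :
    y ⬝ᵥ (graphMap A *ᵥ (((graphGram A)⁻¹ * (graphMap A)ᵀ) *ᵥ y)) ≤ y ⬝ᵥ y := by
  rw [mulVec_mulVec, ← Matrix.mul_assoc]
  exact dotProduct_mulVec_proj_le (graphProj_transpose A) (graphProj_mul_self A) y

lemma testDensity_radial_ge (A : Matrix β α ℝ) {s θ : ℝ} (hs : 0 < s) (hθ : 0 ≤ θ) (a : α → ℝ)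
    (y : α ⊕ β → ℝ) :
    (√(y ⬝ᵥ y + s ^ 2))⁻¹ ^ Fintype.card α *
        (a ⬝ᵥ (((graphGram A)⁻¹ * (graphMap A)ᵀ) *ᵥ y)) +
      θ * (Fintype.card α * s ^ 2 * (√(y ⬝ᵥ y + s ^ 2))⁻¹ ^ (Fintype.card α + 2)) ≤
    testDensity A ((√(y ⬝ᵥ y + s ^ 2))⁻¹ ^ Fintype.card α)
      (-(Fintype.card α / 2) * (√(y ⬝ᵥ y + s ^ 2))⁻¹ ^ (Fintype.card α + 2)) θ a y
      (graphMap A) := by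
  unfold testDensity
  have hy := dotProduct_self_nonneg' y
  have hq : √(y ⬝ᵥ y + s ^ 2) ^ 2 = y ⬝ᵥ y + s ^ 2 := Real.sq_sqrt (by positivity)
  have hq0 : 0 < √(y ⬝ᵥ y + s ^ 2) := Real.sqrt_pos.2 (by positivity)
  set q := √(y ⬝ᵥ y + s ^ 2)
  have ht : ((graphGram A)⁻¹ * (graphMap A)ᵀ * graphMap A).trace = Fintype.card α := by
    rw [Matrix.mul_assoc, graphMap_transpose_mul, nonsing_inv_mul _ (isUnit_det_graphGram A),
      trace_one]
  have hle := quad_graphMap_le A y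
  rw [ht]
  set z := y ⬝ᵥ (graphMap A *ᵥ (((graphGram A)⁻¹ * (graphMap A)ᵀ) *ᵥ y))
  set D := Fintype.card α
  refine add_le_add le_rfl (mul_le_mul_of_nonneg_left ?_ hθ)
  have e1 : q⁻¹ ^ D = q⁻¹ ^ (D + 2) * (y ⬝ᵥ y + s ^ 2) := by
    rw [pow_add, ← hq]; field_simp
  rw [e1]
  have h3 : 0 ≤ q⁻¹ ^ (D + 2) * D := by positivity
  nlinarith [mul_le_mul_of_nonneg_left hle h3]

lemma testDensity_strip_ge (A : Matrix β α ℝ) {s θ e : ℝ} (hs : 0 < s) (hθ : 0 ≤ θ) (he : 0 ≤ e)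
    (a : α → ℝ) (y : α ⊕ β → ℝ) {P : Matrix (α ⊕ β) (α ⊕ β) ℝ} (hP : Pᵀ = P)
    (hPy : P *ᵥ y = y) {Z : Matrix (α ⊕ β) α ℝ} (hZ : ∀ i j, |(Z - P * graphMap A) i j| ≤ e) :
    -√(a ⬝ᵥ a) + θ * (√(y ⬝ᵥ y + s ^ 2))⁻¹ *
      (((graphGram A)⁻¹ * (graphMap A)ᵀ * (P * graphMap A)).trace - 1 -
        2 * (Fintype.card (α ⊕ β) : ℝ) ^ 2 * e) ≤
    testDensity A ((√(y ⬝ᵥ y + s ^ 2))⁻¹ ^ 1)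
      (-(1 / 2) * (√(y ⬝ᵥ y + s ^ 2))⁻¹ ^ (1 + 2)) θ a y Z := by
  unfold testDensity
  have hy := dotProduct_self_nonneg' y
  have hq : √(y ⬝ᵥ y + s ^ 2) ^ 2 = y ⬝ᵥ y + s ^ 2 := Real.sq_sqrt (by positivity)
  have hq0 : 0 < √(y ⬝ᵥ y + s ^ 2) := Real.sqrt_pos.2 (by positivity)
  set q := √(y ⬝ᵥ y + s ^ 2)
  set N : ℝ := (Fintype.card (α ⊕ β) : ℝ) with hN
  have hN0 : 0 ≤ N := Nat.cast_nonneg _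
  have hNN : N ≤ N ^ 2 := by
    rw [hN]; exact_mod_cast Nat.le_self_pow two_ne_zero _
  set E := Z - P * graphMap A with hE
  have hZE : Z = P * graphMap A + E := by rw [hE]; abel
  have h1 := abs_trace_graph_le A he hZ
  have h2 := abs_quad_graph_le A he hZ y
  have h3 := graph_bilin_sq_le' A a y
  have h4 : y ⬝ᵥ ((P * graphMap A) *ᵥ (((graphGram A)⁻¹ * (graphMap A)ᵀ) *ᵥ y)) ≤ y ⬝ᵥ y := by
    rw [← mulVec_mulVec, dotProduct_mulVec, ← mulVec_transpose, hP, hPy]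
    exact quad_graphMap_le A y
  rw [hZE, add_mulVec, dotProduct_add, Matrix.mul_add, trace_add]
  set b := a ⬝ᵥ (((graphGram A)⁻¹ * (graphMap A)ᵀ) *ᵥ y)
  set z := y ⬝ᵥ ((P * graphMap A) *ᵥ (((graphGram A)⁻¹ * (graphMap A)ᵀ) *ᵥ y))
  set z' := y ⬝ᵥ (E *ᵥ (((graphGram A)⁻¹ * (graphMap A)ᵀ) *ᵥ y))
  set t := ((graphGram A)⁻¹ * (graphMap A)ᵀ * (P * graphMap A)).trace
  set t' := ((graphGram A)⁻¹ * (graphMap A)ᵀ * E).trace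
  have hb : -√(a ⬝ᵥ a) ≤ q⁻¹ ^ 1 * b := by
    have h5 : |b| ≤ √(a ⬝ᵥ a) * q := by
      refine abs_le_of_sq_le_sq ?_ (by positivity)
      rw [mul_pow, Real.sq_sqrt (dotProduct_self_nonneg' a), hq]
      refine h3.trans (mul_le_mul_of_nonneg_left ?_ (dotProduct_self_nonneg' a))
      nlinarith
    have h6 : -(√(a ⬝ᵥ a) * q) ≤ b := (abs_le.1 h5).1
    calc -√(a ⬝ᵥ a) = q⁻¹ ^ 1 * (-(√(a ⬝ᵥ a) * q)) := by field_simp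
      _ ≤ _ := by gcongr
  have hzz : z + z' ≤ (1 + N * e) * q ^ 2 := by
    have := (abs_le.1 h2).2
    rw [hq]
    nlinarith [mul_nonneg hN0 he, sq_nonneg s, mul_nonneg (mul_nonneg hN0 he) (sq_nonneg s)]
  have hmain : q⁻¹ * (t - 1 - 2 * N ^ 2 * e) ≤
      2 * (-(1 / 2) * q⁻¹ ^ (1 + 2)) * (z + z') + q⁻¹ ^ 1 * (t + t') := by
    have h7 := (abs_le.1 h1).1
    have h8 : q⁻¹ ^ 3 * (z + z') ≤ q⁻¹ * (1 + N * e) := by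
      calc q⁻¹ ^ 3 * (z + z') ≤ q⁻¹ ^ 3 * ((1 + N * e) * q ^ 2) := by gcongr
        _ = _ := by field_simp
    have h9 : N * e ≤ N ^ 2 * e := by gcongr
    have h10 : q⁻¹ * (t - 1 - 2 * N ^ 2 * e) ≤ q⁻¹ * (t + t' - (1 + N * e)) := by
      refine mul_le_mul_of_nonneg_left ?_ (by positivity)
      rw [← hN] at h7
      linarith
    have e3 : (1 + 2 : ℕ) = 3 := rfl
    rw [e3]
    nlinarith
  have := mul_le_mul_of_nonneg_left hmain hθ
  nlinarith

/-- The flux of a vector field through a level set, weighted by the area factor. -/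
lemma flux_le (A : Matrix β α ℝ) (ν : α → ℝ) (hν : ν ⬝ᵥ ν = 1) (y : α ⊕ β → ℝ) :
    √(graphGram A).det * |ν ⬝ᵥ (((graphGram A)⁻¹ * (graphMap A)ᵀ) *ᵥ y)| ≤
      √(1 + (A * (1 - vecMulVec ν ν)) * (A * (1 - vecMulVec ν ν))ᵀ).det * √(y ⬝ᵥ y) := by
  have hd := (graphGram_posDef A).det_pos
  rw [← det_mul_inv_quad A ν hν, Real.sqrt_mul hd.le, mul_assoc]
  refine mul_le_mul_of_nonneg_left ?_ (Real.sqrt_nonneg _)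
  rw [← Real.sqrt_mul (graphGram_inv_quad_nonneg A ν)]
  exact Real.abs_le_sqrt (graph_bilin_sq_le A ν y)

lemma det_one_add_eq_prod {M : Matrix β β ℝ} (hM : M.IsHermitian) :
    (1 + M).det = ∏ i, (1 + hM.eigenvalues i) := by
  have h := congrArg (Polynomial.eval (-1)) hM.charpoly_eq
  rw [eval_charpoly, Polynomial.eval_prod] at h
  have e1 : scalar β (-1 : ℝ) - M = -(1 + M) := by
    rw [scalar_apply]
    ext i j
    by_cases hij : i = j <;> simp [one_apply, hij]; ring
  rw [e1, det_neg] at h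
  have e2 : ∏ i, Polynomial.eval (-1) (Polynomial.X - Polynomial.C (hM.eigenvalues i)) =
      (-1) ^ Fintype.card β * ∏ i, (1 + hM.eigenvalues i) := by
    rw [← Finset.card_univ, ← Finset.prod_const, ← Finset.prod_mul_distrib]
    refine Finset.prod_congr rfl fun i _ => ?_
    simp; ring
  exact mul_left_cancel₀ (pow_ne_zero _ (by norm_num : (-1 : ℝ) ≠ 0)) (h.trans e2)

lemma posSemidef_mul_transpose (B : Matrix β α ℝ) : (B * Bᵀ).PosSemidef := by
  simpa using posSemidef_self_mul_conjTranspose B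

lemma one_le_det_one_add_mul_transpose (B : Matrix β α ℝ) : 1 ≤ (1 + B * Bᵀ).det := by
  have hB := posSemidef_mul_transpose B
  rw [det_one_add_eq_prod hB.isHermitian]
  refine Finset.prod_induction _ (fun x : ℝ => 1 ≤ x) (fun a b ha hb => by nlinarith) le_rfl ?_
  intro i _
  linarith [hB.eigenvalues_nonneg i]

lemma det_one_add_mul_transpose_le (B : Matrix β α ℝ) :
    (1 + B * Bᵀ).det ≤ (1 + frobSq B) ^ B.rank := by
  have hB := posSemidef_mul_transpose B
  have hH := hB.isHermitian
  rw [det_one_add_eq_prod hH]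
  have htr : frobSq B = ∑ i, hH.eigenvalues i := by
    rw [frobSq_eq_trace, trace_mul_comm, hH.trace_eq_sum_eigenvalues]
    simp
  have hle : ∀ i, hH.eigenvalues i ≤ frobSq B := fun i => by
    rw [htr]
    exact Finset.single_le_sum (fun i _ => hB.eigenvalues_nonneg i) (Finset.mem_univ i)
  have hrank : B.rank = (Finset.univ.filter fun i => hH.eigenvalues i ≠ 0).card := by
    rw [← rank_self_mul_transpose, hH.rank_eq_card_non_zero_eigs, Fintype.card_subtype]
  rw [hrank, ← Finset.prod_const, Finset.prod_filter]
  refine Finset.prod_le_prod (fun i _ => by linarith [hB.eigenvalues_nonneg i]) fun i _ => ?_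
  split_ifs with h
  · linarith [hle i]
  · push Not at h
    simp [h]

end GraphDensity

section WeakForm
open MeasureTheory Filter Topology Convolution

variable {E : Type*} [NormedAddCommGroup E] [InnerProductSpace ℝ E] [FiniteDimensional ℝ E]
  [MeasurableSpace E] [BorelSpace E]

/-- A Lipschitz function is mollified by a bump function: the derivative of the mollification is
the mollification of the derivative. -/
lemma fderiv_bump_convolution {ψ : E → ℝ} {K : NNReal} (hψ : LipschitzWith K ψ)
    (hc : HasCompactSupport ψ) (b : ContDiffBump (0 : E)) (x : E) :
    fderiv ℝ (b.normed volume ⋆[ContinuousLinearMap.lsmul ℝ ℝ, volume] ψ) x =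
      (b.normed volume ⋆[ContinuousLinearMap.lsmul ℝ ℝ, volume] (fderiv ℝ ψ)) x := by
  have hbi : Integrable (b.normed volume) := b.integrable_normed
  have hm : AEStronglyMeasurable (fun t : E => fderiv ℝ ψ (x - t)) volume :=
    ((measurable_fderiv ℝ ψ).comp (measurable_const.sub measurable_id)).aestronglyMeasurable
  have key := hasFDerivAt_integral_of_dominated_loc_of_lip (𝕜 := ℝ) (μ := (volume : Measure E))
    (F := fun (y : E) (t : E) => b.normed volume t * ψ (y - t))
    (F' := fun t => b.normed volume t • fderiv ℝ ψ (x - t)) (x₀ := x)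
    (bound := fun t => K * b.normed volume t) (s := Set.univ) Filter.univ_mem
    (Eventually.of_forall fun y => hbi.aestronglyMeasurable.mul
      (hψ.continuous.comp (continuous_const.sub continuous_id)).aestronglyMeasurable)
    (by
      obtain ⟨C, hC⟩ := hψ.continuous.bounded_above_of_compact_support hc
      exact hbi.mul_bdd (c := C)
        (hψ.continuous.comp (continuous_const.sub continuous_id)).aestronglyMeasurable
        (Eventually.of_forall fun t => hC _))
    (hbi.aestronglyMeasurable.smul hm)
    (Eventually.of_forall fun t => by
      refine LipschitzOnWith.of_dist_le_mul fun y _ z _ => ?_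
      rw [Real.coe_nnabs, abs_of_nonneg (mul_nonneg K.coe_nonneg (b.nonneg_normed (μ := volume) t)), Real.dist_eq,
        ← mul_sub, abs_mul, abs_of_nonneg (b.nonneg_normed t), mul_comm (K : ℝ), mul_assoc]
      refine mul_le_mul_of_nonneg_left ?_ (b.nonneg_normed t)
      have := hψ.dist_le_mul (y - t) (z - t)
      rwa [dist_sub_right, Real.dist_eq] at this)
    (hbi.const_mul _)
    (by
      have h1 : ∀ᵐ t : E, DifferentiableAt ℝ ψ (x - t) :=
        (quasiMeasurePreserving_sub_left volume x).ae hψ.ae_differentiableAt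
      filter_upwards [h1] with t ht
      have h2 : HasFDerivAt (fun y => ψ (y - t)) (fderiv ℝ ψ (x - t)) x := by
        have := ht.hasFDerivAt.comp x ((hasFDerivAt_id x).sub_const t)
        rwa [ContinuousLinearMap.comp_id] at this
      exact h2.const_mul _)
  exact key.2.fderiv

lemma exists_smooth_approx {ψ : E → ℝ} {K : NNReal} (hψ : LipschitzWith K ψ)
    (hc : HasCompactSupport ψ) {Ω : Set E} (hΩ : IsOpen Ω) (hsub : tsupport ψ ⊆ Ω) :
    ∃ φ : ℕ → E → ℝ, (∀ k, ContDiff ℝ (⊤ : ℕ∞) (φ k) ∧ HasCompactSupport (φ k) ∧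
      tsupport (φ k) ⊆ Ω) ∧ (∀ k x, ‖fderiv ℝ (φ k) x‖ ≤ K) ∧
      ∀ᵐ x, Tendsto (fun k => fderiv ℝ (φ k) x) atTop (𝓝 (fderiv ℝ ψ x)) := by
  obtain ⟨δ, hδ, hδΩ⟩ := hc.isCompact.exists_cthickening_subset_open hΩ hsub
  let b : ℕ → ContDiffBump (0 : E) := fun k =>
    ⟨δ / (k + 1) / 2, δ / (k + 1), by positivity, half_lt_self (by positivity)⟩
  have hr : ∀ k, (b k).rOut ≤ δ := fun k => by
    show δ / (k + 1) ≤ δ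
    exact div_le_self hδ.le (by simp)
  have hsupp : ∀ k, Function.support
      ((b k).normed volume ⋆[ContinuousLinearMap.lsmul ℝ ℝ, volume] ψ) ⊆
        Metric.cthickening δ (tsupport ψ) := fun k => by
    refine (support_convolution_subset _).trans ?_
    rintro _ ⟨y, hy, z, hz, rfl⟩
    rw [(b k).support_normed_eq] at hy
    refine Metric.mem_cthickening_of_dist_le _ z _ _ (subset_tsupport _ hz) ?_
    have : ‖y‖ < (b k).rOut := by simpa using hy
    simpa [dist_eq_norm] using this.le.trans (hr k)
  have hts : ∀ k, tsupport
      ((b k).normed volume ⋆[ContinuousLinearMap.lsmul ℝ ℝ, volume] ψ) ⊆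
        Metric.cthickening δ (tsupport ψ) := fun k =>
    closure_minimal (hsupp k) Metric.isClosed_cthickening
  refine ⟨fun k => (b k).normed volume ⋆[ContinuousLinearMap.lsmul ℝ ℝ, volume] ψ,
    fun k => ⟨?_, ?_, (hts k).trans hδΩ⟩, fun k x => ?_, ?_⟩
  · exact (b k).hasCompactSupport_normed.contDiff_convolution_left _ (b k).contDiff_normed
      hψ.continuous.locallyIntegrable
  · exact HasCompactSupport.of_support_subset_isCompact hc.isCompact.cthickening (hsupp k)
  · rw [fderiv_bump_convolution hψ hc]
    refine (norm_integral_le_integral_norm _).trans ?_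
    calc ∫ t, ‖(ContinuousLinearMap.lsmul ℝ ℝ ((b k).normed volume t)) (fderiv ℝ ψ (x - t))‖
        ≤ ∫ t, (b k).normed volume t * K := by
          refine integral_mono_of_nonneg (Eventually.of_forall fun _ => norm_nonneg _)
            ((b k).integrable_normed.mul_const _) (Eventually.of_forall fun t => ?_)
          simp only [ContinuousLinearMap.lsmul_apply, norm_smul, Real.norm_eq_abs,
            abs_of_nonneg ((b k).nonneg_normed t)]
          exact mul_le_mul_of_nonneg_left (norm_fderiv_le_of_lipschitz ℝ hψ)
            ((b k).nonneg_normed t)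
      _ = K := by rw [integral_mul_const, (b k).integral_normed, one_mul]
  · have hli : LocallyIntegrable (fderiv ℝ ψ) volume := by
      refine (locallyIntegrable_const (K : ℝ)).mono
        (measurable_fderiv ℝ ψ).aestronglyMeasurable (Eventually.of_forall fun x => ?_)
      simpa using norm_fderiv_le_of_lipschitz ℝ hψ (x₀ := x)
    have := ContDiffBump.ae_convolution_tendsto_right_of_locallyIntegrable (φ := b) (l := atTop)
      (K := 2) (μ := (volume : Measure E)) (g := fderiv ℝ ψ) ?_
      (Eventually.of_forall fun k => ?_) hli
    · filter_upwards [this] with x hx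
      refine hx.congr fun k => ?_
      rw [fderiv_bump_convolution hψ hc]
    · exact tendsto_const_nhds.div_atTop
        (tendsto_atTop_add_const_right _ _ tendsto_natCast_atTop_atTop)
    · show δ / (k + 1) ≤ 2 * (δ / (k + 1) / 2)
      linarith

/-- A linear first-order weak equation tested by smooth functions may be tested by Lipschitz
functions. -/
lemma weak_eq_lipschitz {ι : Type*} [Fintype ι] {Ω : Set E} (hΩ : IsOpen Ω)
    (a : ι → E → ℝ) (v : ι → E) {C : ℝ} (ha : ∀ i x, |a i x| ≤ C)
    (ham : ∀ i, AEStronglyMeasurable (a i) (volume.restrict Ω)) (hfin : volume Ω ≠ ⊤)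
    (hw : ∀ φ : E → ℝ, ContDiff ℝ (⊤ : ℕ∞) φ → HasCompactSupport φ → tsupport φ ⊆ Ω →
      ∫ x in Ω, ∑ i, a i x * fderiv ℝ φ x (v i) = 0)
    {ψ : E → ℝ} {K : NNReal} (hψ : LipschitzWith K ψ) (hc : HasCompactSupport ψ)
    (hsub : tsupport ψ ⊆ Ω) :
    ∫ x in Ω, ∑ i, a i x * fderiv ℝ ψ x (v i) = 0 := by
  obtain ⟨φ, hφ, hK, hlim⟩ := exists_smooth_approx hψ hc hΩ hsub
  have hfm : IsFiniteMeasure (volume.restrict Ω) := ⟨by simpa using hfin.lt_top⟩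
  have := tendsto_integral_of_dominated_convergence (μ := volume.restrict Ω)
    (F := fun k x => ∑ i, a i x * fderiv ℝ (φ k) x (v i))
    (f := fun x => ∑ i, a i x * fderiv ℝ ψ x (v i)) (fun _ => ∑ i, C * (K * ‖v i‖))
    (fun k => by
      refine Finset.aestronglyMeasurable_fun_sum _ fun i _ => (ham i).mul ?_
      exact (measurable_fderiv_apply_const ℝ (φ k) (v i)).aestronglyMeasurable)
    (integrable_const _)
    (fun k => Eventually.of_forall fun x => by
      refine (norm_sum_le _ _).trans (Finset.sum_le_sum fun i _ => ?_)
      rw [norm_mul, Real.norm_eq_abs]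
      exact mul_le_mul (ha i x) (((fderiv ℝ (φ k) x).le_opNorm _).trans
        (mul_le_mul_of_nonneg_right (hK k x) (norm_nonneg _))) (norm_nonneg _)
        ((abs_nonneg _).trans (ha i x)))
    (by
      filter_upwards [ae_restrict_of_ae hlim] with x hx
      refine tendsto_finsetSum _ fun i _ => Tendsto.const_mul _ ?_
      exact ((ContinuousLinearMap.apply ℝ ℝ (v i)).continuous.tendsto _).comp hx)
  have h0 : ∀ k, ∫ x in Ω, ∑ i, a i x * fderiv ℝ (φ k) x (v i) = 0 := fun k =>
    hw _ (hφ k).1 (hφ k).2.1 (hφ k).2.2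
  simp only [h0] at this
  exact (tendsto_nhds_unique this tendsto_const_nhds)

end WeakForm

section WeakSystem
open MeasureTheory Filter Topology Matrix

variable {α β : Type*} [Fintype α] [Fintype β] [DecidableEq α] [DecidableEq β]

/-- The vector of partial derivatives of a scalar function. -/
noncomputable def grad (θ : EuclideanSpace ℝ α → ℝ) (x : EuclideanSpace ℝ α) : α → ℝ :=
  fun i => fderiv ℝ θ x (EuclideanSpace.single i 1)

/-- The Jacobian matrix of a map between Euclidean spaces. -/
noncomputable def jac (F : EuclideanSpace ℝ α → EuclideanSpace ℝ β) (x : EuclideanSpace ℝ α) :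
    Matrix β α ℝ :=
  Matrix.of fun b i => fderiv ℝ F x (EuclideanSpace.single i 1) b

/-- The Jacobian matrix of a family of scalar functions. -/
noncomputable def famJac {κ : Type*} (Y : κ → EuclideanSpace ℝ α → ℝ) (x : EuclideanSpace ℝ α) :
    Matrix κ α ℝ :=
  Matrix.of fun k i => fderiv ℝ (Y k) x (EuclideanSpace.single i 1)

/-- The weak minimal surface system on `Ω`, with the equations for the horizontal and the vertical
coordinates put together. -/
def IsWeakMSS (Ω : Set (EuclideanSpace ℝ α)) (F : EuclideanSpace ℝ α → EuclideanSpace ℝ β) :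
    Prop :=
  ∀ φ : EuclideanSpace ℝ α → ℝ, ContDiff ℝ (⊤ : ℕ∞) φ → HasCompactSupport φ → tsupport φ ⊆ Ω →
    ∀ k : α ⊕ β, ∫ x in Ω, ∑ i, √(graphGram (jac F x)).det *
      ((graphGram (jac F x))⁻¹ * (graphMap (jac F x))ᵀ) i k *
        fderiv ℝ φ x (EuclideanSpace.single i 1) = 0

lemma continuous_graphGram : Continuous fun A : Matrix β α ℝ => graphGram A := by
  unfold graphGram
  exact continuous_const.add (continuous_id.matrix_transpose.matrix_mul continuous_id)

lemma continuous_graphGram_det : Continuous fun A : Matrix β α ℝ => (graphGram A).det :=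
  continuous_graphGram.matrix_det

lemma continuous_graphGram_inv : Continuous fun A : Matrix β α ℝ => (graphGram A)⁻¹ := by
  have h1 : Continuous fun A : Matrix β α ℝ => ((graphGram A).det)⁻¹ :=
    continuous_graphGram_det.inv₀ fun A => (isUnit_det_graphGram A).ne_zero
  have h2 : Continuous fun A : Matrix β α ℝ => (graphGram A).adjugate :=
    continuous_graphGram.matrix_adjugate
  refine (h1.smul h2).congr fun A => ?_
  rw [Matrix.inv_def, Ring.inverse_eq_inv']
  rfl

lemma continuous_graphMap : Continuous (graphMap : Matrix β α ℝ → Matrix (α ⊕ β) α ℝ) := by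
  refine continuous_pi fun k => continuous_pi fun i => ?_
  cases k
  · simpa only [graphMap, fromRows_apply_inl] using continuous_const
  · simp only [graphMap, fromRows_apply_inr]; fun_prop

lemma continuous_graph_coef (i : α) (k : α ⊕ β) : Continuous fun A : Matrix β α ℝ =>
    √(graphGram A).det * ((graphGram A)⁻¹ * (graphMap A)ᵀ) i k := by
  refine (Real.continuous_sqrt.comp continuous_graphGram_det).mul ?_
  exact (continuous_graphGram_inv.matrix_mul continuous_graphMap.matrix_transpose).matrix_elem i k

lemma exists_bound_of_continuous {c : Matrix β α ℝ → ℝ} (hc : Continuous c) (K : ℝ) :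
    ∃ C, ∀ A : Matrix β α ℝ, (∀ i j, |A i j| ≤ K) → |c A| ≤ C := by
  have hcomp : IsCompact (Set.univ.pi fun _ : β => Set.univ.pi fun _ : α => Set.Icc (-K) K) :=
    isCompact_univ_pi fun _ => isCompact_univ_pi fun _ => isCompact_Icc
  obtain ⟨C, hC⟩ := hcomp.exists_bound_of_continuousOn hc.continuousOn
  exact ⟨C, fun A hA => hC A fun i _ j _ => abs_le.1 (hA i j)⟩

lemma abs_euclidean_apply_le (y : EuclideanSpace ℝ β) (b : β) : |y b| ≤ ‖y‖ := by
  simpa using PiLp.norm_apply_le y b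

lemma abs_jac_le {F : EuclideanSpace ℝ α → EuclideanSpace ℝ β} {K : NNReal}
    (hF : LipschitzWith K F) (x : EuclideanSpace ℝ α) (b : β) (i : α) : |jac F x b i| ≤ K := by
  refine (abs_euclidean_apply_le _ b).trans ?_
  refine ((fderiv ℝ F x).le_opNorm _).trans ?_
  simpa using norm_fderiv_le_of_lipschitz ℝ hF (x₀ := x)

lemma measurable_comp_jac {c : Matrix β α ℝ → ℝ} (hc : Continuous c)
    (F : EuclideanSpace ℝ α → EuclideanSpace ℝ β) : Measurable fun x => c (jac F x) := by
  have h : Measurable fun x => fun b i => jac F x b i := by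
    refine measurable_pi_lambda _ fun b => measurable_pi_lambda _ fun i => ?_
    exact ((PiLp.continuous_apply 2 _ b).measurable).comp
      (measurable_fderiv_apply_const ℝ F (EuclideanSpace.single i 1))
  have hc' : Continuous (fun A : β → α → ℝ => c (Matrix.of A)) := hc
  exact hc'.measurable.comp h

lemma weak_field {Ω : Set (EuclideanSpace ℝ α)} (hΩ : IsOpen Ω) (hfin : volume Ω ≠ ⊤)
    {F : EuclideanSpace ℝ α → EuclideanSpace ℝ β} {K : NNReal} (hF : LipschitzWith K F)
    (hw : IsWeakMSS Ω F) {Y : α ⊕ β → EuclideanSpace ℝ α → ℝ}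
    (hY : ∀ k, ∃ L, LipschitzWith L (Y k)) (hYc : ∀ k, HasCompactSupport (Y k))
    (hYs : ∀ k, tsupport (Y k) ⊆ Ω) :
    IntegrableOn (fun x => √(graphGram (jac F x)).det *
      ((graphGram (jac F x))⁻¹ * (graphMap (jac F x))ᵀ * famJac Y x).trace) Ω ∧
    ∫ x in Ω, √(graphGram (jac F x)).det *
      ((graphGram (jac F x))⁻¹ * (graphMap (jac F x))ᵀ * famJac Y x).trace = 0 := by
  have hfm : IsFiniteMeasure (volume.restrict Ω) := ⟨by simpa using hfin.lt_top⟩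
  have heq : ∀ x, √(graphGram (jac F x)).det *
      ((graphGram (jac F x))⁻¹ * (graphMap (jac F x))ᵀ * famJac Y x).trace =
      ∑ k, ∑ i, √(graphGram (jac F x)).det *
      ((graphGram (jac F x))⁻¹ * (graphMap (jac F x))ᵀ) i k *
        fderiv ℝ (Y k) x (EuclideanSpace.single i 1) := fun x => by
    simp only [Matrix.trace, Matrix.diag_apply]
    rw [Finset.mul_sum, Finset.sum_comm]
    refine Finset.sum_congr rfl fun i _ => ?_
    rw [Matrix.mul_apply, Finset.mul_sum]
    refine Finset.sum_congr rfl fun k _ => ?_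
    rw [mul_assoc]; rfl
  have hb : ∀ i k, ∃ C, ∀ x, |√(graphGram (jac F x)).det *
      ((graphGram (jac F x))⁻¹ * (graphMap (jac F x))ᵀ) i k| ≤ C := fun i k => by
    obtain ⟨C, hC⟩ := exists_bound_of_continuous (continuous_graph_coef (α := α) (β := β) i k) K
    exact ⟨C, fun x => hC _ (abs_jac_le hF x)⟩
  have hm : ∀ i k, Measurable fun x => √(graphGram (jac F x)).det *
      ((graphGram (jac F x))⁻¹ * (graphMap (jac F x))ᵀ) i k := fun i k =>
    measurable_comp_jac (continuous_graph_coef (α := α) (β := β) i k) F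
  have hint : ∀ k i, IntegrableOn (fun x => √(graphGram (jac F x)).det *
      ((graphGram (jac F x))⁻¹ * (graphMap (jac F x))ᵀ) i k *
        fderiv ℝ (Y k) x (EuclideanSpace.single i 1)) Ω := fun k i => by
    obtain ⟨C, hC⟩ := hb i k
    obtain ⟨L, hL⟩ := hY k
    have hmm := (hm i k).mul
      (measurable_fderiv_apply_const ℝ (Y k) (EuclideanSpace.single i (1 : ℝ)))
    refine Integrable.of_bound hmm.aestronglyMeasurable (C * L)
      (Eventually.of_forall fun x => ?_)
    rw [norm_mul, Real.norm_eq_abs]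
    refine mul_le_mul (hC x) ?_ (norm_nonneg _) ((abs_nonneg _).trans (hC x))
    refine ((fderiv ℝ (Y k) x).le_opNorm _).trans ?_
    simpa using norm_fderiv_le_of_lipschitz ℝ hL (x₀ := x)
  simp only [heq]
  refine ⟨integrable_finsetSum _ fun k _ => integrable_finsetSum _ fun i _ => hint k i, ?_⟩
  rw [integral_finsetSum _ fun k _ => integrable_finsetSum _ fun i _ => hint k i]
  refine Finset.sum_eq_zero fun k _ => ?_
  obtain ⟨L, hL⟩ := hY k
  choose C hC using fun i => hb i k
  refine weak_eq_lipschitz hΩ (fun i x => √(graphGram (jac F x)).det *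
      ((graphGram (jac F x))⁻¹ * (graphMap (jac F x))ᵀ) i k)
      (fun i => EuclideanSpace.single i 1) (C := ∑ i, |C i|)
      (fun i x => (hC i x).trans ((le_abs_self _).trans
        (Finset.single_le_sum (f := fun i => |C i|) (fun _ _ => abs_nonneg _)
          (Finset.mem_univ i))))
      (fun i => (hm i k).aestronglyMeasurable) hfin
      (fun φ h1 h2 h3 => hw φ h1 h2 h3 k) hL (hYc k) (hYs k)

end WeakSystem

section RadialTest
open MeasureTheory Filter Topology Matrix

lemma hasDerivAt_radial {s z : ℝ} (h : 0 < z + s ^ 2) (D : ℕ) :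
    HasDerivAt (fun z => (√(z + s ^ 2))⁻¹ ^ D)
      (-(D / 2) * (√(z + s ^ 2))⁻¹ ^ (D + 2)) z := by
  have hq : 0 < √(z + s ^ 2) := Real.sqrt_pos.2 h
  have h1 : HasDerivAt (fun z => √(z + s ^ 2)) (1 / (2 * √(z + s ^ 2))) z :=
    ((hasDerivAt_id z).add_const (s ^ 2)).sqrt h.ne'
  refine ((h1.inv hq.ne').pow D).congr_deriv ?_
  rcases D with _ | D
  · simp
  · simp only [Nat.add_sub_cancel, Pi.inv_apply]
    push_cast
    rw [show -(1 / (2 * √(z + s ^ 2))) / √(z + s ^ 2) ^ 2 =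
      -(√(z + s ^ 2))⁻¹ ^ 3 / 2 by field_simp]
    ring

lemma contDiffAt_radial {s z : ℝ} (h : 0 < z + s ^ 2) (D : ℕ) :
    ContDiffAt ℝ 1 (fun z => (√(z + s ^ 2))⁻¹ ^ D) z := by
  have hq : 0 < √(z + s ^ 2) := Real.sqrt_pos.2 h
  exact (((contDiffAt_id.add contDiffAt_const).sqrt h.ne').inv hq.ne').pow D

lemma exists_lipschitzWith_of_hasCompactSupport {E : Type*} [NormedAddCommGroup E]
    [NormedSpace ℝ E] [FiniteDimensional ℝ E] {ψ : E → ℝ} (hψ : LocallyLipschitz ψ)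
    (hc : HasCompactSupport ψ) : ∃ L, LipschitzWith L ψ := by
  obtain ⟨r, hr⟩ := hc.isCompact.isBounded.subset_closedBall (0 : E)
  obtain ⟨C, hC⟩ := hψ.continuous.bounded_above_of_compact_support hc
  have : ProperSpace E := FiniteDimensional.proper ℝ E
  obtain ⟨K, hK⟩ := (hψ.locallyLipschitzOn (s := Metric.closedBall 0 (r + 1))
    ).exists_lipschitzOnWith_of_compact (isCompact_closedBall (0 : E) (r + 1))
  have hC0 : 0 ≤ C := (norm_nonneg _).trans (hC 0)
  have hout : ∀ x y, x ∈ Metric.closedBall (0 : E) r → y ∉ Metric.closedBall (0 : E) (r + 1) →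
      dist (ψ x) (ψ y) ≤ C * dist x y := fun x y hx hy => by
    have hy0 : ψ y = 0 := by
      by_contra h
      have := hr (subset_tsupport _ h)
      exact hy (Metric.closedBall_subset_closedBall (by linarith) this)
    rw [hy0, dist_zero_right]
    refine (hC x).trans (le_mul_of_one_le_right hC0 ?_)
    simp only [Metric.mem_closedBall, not_le] at hx hy
    have := dist_triangle y x 0
    rw [dist_comm y x] at this
    linarith
  have hz : ∀ x, x ∉ Metric.closedBall (0 : E) r → ψ x = 0 := fun x hx => by
    by_contra h
    exact hx (hr (subset_tsupport _ h))
  refine ⟨K + ⟨C, hC0⟩, LipschitzWith.of_dist_le_mul fun x y => ?_⟩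
  have hd := dist_nonneg (x := x) (y := y)
  have hK0 : (0 : ℝ) ≤ K := K.coe_nonneg
  have hcoe : ((K + ⟨C, hC0⟩ : NNReal) : ℝ) = K + C := rfl
  rw [hcoe, add_mul]
  by_cases hx : x ∈ Metric.closedBall (0 : E) (r + 1)
  · by_cases hy : y ∈ Metric.closedBall (0 : E) (r + 1)
    · exact (hK.dist_le_mul x hx y hy).trans (le_add_of_nonneg_right (by positivity))
    · by_cases hx' : x ∈ Metric.closedBall (0 : E) r
      · exact (hout x y hx' hy).trans (le_add_of_nonneg_left (by positivity))
      · rw [hz x hx', hz y (fun h => hy (Metric.closedBall_subset_closedBall (by linarith) h)),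
          dist_self]
        positivity
  · by_cases hy : y ∈ Metric.closedBall (0 : E) r
    · rw [dist_comm, dist_comm x y]
      exact (hout y x hy hx).trans (le_add_of_nonneg_left (by positivity))
    · rw [hz y hy, hz x (fun h => hx (Metric.closedBall_subset_closedBall (by linarith) h)),
          dist_self]
      positivity

variable {α β : Type*} [Fintype α] [Fintype β] [DecidableEq α] [DecidableEq β]

lemma trace_mul_radial (A : Matrix β α ℝ) (φ φ' θ : ℝ) (a : α → ℝ) (y : α ⊕ β → ℝ)
    (Z : Matrix (α ⊕ β) α ℝ) {W : Matrix (α ⊕ β) α ℝ}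
    (hW : ∀ k i, W k i = a i * φ * y k + θ * (φ' * ∑ j, 2 * y j * Z j i) * y k + θ * φ * Z k i) :
    ((graphGram A)⁻¹ * (graphMap A)ᵀ * W).trace = testDensity A φ φ' θ a y Z := by
  have : W = φ • vecMulVec y a + (2 * θ * φ') • vecMulVec y (Zᵀ *ᵥ y) + (θ * φ) • Z := by
    ext k i
    simp only [hW, Matrix.add_apply, Matrix.smul_apply, vecMulVec_apply, smul_eq_mul, mulVec, dotProduct,
      transpose_apply]
    have : ∑ j, 2 * y j * Z j i = 2 * ∑ j, Z j i * y j := by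
      rw [Finset.mul_sum]; exact Finset.sum_congr rfl fun _ _ => by ring
    rw [this]; ring
  have htr : ∀ (M : Matrix α (α ⊕ β) ℝ) (b : α → ℝ),
      (M * vecMulVec y b).trace = b ⬝ᵥ (M *ᵥ y) := fun M b => by
    rw [mul_vecMulVec, trace_vecMulVec, dotProduct_comm]
  rw [this, testDensity, Matrix.mul_add, Matrix.mul_add, trace_add, trace_add,
    Matrix.mul_smul, Matrix.mul_smul, Matrix.mul_smul, trace_smul, trace_smul, trace_smul, htr, htr]
  rw [mulVec_transpose, ← dotProduct_mulVec]
  simp only [smul_eq_mul]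
  ring

/-- The weak minimal surface system tested with `θ φ(|X|²) X`, where `φ(z) = (z + s²)^(-D/2)` and
`X` is a `C¹` expression in the point and the value of the solution. -/
lemma weak_radial_test {Ω S : Set (EuclideanSpace ℝ α)} (hΩ : IsOpen Ω) (hfin : volume Ω ≠ ⊤)
    {F : EuclideanSpace ℝ α → EuclideanSpace ℝ β} {K : NNReal} (hF : LipschitzWith K F)
    (hw : IsWeakMSS Ω F) {θ : EuclideanSpace ℝ α → ℝ} (hθ : ContDiff ℝ 1 θ)
    (hθc : HasCompactSupport θ) (hθs : tsupport θ ⊆ Ω ∩ S)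
    {X : α ⊕ β → EuclideanSpace ℝ α × EuclideanSpace ℝ β → ℝ}
    (hX : ∀ k, ∀ x ∈ S, ∀ y, ContDiffAt ℝ 1 (X k) (x, y)) {s : ℝ} (hs : 0 < s) (D : ℕ)
    {Xh : α ⊕ β → EuclideanSpace ℝ α → ℝ} (hXh : ∀ k x, Xh k x = X k (x, F x)) :
    let q := fun x => (√((fun k => Xh k x) ⬝ᵥ (fun k => Xh k x) + s ^ 2))⁻¹
    let I := fun x => √(graphGram (jac F x)).det * testDensity (jac F x) (q x ^ D)
      (-(D / 2) * q x ^ (D + 2)) (θ x) (grad θ x) (fun k => Xh k x) (famJac Xh x)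
    IntegrableOn I Ω ∧ ∫ x in Ω, I x = 0 := by
  intro q I
  have hpos : ∀ v : α ⊕ β → ℝ, 0 < v ⬝ᵥ v + s ^ 2 := fun v => by
    have : 0 ≤ v ⬝ᵥ v := Finset.sum_nonneg fun _ _ => mul_self_nonneg _
    positivity
  let Ξ : α ⊕ β → EuclideanSpace ℝ α × EuclideanSpace ℝ β → ℝ := fun k p =>
    θ p.1 * (√((fun j => X j p) ⬝ᵥ (fun j => X j p) + s ^ 2))⁻¹ ^ D * X k p
  have hΞ : ∀ k, ContDiff ℝ 1 (Ξ k) := fun k => by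
    rw [contDiff_iff_contDiffAt]
    rintro ⟨x, y⟩
    by_cases hx : x ∈ S
    · have h1 : ContDiffAt ℝ 1 (fun p => (fun j => X j p) ⬝ᵥ (fun j => X j p)) (x, y) :=
        ContDiffAt.sum fun j _ => (hX j x hx y).mul (hX j x hx y)
      have h2 := (contDiffAt_radial (hpos fun j => X j (x, y)) D).comp (x, y) h1
      exact ((hθ.contDiffAt.comp (x, y) contDiffAt_fst).mul h2).mul (hX k x hx y)
    · have hx' : x ∉ tsupport θ := fun h => hx (hθs h).2
      have h0 : θ =ᶠ[𝓝 x] 0 := notMem_tsupport_iff_eventuallyEq.1 hx'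
      have h1 : Ξ k =ᶠ[𝓝 (x, y)] fun _ => 0 := by
        filter_upwards [continuousAt_fst.eventually h0] with p hp
        simp only [Ξ]
        rw [show θ p.1 = 0 from hp, zero_mul, zero_mul]
      exact contDiffAt_const.congr_of_eventuallyEq h1
  let Y : α ⊕ β → EuclideanSpace ℝ α → ℝ := fun k x => Ξ k (x, F x)
  have hYdef : ∀ k x, Y k x = θ x * q x ^ D * Xh k x := fun k x => by
    simp only [Y, Ξ, q, hXh]
  have hYsupp : ∀ k, tsupport (Y k) ⊆ tsupport θ := fun k => by
    refine closure_mono fun x hx => ?_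
    by_contra h
    have h0 : θ x = 0 := by simpa using h
    exact hx (by rw [hYdef, h0, zero_mul, zero_mul])
  have hYc : ∀ k, HasCompactSupport (Y k) := fun k =>
    hθc.of_isClosed_subset (isClosed_tsupport _) (hYsupp k)
  have hYL : ∀ k, ∃ L, LipschitzWith L (Y k) := fun k => by
    refine exists_lipschitzWith_of_hasCompactSupport ?_ (hYc k)
    exact (hΞ k).locallyLipschitz.comp (LipschitzWith.id.prodMk hF).locallyLipschitz
  have hmain := weak_field hΩ hfin hF hw hYL hYc
    (fun k => (hYsupp k).trans fun x hx => (hθs hx).1)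
  have hae : ∀ᵐ x ∂(volume.restrict Ω), √(graphGram (jac F x)).det *
      ((graphGram (jac F x))⁻¹ * (graphMap (jac F x))ᵀ * famJac Y x).trace = I x := by
    filter_upwards [ae_restrict_of_ae hF.ae_differentiableAt] with x hFx
    simp only [I]
    congr 1
    apply trace_mul_radial
    intro k i
    by_cases hx : x ∈ S
    · have hd : ∀ j, HasFDerivAt (Xh j) (fderiv ℝ (Xh j) x) x := fun j => by
        refine DifferentiableAt.hasFDerivAt ?_
        have h1 : DifferentiableAt ℝ (fun x => X j (x, F x)) x :=
          ((hX j x hx (F x)).differentiableAt one_ne_zero).comp x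
            (differentiableAt_id.prodMk hFx)
        exact h1.congr_of_eventuallyEq (Eventually.of_forall fun z => hXh j z)
      have hθ' : HasFDerivAt θ (fderiv ℝ θ x) x := (hθ.differentiable one_ne_zero x).hasFDerivAt
      have hsq : HasFDerivAt (fun x => (fun j => Xh j x) ⬝ᵥ (fun j => Xh j x))
          (∑ j, (Xh j x • fderiv ℝ (Xh j) x + Xh j x • fderiv ℝ (Xh j) x)) x :=
        HasFDerivAt.fun_sum fun j _ => (hd j).mul (hd j)
      have hq := (hasDerivAt_radial (hpos fun j => Xh j x) D).comp_hasFDerivAt x hsq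
      have hY := (hθ'.mul hq).mul (hd k)
      have hY' : fderiv ℝ (Y k) x = _ :=
        (hY.congr_of_eventuallyEq (Eventually.of_forall fun z => hYdef k z)).fderiv
      simp only [famJac, of_apply, hY', grad, q]
      simp only [_root_.add_apply, _root_.smul_apply,
        _root_.sum_apply, smul_eq_mul, Function.comp_apply, Pi.mul_apply]
      have : ∀ j, 2 * Xh j x * fderiv ℝ (Xh j) x (EuclideanSpace.single i 1) =
        Xh j x * fderiv ℝ (Xh j) x (EuclideanSpace.single i 1) +
        Xh j x * fderiv ℝ (Xh j) x (EuclideanSpace.single i 1) := fun j => by ring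
      simp only [this]
      ring
    · have hx' : x ∉ tsupport θ := fun h => hx (hθs h).2
      have h0 : θ =ᶠ[𝓝 x] 0 := notMem_tsupport_iff_eventuallyEq.1 hx'
      have h1 : Y k =ᶠ[𝓝 x] fun _ => 0 := by
        filter_upwards [h0] with z hz
        rw [hYdef, show θ z = 0 from hz, zero_mul, zero_mul]
      have h2 : θ x = 0 := h0.eq_of_nhds
      have h3 : fderiv ℝ θ x = 0 := by rw [h0.fderiv_eq]; simp
      simp [famJac, grad, h2, h3, h1.fderiv_eq]
  exact ⟨hmain.1.congr hae, (integral_congr_ae hae).symm.trans hmain.2⟩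

end RadialTest

section Cutoffs
open MeasureTheory Filter Topology Matrix

/-- The derivative of the standard smooth transition function. -/
noncomputable def stepDeriv (t : ℝ) : ℝ := deriv Real.smoothTransition t

lemma hasDerivAt_step (t : ℝ) : HasDerivAt Real.smoothTransition (stepDeriv t) t :=
  ((Real.smoothTransition.contDiff (n := 1)).differentiable one_ne_zero t).hasDerivAt

lemma continuous_stepDeriv : Continuous stepDeriv :=
  (Real.smoothTransition.contDiff (n := 1)).continuous_deriv le_rfl

lemma stepDeriv_nonneg (t : ℝ) : 0 ≤ stepDeriv t := Real.smoothTransition.monotone.deriv_nonneg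

lemma stepDeriv_eq_zero_of_nonpos {t : ℝ} (ht : t ≤ 0) : stepDeriv t = 0 := by
  have h1 : IsLocalMin Real.smoothTransition t :=
    Eventually.of_forall fun z => by
      show Real.smoothTransition t ≤ _
      rw [Real.smoothTransition.zero_of_nonpos ht]; exact Real.smoothTransition.nonneg z
  exact h1.deriv_eq_zero

lemma stepDeriv_eq_zero_of_one_le {t : ℝ} (ht : 1 ≤ t) : stepDeriv t = 0 := by
  have h1 : IsLocalMax Real.smoothTransition t :=
    Eventually.of_forall fun z => by
      show _ ≤ Real.smoothTransition t
      rw [Real.smoothTransition.one_of_one_le ht]; exact Real.smoothTransition.le_one z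
  exact h1.deriv_eq_zero

lemma exists_stepDeriv_le : ∃ C, 0 < C ∧ ∀ t, stepDeriv t ≤ C := by
  obtain ⟨C, hC⟩ := (isCompact_Icc (a := (0 : ℝ)) (b := 1)).exists_bound_of_continuousOn
    continuous_stepDeriv.continuousOn
  refine ⟨|C| + 1, by positivity, fun t => ?_⟩
  by_cases h0 : t ≤ 0
  · rw [stepDeriv_eq_zero_of_nonpos h0]; positivity
  by_cases h1 : 1 ≤ t
  · rw [stepDeriv_eq_zero_of_one_le h1]; positivity
  · have := hC t ⟨(not_le.1 h0).le, (not_le.1 h1).le⟩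
    exact (Real.le_norm_self _).trans (this.trans ((le_abs_self C).trans (by linarith)))

/-- The cutoff vanishing on `t ≤ δ` and equal to `1` on `2δ ≤ t`. -/
noncomputable def cutIn (δ t : ℝ) : ℝ := Real.smoothTransition (t / δ - 1)

/-- The cutoff vanishing on `c ≤ t` and equal to `1` on `t ≤ c / 2`. -/
noncomputable def cutOut (c t : ℝ) : ℝ := Real.smoothTransition (2 - 2 * t / c)

lemma hasDerivAt_cutIn (δ t : ℝ) : HasDerivAt (cutIn δ) (δ⁻¹ * stepDeriv (t / δ - 1)) t := by
  have h : HasDerivAt (fun t => t / δ - 1) δ⁻¹ t := by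
    simpa using ((hasDerivAt_id t).div_const δ).sub_const 1
  exact ((hasDerivAt_step _).comp t h).congr_deriv (mul_comm _ _)

lemma hasDerivAt_cutOut (c t : ℝ) :
    HasDerivAt (cutOut c) (-(2 / c) * stepDeriv (2 - 2 * t / c)) t := by
  have h : HasDerivAt (fun t => 2 - 2 * t / c) (-(2 / c)) t := by
    simpa using (((hasDerivAt_id t).const_mul 2).div_const c).const_sub 2
  exact ((hasDerivAt_step _).comp t h).congr_deriv (mul_comm _ _)

lemma contDiff_cutIn (δ : ℝ) : ContDiff ℝ 2 (cutIn δ) :=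
  (Real.smoothTransition.contDiff (n := 2)).comp ((contDiff_id.div_const δ).sub contDiff_const)

lemma contDiff_cutOut (c : ℝ) : ContDiff ℝ 2 (cutOut c) :=
  (Real.smoothTransition.contDiff (n := 2)).comp
    (contDiff_const.sub ((contDiff_const.mul contDiff_id).div_const c))

lemma cutIn_eq_zero {δ t : ℝ} (hδ : 0 < δ) (h : t ≤ δ) : cutIn δ t = 0 :=
  Real.smoothTransition.zero_of_nonpos (by
    have := (div_le_one hδ).2 h
    linarith)

lemma cutIn_eq_one {δ t : ℝ} (hδ : 0 < δ) (h : 2 * δ ≤ t) : cutIn δ t = 1 :=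
  Real.smoothTransition.one_of_one_le (by
    have := (le_div_iff₀ hδ).2 h
    linarith)

lemma cutOut_eq_zero {c t : ℝ} (hc : 0 < c) (h : c ≤ t) : cutOut c t = 0 :=
  Real.smoothTransition.zero_of_nonpos (by
    have := (le_div_iff₀ hc).2 (show 2 * c ≤ 2 * t by linarith)
    linarith)

lemma cutOut_eq_one {c t : ℝ} (hc : 0 < c) (h : t ≤ c / 2) : cutOut c t = 1 :=
  Real.smoothTransition.one_of_one_le (by
    have := (div_le_one hc).2 (show 2 * t ≤ c by linarith)
    linarith)

lemma cutIn_nonneg (δ t : ℝ) : 0 ≤ cutIn δ t := Real.smoothTransition.nonneg _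
lemma cutIn_le_one (δ t : ℝ) : cutIn δ t ≤ 1 := Real.smoothTransition.le_one _
lemma cutOut_nonneg (δ t : ℝ) : 0 ≤ cutOut δ t := Real.smoothTransition.nonneg _
lemma cutOut_le_one (δ t : ℝ) : cutOut δ t ≤ 1 := Real.smoothTransition.le_one _

variable {α : Type*} [Fintype α] [DecidableEq α]

/-- `u` is a defining function of the bounded open set `Ω`: it is `C²` on the closed set `0 ≤ u`,
and its gradient does not vanish on `0 ≤ u ≤ c`. -/
structure IsDefining (Ω : Set (EuclideanSpace ℝ α)) (u : EuclideanSpace ℝ α → ℝ) (c : ℝ) :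
    Prop where
  cont : Continuous u
  pos_iff : ∀ x, x ∈ Ω ↔ 0 < u x
  compact : IsCompact {x | 0 ≤ u x}
  smooth : ∀ x, 0 ≤ u x → ContDiffAt ℝ 2 u x
  c_pos : 0 < c
  grad_ne : ∀ x, 0 ≤ u x → u x ≤ c → grad u x ≠ 0

namespace IsDefining
variable {Ω : Set (EuclideanSpace ℝ α)} {u : EuclideanSpace ℝ α → ℝ} {c : ℝ}

lemma isOpen (h : IsDefining Ω u c) : IsOpen Ω := by
  have : Ω = {x | 0 < u x} := Set.ext h.pos_iff
  rw [this]; exact isOpen_lt continuous_const h.cont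

lemma volume_ne_top (h : IsDefining Ω u c) : volume Ω ≠ ⊤ :=
  measure_ne_top_of_subset (fun x hx => ((h.pos_iff x).1 hx).le) h.compact.measure_ne_top

lemma contDiffAt_grad (h : IsDefining Ω u c) {x : EuclideanSpace ℝ α} (hx : 0 ≤ u x) (i : α) :
    ContDiffAt ℝ 1 (fun z => grad u z i) x := by
  have : ContDiffAt ℝ 1 (fderiv ℝ u) x := (h.smooth x hx).fderiv_right (by norm_num)
  exact this.clm_apply contDiffAt_const

lemma differentiableAt (h : IsDefining Ω u c) {x : EuclideanSpace ℝ α} (hx : 0 ≤ u x) :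
    DifferentiableAt ℝ u x := (h.smooth x hx).differentiableAt two_ne_zero

lemma tsupport_comp_subset (h : IsDefining Ω u c) {η : ℝ → ℝ} {δ : ℝ}
    (hη0 : ∀ t ≤ δ, η t = 0) : tsupport (fun x => η (u x)) ⊆ {x | δ ≤ u x} := by
  refine closure_minimal (fun x hx => ?_) (isClosed_le continuous_const h.cont)
  by_contra hlt
  exact hx (hη0 _ (not_le.1 hlt).le)

lemma hasCompactSupport_comp (h : IsDefining Ω u c) {η : ℝ → ℝ} {δ : ℝ} (hδ : 0 < δ)
    (hη0 : ∀ t ≤ δ, η t = 0) : HasCompactSupport (fun x => η (u x)) :=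
  h.compact.of_isClosed_subset (isClosed_tsupport _)
    ((h.tsupport_comp_subset hη0).trans fun _ hx => hδ.le.trans hx)

lemma tsupport_comp_subset_domain (h : IsDefining Ω u c) {η : ℝ → ℝ} {δ : ℝ} (hδ : 0 < δ)
    (hη0 : ∀ t ≤ δ, η t = 0) : tsupport (fun x => η (u x)) ⊆ Ω :=
  (h.tsupport_comp_subset hη0).trans fun x hx => (h.pos_iff x).2 (hδ.trans_le hx)

lemma eventually_zero (h : IsDefining Ω u c) {η : ℝ → ℝ} {δ : ℝ}
    (hη0 : ∀ t ≤ δ, η t = 0) {x : EuclideanSpace ℝ α} (hx : u x < δ) :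
    (fun x => η (u x)) =ᶠ[𝓝 x] fun _ => 0 := by
  filter_upwards [h.cont.continuousAt.eventually (gt_mem_nhds hx)] with z hz using hη0 _ (le_of_lt hz)

lemma contDiff_comp (h : IsDefining Ω u c) {η : ℝ → ℝ} (hη : ContDiff ℝ 2 η) {δ : ℝ}
    (hδ : 0 < δ) (hη0 : ∀ t ≤ δ, η t = 0) : ContDiff ℝ 2 (fun x => η (u x)) := by
  rw [contDiff_iff_contDiffAt]
  intro x
  rcases lt_or_ge (u x) δ with hx | hx
  · exact contDiffAt_const.congr_of_eventuallyEq (h.eventually_zero hη0 hx)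
  · exact hη.contDiffAt.comp x (h.smooth x (hδ.le.trans hx))

lemma grad_comp (h : IsDefining Ω u c) {η η' : ℝ → ℝ} (hη : ∀ t, HasDerivAt η (η' t) t) {δ : ℝ}
    (hδ : 0 < δ) (hη0 : ∀ t ≤ δ, η t = 0) (x : EuclideanSpace ℝ α) :
    grad (fun x => η (u x)) x = η' (u x) • grad u x := by
  rcases lt_or_ge (u x) δ with hx | hx
  · have h0 : η =ᶠ[𝓝 (u x)] fun _ => 0 := by
      filter_upwards [gt_mem_nhds hx] with t ht using hη0 t (le_of_lt ht)
    have h1 : η' (u x) = 0 := by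
      rw [← (hη (u x)).deriv, h0.deriv_eq, deriv_const]
    ext i
    simp [grad, h1, (h.eventually_zero hη0 hx).fderiv_eq]
  · ext i
    have := (hη (u x)).comp_hasFDerivAt x (h.differentiableAt (hδ.le.trans hx)).hasFDerivAt
    have h2 : fderiv ℝ (fun x => η (u x)) x = _ := this.fderiv
    simp [grad, h2]

end IsDefining

lemma integral_fderiv_eq_zero {ψ : EuclideanSpace ℝ α → ℝ} (hψ : ContDiff ℝ 1 ψ)
    (hc : HasCompactSupport ψ) (v : EuclideanSpace ℝ α) : ∫ x, fderiv ℝ ψ x v = 0 := by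
  have h1 : Integrable fun x => fderiv ℝ ψ x v :=
    ((hψ.continuous_fderiv one_ne_zero).clm_apply continuous_const).integrable_of_hasCompactSupport
      (hc.fderiv_apply ℝ v)
  have := integral_mul_fderiv_eq_neg_fderiv_mul_of_integrable (𝕜 := ℝ)
    (μ := (volume : Measure (EuclideanSpace ℝ α))) (f := fun _ => (1 : ℝ)) (g := ψ) (v := v)
    (by simp) (by simpa using h1)
    (by simpa using hψ.continuous.integrable_of_hasCompactSupport hc)
    (fun x _ => differentiableAt_const _) (fun x _ => hψ.differentiable one_ne_zero x)
  simpa using this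

/-- The coarea weight of the layer `δ ≤ u ≤ 2δ`. -/
noncomputable def layer (u : EuclideanSpace ℝ α → ℝ) (δ : ℝ) (x : EuclideanSpace ℝ α) : ℝ :=
  δ⁻¹ * stepDeriv (u x / δ - 1) * √(grad u x ⬝ᵥ grad u x)

lemma layer_nonneg (u : EuclideanSpace ℝ α → ℝ) {δ : ℝ} (hδ : 0 < δ) (x : EuclideanSpace ℝ α) :
    0 ≤ layer u δ x :=
  mul_nonneg (mul_nonneg (inv_nonneg.2 hδ.le) (stepDeriv_nonneg _)) (Real.sqrt_nonneg _)

lemma layer_eq_zero_of_ge {u : EuclideanSpace ℝ α → ℝ} {δ : ℝ} (hδ : 0 < δ)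
    {x : EuclideanSpace ℝ α} (hx : 2 * δ ≤ u x) : layer u δ x = 0 := by
  rw [layer, stepDeriv_eq_zero_of_one_le (by have := (le_div_iff₀ hδ).2 hx; linarith)]; simp

end Cutoffs

section LayerBound
open MeasureTheory Filter Topology Matrix
variable {α : Type*} [Fintype α] [DecidableEq α]

namespace IsDefining
variable {Ω : Set (EuclideanSpace ℝ α)} {u : EuclideanSpace ℝ α → ℝ} {c : ℝ}

lemma continuousOn_grad_sq (h : IsDefining Ω u c) :
    ContinuousOn (fun x => grad u x ⬝ᵥ grad u x) {x | 0 ≤ u x} := fun x hx => by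
  refine ContinuousAt.continuousWithinAt ?_
  exact tendsto_finsetSum _ fun i _ =>
    (h.contDiffAt_grad hx i).continuousAt.mul (h.contDiffAt_grad hx i).continuousAt

lemma grad_sq_pos (h : IsDefining Ω u c) {x : EuclideanSpace ℝ α} (hx : 0 ≤ u x)
    (hxc : u x ≤ c) : 0 < grad u x ⬝ᵥ grad u x :=
  lt_of_le_of_ne (dotProduct_self_nonneg' _)
    (fun h0 => h.grad_ne x hx hxc (dotProduct_self_eq_zero.1 h0.symm))

lemma exists_grad_lower (h : IsDefining Ω u c) :
    ∃ c₀, 0 < c₀ ∧ ∀ x, 0 ≤ u x → u x ≤ c → c₀ ≤ √(grad u x ⬝ᵥ grad u x) := by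
  have hcomp : IsCompact {x | 0 ≤ u x ∧ u x ≤ c} :=
    h.compact.of_isClosed_subset ((isClosed_le continuous_const h.cont).inter
      (isClosed_le h.cont continuous_const)) fun x hx => hx.1
  obtain ⟨C, hC⟩ := hcomp.exists_bound_of_continuousOn
    (f := fun x => (√(grad u x ⬝ᵥ grad u x))⁻¹)
    (((h.continuousOn_grad_sq.mono fun x hx => hx.1).sqrt).inv₀ fun x hx =>
      (Real.sqrt_pos.2 (h.grad_sq_pos hx.1 hx.2)).ne')
  refine ⟨(|C| + 1)⁻¹, by positivity, fun x hx hxc => ?_⟩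
  have h1 := Real.sqrt_pos.2 (h.grad_sq_pos hx hxc)
  refine inv_le_of_inv_le₀ h1 ?_
  have := (Real.le_norm_self _).trans (hC x ⟨hx, hxc⟩)
  exact this.trans ((le_abs_self C).trans (by linarith))

lemma exists_grad_upper (h : IsDefining Ω u c) :
    ∃ C, 0 < C ∧ ∀ x, 0 ≤ u x → √(grad u x ⬝ᵥ grad u x) ≤ C := by
  obtain ⟨C, hC⟩ := h.compact.exists_bound_of_continuousOn h.continuousOn_grad_sq.sqrt
  exact ⟨|C| + 1, by positivity, fun x hx => (Real.le_norm_self _).trans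
    ((hC x hx).trans ((le_abs_self C).trans (by linarith)))⟩

lemma grad_cutIn (h : IsDefining Ω u c) {δ : ℝ} (hδ : 0 < δ) (x : EuclideanSpace ℝ α) :
    grad (fun x => cutIn δ (u x)) x = (δ⁻¹ * stepDeriv (u x / δ - 1)) • grad u x :=
  h.grad_comp (hasDerivAt_cutIn δ) hδ (fun _ ht => cutIn_eq_zero hδ ht) x

lemma sqrt_grad_cutIn (h : IsDefining Ω u c) {δ : ℝ} (hδ : 0 < δ) (x : EuclideanSpace ℝ α) :
    √(grad (fun x => cutIn δ (u x)) x ⬝ᵥ grad (fun x => cutIn δ (u x)) x) = layer u δ x := by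
  have h0 : 0 ≤ δ⁻¹ * stepDeriv (u x / δ - 1) :=
    mul_nonneg (inv_nonneg.2 hδ.le) (stepDeriv_nonneg _)
  rw [h.grad_cutIn hδ, smul_dotProduct, dotProduct_smul, smul_eq_mul, smul_eq_mul, ← mul_assoc,
    Real.sqrt_mul (mul_self_nonneg _), Real.sqrt_mul_self h0, layer]

lemma continuous_layer (h : IsDefining Ω u c) {δ : ℝ} (hδ : 0 < δ) : Continuous (layer u δ) := by
  have h1 : ContDiff ℝ 2 (fun x => cutIn δ (u x)) :=
    h.contDiff_comp (contDiff_cutIn δ) hδ (fun _ ht => cutIn_eq_zero hδ ht)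
  have h2 : ∀ i, Continuous fun x => grad (fun x => cutIn δ (u x)) x i := fun i =>
    (h1.continuous_fderiv two_ne_zero).clm_apply continuous_const
  have h3 : Continuous fun x => grad (fun x => cutIn δ (u x)) x ⬝ᵥ
      grad (fun x => cutIn δ (u x)) x :=
    continuous_finsetSum Finset.univ fun i _ => (h2 i).mul (h2 i)
  exact h3.sqrt.congr fun x => h.sqrt_grad_cutIn hδ x

lemma integrableOn_layer (h : IsDefining Ω u c) {δ : ℝ} (hδ : 0 < δ) :
    IntegrableOn (layer u δ) Ω :=
  ((h.continuous_layer hδ).continuousOn.integrableOn_compact h.compact).mono_set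
    fun x hx => ((h.pos_iff x).1 hx).le

lemma integral_divergence (h : IsDefining Ω u c) {η η' : ℝ → ℝ} (hη2 : ContDiff ℝ 2 η)
    (hη : ∀ t, HasDerivAt η (η' t) t) {δ : ℝ} (hδ : 0 < δ) (hη0 : ∀ t ≤ δ, η t = 0) :
    IntegrableOn (fun x => η' (u x) * (grad u x ⬝ᵥ grad u x) +
      η (u x) * ∑ k, grad (fun z => grad u z k) x k) Ω ∧
    ∫ x in Ω, (η' (u x) * (grad u x ⬝ᵥ grad u x) +
      η (u x) * ∑ k, grad (fun z => grad u z k) x k) = 0 := by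
  have hη'0 : ∀ t < δ, η' t = 0 := fun t ht => by
    have h0 : η =ᶠ[𝓝 t] fun _ => 0 := by
      filter_upwards [gt_mem_nhds ht] with t ht using hη0 t (le_of_lt ht)
    rw [← (hη t).deriv, h0.deriv_eq, deriv_const]
  let ψ : α → EuclideanSpace ℝ α → ℝ := fun k x => η (u x) * grad u x k
  have hψz : ∀ k x, u x < δ → ψ k =ᶠ[𝓝 x] fun _ => 0 := fun k x hx => by
    filter_upwards [h.eventually_zero hη0 hx] with z hz
    simp only [ψ]; rw [hz, zero_mul]
  have hψ : ∀ k, ContDiff ℝ 1 (ψ k) := fun k => by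
    rw [contDiff_iff_contDiffAt]
    intro x
    rcases lt_or_ge (u x) δ with hx | hx
    · exact contDiffAt_const.congr_of_eventuallyEq (hψz k x hx)
    · exact ((h.contDiff_comp hη2 hδ hη0).contDiffAt.of_le one_le_two).mul
        (h.contDiffAt_grad (hδ.le.trans hx) k)
  have hψc : ∀ k, HasCompactSupport (ψ k) := fun k => (h.hasCompactSupport_comp hδ hη0).mul_right
  have hd : ∀ k x, fderiv ℝ (ψ k) x (EuclideanSpace.single k 1) =
      η' (u x) * (grad u x k * grad u x k) + η (u x) * grad (fun z => grad u z k) x k :=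
    fun k x => by
    rcases lt_or_ge (u x) δ with hx | hx
    · rw [(hψz k x hx).fderiv_eq, hη'0 _ hx, hη0 _ hx.le]; simp
    · have hx0 := hδ.le.trans hx
      have h1 : DifferentiableAt ℝ (fun x => η (u x)) x :=
        (h.contDiff_comp hη2 hδ hη0).differentiable two_ne_zero x
      have h2 : DifferentiableAt ℝ (fun z => grad u z k) x :=
        (h.contDiffAt_grad hx0 k).differentiableAt one_ne_zero
      have h3 : fderiv ℝ (ψ k) x = _ := (h1.hasFDerivAt.mul h2.hasFDerivAt).fderiv
      have h4 : fderiv ℝ (fun x => η (u x)) x (EuclideanSpace.single k 1) =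
          η' (u x) * grad u x k := congrFun (h.grad_comp hη hδ hη0 x) k
      rw [h3]
      simp only [_root_.add_apply, _root_.smul_apply, smul_eq_mul, h4]
      simp only [grad]; ring
  have hsum : ∀ x, η' (u x) * (grad u x ⬝ᵥ grad u x) +
      η (u x) * ∑ k, grad (fun z => grad u z k) x k =
      ∑ k, fderiv ℝ (ψ k) x (EuclideanSpace.single k 1) := fun x => by
    simp only [hd, dotProduct, Finset.mul_sum, Finset.sum_add_distrib]
  have hint : ∀ k, Integrable fun x => fderiv ℝ (ψ k) x (EuclideanSpace.single k 1) := fun k =>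
    (((hψ k).continuous_fderiv one_ne_zero).clm_apply
      continuous_const).integrable_of_hasCompactSupport ((hψc k).fderiv_apply ℝ _)
  simp only [hsum]
  refine ⟨(integrable_finsetSum _ fun k _ => hint k).integrableOn, ?_⟩
  rw [setIntegral_eq_integral_of_forall_compl_eq_zero, integral_finsetSum _ fun k _ => hint k]
  · exact Finset.sum_eq_zero fun k _ => integral_fderiv_eq_zero (hψ k) (hψc k) _
  · intro x hx
    refine Finset.sum_eq_zero fun k _ => ?_
    have : u x < δ := lt_of_le_of_lt (not_lt.1 fun h' => hx ((h.pos_iff x).2 h')) hδ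
    rw [(hψz k x this).fderiv_eq]; simp

/-- The layers `δ ≤ u ≤ 2δ` have uniformly bounded coarea mass. -/
lemma exists_layer_bound (h : IsDefining Ω u c) :
    ∃ C, 0 < C ∧ ∀ δ, 0 < δ → 4 * δ ≤ c → ∫ x in Ω, layer u δ x ≤ C := by
  obtain ⟨c₀, hc₀, hlow⟩ := h.exists_grad_lower
  obtain ⟨C₁, hC₁, hup⟩ := h.exists_grad_upper
  obtain ⟨C₂, hC₂, hst⟩ := exists_stepDeriv_le
  have hLc : ContinuousOn (fun x => ∑ k, grad (fun z => grad u z k) x k) {x | 0 ≤ u x} :=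
    fun x hx => by
      refine ContinuousAt.continuousWithinAt (tendsto_finsetSum _ fun k _ => ?_)
      have : ContDiffAt ℝ 0 (fderiv ℝ fun z => grad u z k) x :=
        (h.contDiffAt_grad hx k).fderiv_right (by norm_num)
      exact this.continuousAt.clm_apply continuousAt_const
  obtain ⟨C₃, hC₃⟩ := h.compact.exists_bound_of_continuousOn hLc
  have hfm : IsFiniteMeasure (volume.restrict Ω) := ⟨by simpa using h.volume_ne_top.lt_top⟩
  have hcp := h.c_pos
  set M := 2 / c * C₂ * C₁ ^ 2 + |C₃| with hM
  have hM0 : 0 ≤ M := by positivity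
  refine ⟨c₀⁻¹ * (M * (volume.real Ω)) + 1, by positivity, fun δ hδ hδc => ?_⟩
  have hη : ∀ t, HasDerivAt (fun t => cutIn δ t * cutOut c t)
      (δ⁻¹ * stepDeriv (t / δ - 1) * cutOut c t +
        cutIn δ t * (-(2 / c) * stepDeriv (2 - 2 * t / c))) t := fun t =>
    (hasDerivAt_cutIn δ t).mul (hasDerivAt_cutOut c t)
  obtain ⟨hI, hI0⟩ := h.integral_divergence ((contDiff_cutIn δ).mul (contDiff_cutOut c)) hη hδ
    (fun t ht => by simp only [cutIn_eq_zero hδ ht, zero_mul])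
  have hpt : ∀ x ∈ Ω, c₀ * layer u δ x ≤
      ((δ⁻¹ * stepDeriv (u x / δ - 1) * cutOut c (u x) +
        cutIn δ (u x) * (-(2 / c) * stepDeriv (2 - 2 * u x / c))) * (grad u x ⬝ᵥ grad u x) +
        cutIn δ (u x) * cutOut c (u x) * ∑ k, grad (fun z => grad u z k) x k) + M := fun x hx => by
    have hx0 := ((h.pos_iff x).1 hx).le
    have hst0 := stepDeriv_nonneg (u x / δ - 1)
    have hδi : 0 ≤ δ⁻¹ := inv_nonneg.2 hδ.le
    have h1 : c₀ * layer u δ x ≤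
        δ⁻¹ * stepDeriv (u x / δ - 1) * cutOut c (u x) * (grad u x ⬝ᵥ grad u x) := by
      rcases le_or_gt (2 * δ) (u x) with h2 | h2
      · rw [layer_eq_zero_of_ge hδ h2, mul_zero]
        exact mul_nonneg (mul_nonneg (mul_nonneg hδi hst0) (cutOut_nonneg _ _))
          (dotProduct_self_nonneg' _)
      · have h3 : c₀ * √(grad u x ⬝ᵥ grad u x) ≤ grad u x ⬝ᵥ grad u x :=
          (mul_le_mul_of_nonneg_right (hlow x hx0 (by linarith)) (Real.sqrt_nonneg _)).trans_eq
            (Real.mul_self_sqrt (dotProduct_self_nonneg' _))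
        rw [cutOut_eq_one hcp (by linarith), mul_one, layer, mul_left_comm]
        exact mul_le_mul_of_nonneg_left h3 (mul_nonneg hδi hst0)
    have hg : grad u x ⬝ᵥ grad u x ≤ C₁ ^ 2 := by
      rw [← Real.sq_sqrt (dotProduct_self_nonneg' (grad u x))]
      exact pow_le_pow_left₀ (Real.sqrt_nonneg _) (hup x hx0) 2
    have h2 : cutIn δ (u x) * (2 / c * stepDeriv (2 - 2 * u x / c)) * (grad u x ⬝ᵥ grad u x) ≤
        2 / c * C₂ * C₁ ^ 2 := by
      refine mul_le_mul ?_ hg (dotProduct_self_nonneg' _) (by positivity)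
      refine (mul_le_of_le_one_left (mul_nonneg (by positivity) (stepDeriv_nonneg _))
        (cutIn_le_one _ _)).trans ?_
      exact mul_le_mul_of_nonneg_left (hst _) (by positivity)
    have h3 : -|C₃| ≤ cutIn δ (u x) * cutOut c (u x) * ∑ k, grad (fun z => grad u z k) x k := by
      refine neg_le_of_abs_le ?_
      rw [abs_mul, abs_of_nonneg (mul_nonneg (cutIn_nonneg _ _) (cutOut_nonneg _ _))]
      refine (mul_le_of_le_one_left (abs_nonneg _) (mul_le_one₀ (cutIn_le_one _ _)
        (cutOut_nonneg _ _) (cutOut_le_one _ _))).trans ((hC₃ x hx0).trans (le_abs_self _))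
    refine h1.trans ?_
    rw [hM, add_mul]
    linarith [h2, h3]
  have hLi := h.integrableOn_layer hδ
  have hmono := setIntegral_mono_on (hLi.const_mul c₀) (hI.add (integrable_const M))
    h.isOpen.measurableSet hpt
  simp only [Pi.add_apply] at hmono
  rw [integral_const_mul, integral_add hI (integrable_const M), hI0, zero_add, setIntegral_const,
    smul_eq_mul, mul_comm (volume.real Ω)] at hmono
  rw [← le_inv_mul_iff₀ hc₀] at hmono
  linarith

end IsDefining
end LayerBound

section StripProjection
open Matrix
variable {α β : Type*} [Fintype α] [DecidableEq α] [Fintype β] [DecidableEq β]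

/-- The orthogonal projection onto the hyperplane orthogonal to `a`. -/
noncomputable def tanProj (a : α → ℝ) : Matrix α α ℝ := 1 - vecMulVec ((a ⬝ᵥ a)⁻¹ • a) a

lemma tanProj_transpose (a : α → ℝ) : (tanProj a)ᵀ = tanProj a := by
  ext i j
  simp [tanProj, vecMulVec_apply, Matrix.one_apply, eq_comm]
  left; ring

lemma one_sub_tanProj (a : α → ℝ) : 1 - tanProj a = vecMulVec ((a ⬝ᵥ a)⁻¹ • a) a := by
  simp [tanProj]

lemma dotProduct_self_ne_zero {a : α → ℝ} (ha : a ≠ 0) : a ⬝ᵥ a ≠ 0 := fun h =>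
  ha (dotProduct_self_eq_zero.1 h)

lemma tanProj_mulVec_self {a : α → ℝ} (ha : a ≠ 0) : tanProj a *ᵥ a = 0 := by
  have h := dotProduct_self_ne_zero ha
  ext i
  simp [tanProj, sub_mulVec, smul_mulVec, vecMulVec_mulVec]
  field_simp
  simp

lemma tanProj_mul_self {a : α → ℝ} (ha : a ≠ 0) : tanProj a * tanProj a = tanProj a := by
  have h := dotProduct_self_ne_zero ha
  have : vecMulVec ((a ⬝ᵥ a)⁻¹ • a) a * vecMulVec ((a ⬝ᵥ a)⁻¹ • a) a =
      vecMulVec ((a ⬝ᵥ a)⁻¹ • a) a := by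
    rw [vecMulVec_mul_vecMulVec]
    simp [h]
  unfold tanProj
  simp only [Matrix.sub_mul, Matrix.mul_sub, Matrix.mul_one, Matrix.one_mul, this]
  simp

lemma trace_one_sub_tanProj {a : α → ℝ} (ha : a ≠ 0) : (1 - tanProj a).trace = 1 := by
  have h := dotProduct_self_ne_zero ha
  rw [one_sub_tanProj, trace_vecMulVec]
  simp [h]

/-- The tangent frame of the graph of a map with differential `H` over the hyperplane `aᗮ`. -/
noncomputable def stripFrame (H : Matrix β α ℝ) (a : α → ℝ) : Matrix (α ⊕ β) α ℝ :=
  fromRows (tanProj a) (H * tanProj a)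

/-- The orthogonal projection onto the complement of the range of `stripFrame H a`. -/
noncomputable def stripProj (H : Matrix β α ℝ) (a : α → ℝ) : Matrix (α ⊕ β) (α ⊕ β) ℝ :=
  1 - stripFrame H a * (graphGram (H * tanProj a))⁻¹ * (stripFrame H a)ᵀ

variable (H : Matrix β α ℝ) {a : α → ℝ}
lemma stripFrame_gram (ha : a ≠ 0) : (stripFrame H a)ᵀ * stripFrame H a =
    graphGram (H * tanProj a) - (1 - tanProj a) := by
  rw [stripFrame, transpose_fromRows, fromCols_mul_fromRows, tanProj_transpose,
    tanProj_mul_self ha, graphGram]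
  abel

lemma stripFrame_mul_one_sub (ha : a ≠ 0) : stripFrame H a * (1 - tanProj a) = 0 := by
  rw [stripFrame, fromRows_mul, Matrix.mul_assoc, Matrix.mul_sub, tanProj_mul_self ha]
  simp

lemma stripGram_inv_mul (ha : a ≠ 0) :
    (graphGram (H * tanProj a))⁻¹ * (1 - tanProj a) = 1 - tanProj a := by
  have h : graphGram (H * tanProj a) * (1 - tanProj a) = 1 - tanProj a := by
    rw [graphGram, Matrix.add_mul, Matrix.mul_assoc, Matrix.mul_assoc, Matrix.mul_sub (tanProj a),
      tanProj_mul_self ha]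
    simp
  rw [← h, ← Matrix.mul_assoc, nonsing_inv_mul _ (isUnit_det_graphGram _), Matrix.one_mul, h]

lemma stripProj_mul_frame (ha : a ≠ 0) : stripProj H a * stripFrame H a = 0 := by
  rw [stripProj, Matrix.sub_mul, Matrix.mul_assoc, stripFrame_gram H ha, Matrix.mul_assoc,
    Matrix.mul_sub, nonsing_inv_mul _ (isUnit_det_graphGram _), stripGram_inv_mul H ha,
    Matrix.mul_sub, stripFrame_mul_one_sub H ha]
  simp

lemma stripProj_transpose (a : α → ℝ) : (stripProj H a)ᵀ = stripProj H a := by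
  simp [stripProj, graphGram_inv_transpose, Matrix.mul_assoc]

lemma stripProj_mul_self (ha : a ≠ 0) : stripProj H a * stripProj H a = stripProj H a := by
  conv_lhs => rw [stripProj.eq_1 H a, Matrix.mul_sub, ← stripProj.eq_1 H a]
  rw [← Matrix.mul_assoc, ← Matrix.mul_assoc, stripProj_mul_frame H ha]
  simp

lemma trace_one_sub_stripProj (ha : a ≠ 0) : (1 - stripProj H a).trace = Fintype.card α - 1 := by
  rw [stripProj, sub_sub_cancel, trace_mul_comm, ← Matrix.mul_assoc, trace_mul_comm,
    stripFrame_gram H ha, Matrix.mul_sub, nonsing_inv_mul _ (isUnit_det_graphGram _),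
    stripGram_inv_mul H ha, trace_sub, trace_one_sub_tanProj ha, trace_one]

lemma stripProj_mulVec_normal (ha : a ≠ 0) :
    stripProj H a *ᵥ (Sum.elim a 0) = Sum.elim a 0 := by
  have h : (stripFrame H a)ᵀ *ᵥ (Sum.elim a 0) = 0 := by
    rw [stripFrame, transpose_fromRows, fromCols_mulVec_sumElim, tanProj_transpose,
      tanProj_mulVec_self ha]
    simp
  rw [stripProj, sub_mulVec, ← mulVec_mulVec, h]
  simp

/-- The displacement from the graph of `h` over a level set, before projection. -/
noncomputable def stripDisp (H : Matrix β α ℝ) (a : α → ℝ) (t : ℝ) (z : β → ℝ) : α ⊕ β → ℝ :=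
  Sum.elim (t • (a ⬝ᵥ a)⁻¹ • a) (z + t • (H *ᵥ ((a ⬝ᵥ a)⁻¹ • a)))

lemma sq_le_strip (ha : a ≠ 0) (t : ℝ) (z : β → ℝ) :
    t ^ 2 ≤ (a ⬝ᵥ a) * ((stripProj H a *ᵥ stripDisp H a t z) ⬝ᵥ
      (stripProj H a *ᵥ stripDisp H a t z)) := by
  have h := dotProduct_self_ne_zero ha
  have h1 : (Sum.elim a 0 : α ⊕ β → ℝ) ⬝ᵥ (stripProj H a *ᵥ stripDisp H a t z) = t := by
    rw [dotProduct_mulVec, ← mulVec_transpose, stripProj_transpose, stripProj_mulVec_normal H ha,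
      stripDisp, sumElim_dotProduct_sumElim]
    simp [h]
  have h2 := dotProduct_sq_le (Sum.elim a 0 : α ⊕ β → ℝ) (stripProj H a *ᵥ stripDisp H a t z)
  rw [h1, sumElim_dotProduct_sumElim] at h2
  simpa using h2

end StripProjection

section EntrywiseSmooth
open Matrix
variable {E : Type*} [NormedAddCommGroup E] [NormedSpace ℝ E]
variable {ι κ μ : Type*} [Fintype ι] [DecidableEq ι] [Fintype κ] [DecidableEq κ]
  [Fintype μ] [DecidableEq μ]

/-- All entries of the matrix-valued function `M` are continuously differentiable at `x`. -/
def EntryC1 (M : E → Matrix ι κ ℝ) (x : E) : Prop :=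
  ∀ i j, ContDiffAt ℝ 1 (fun y => M y i j) x

lemma EntryC1.mul {M : E → Matrix ι κ ℝ} {M' : E → Matrix κ μ ℝ} {x : E} (h : EntryC1 M x)
    (h' : EntryC1 M' x) : EntryC1 (fun y => M y * M' y) x := fun i j => by
  simp only [Matrix.mul_apply]
  exact ContDiffAt.sum fun k _ => (h i k).mul (h' k j)

lemma EntryC1.transpose {M : E → Matrix ι κ ℝ} {x : E} (h : EntryC1 M x) :
    EntryC1 (fun y => (M y)ᵀ) x := fun i j => h j i

lemma EntryC1.const_sub {M : E → Matrix ι κ ℝ} {x : E} (h : EntryC1 M x) (A : Matrix ι κ ℝ) :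
    EntryC1 (fun y => A - M y) x := fun i j => contDiffAt_const.sub (h i j)

lemma EntryC1.const_add {M : E → Matrix ι κ ℝ} {x : E} (h : EntryC1 M x) (A : Matrix ι κ ℝ) :
    EntryC1 (fun y => A + M y) x := fun i j => contDiffAt_const.add (h i j)

lemma EntryC1.det {M : E → Matrix ι ι ℝ} {x : E} (h : EntryC1 M x) :
    ContDiffAt ℝ 1 (fun y => (M y).det) x := by
  simp only [Matrix.det_apply]
  exact ContDiffAt.sum fun σ _ => (contDiffAt_prod fun i _ => h _ _).const_smul _

lemma EntryC1.inv {M : E → Matrix ι ι ℝ} {x : E} (h : EntryC1 M x) (hd : (M x).det ≠ 0) :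
    EntryC1 (fun y => (M y)⁻¹) x := fun i j => by
  have h1 : ∀ y, (M y)⁻¹ i j = ((M y).det)⁻¹ * ((M y).updateRow j (Pi.single i 1)).det := by
    intro y
    rw [Matrix.inv_def, Matrix.smul_apply, adjugate_apply, Ring.inverse_eq_inv', smul_eq_mul]
  simp only [h1]
  refine (h.det.inv hd).mul (EntryC1.det fun k l => ?_)
  simp only [updateRow_apply]
  split_ifs
  · exact contDiffAt_const
  · exact h k l

variable {α β : Type*} [Fintype α] [DecidableEq α] [Fintype β] [DecidableEq β]

lemma contDiffAt_dotProduct {a b : E → α → ℝ} {x : E}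
    (ha : ∀ i, ContDiffAt ℝ 1 (fun y => a y i) x) (hb : ∀ i, ContDiffAt ℝ 1 (fun y => b y i) x) :
    ContDiffAt ℝ 1 (fun y => a y ⬝ᵥ b y) x :=
  ContDiffAt.sum fun i _ => (ha i).mul (hb i)

lemma contDiffAt_normal {a : E → α → ℝ} {x : E} (ha : ∀ i, ContDiffAt ℝ 1 (fun y => a y i) x)
    (h0 : a x ≠ 0) (i : α) : ContDiffAt ℝ 1 (fun y => ((a y ⬝ᵥ a y)⁻¹ • a y) i) x :=
  ((contDiffAt_dotProduct ha ha).inv (dotProduct_self_ne_zero h0)).mul (ha i)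

lemma entryC1_tanProj {a : E → α → ℝ} {x : E} (ha : ∀ i, ContDiffAt ℝ 1 (fun y => a y i) x)
    (h0 : a x ≠ 0) : EntryC1 (fun y => tanProj (a y)) x :=
  EntryC1.const_sub (M := fun y => vecMulVec ((a y ⬝ᵥ a y)⁻¹ • a y) (a y))
    (fun i j => (contDiffAt_normal ha h0 i).mul (ha j)) 1

lemma entryC1_stripProj {a : E → α → ℝ} {H : E → Matrix β α ℝ} {x : E}
    (ha : ∀ i, ContDiffAt ℝ 1 (fun y => a y i) x) (hH : EntryC1 H x) (h0 : a x ≠ 0) :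
    EntryC1 (fun y => stripProj (H y) (a y)) x := by
  have hQ := entryC1_tanProj ha h0
  have hHQ := hH.mul hQ
  have hB : EntryC1 (fun y => stripFrame (H y) (a y)) x := by
    rintro (i | i) j
    · exact hQ i j
    · exact hHQ i j
  have hS : EntryC1 (fun y => graphGram (H y * tanProj (a y))) x :=
    (hHQ.transpose.mul hHQ).const_add 1
  exact ((hB.mul (hS.inv (isUnit_det_graphGram _).ne_zero)).mul hB.transpose).const_sub 1

end EntrywiseSmooth

section StripField
open MeasureTheory Filter Topology Matrix
variable {α β : Type*} [Fintype α] [DecidableEq α] [Fintype β] [DecidableEq β]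

/-- The lift of the normal direction `a / |a|²` to the graph of a map with differential `H`. -/
noncomputable def stripDir (H : Matrix β α ℝ) (a : α → ℝ) : α ⊕ β → ℝ :=
  Sum.elim ((a ⬝ᵥ a)⁻¹ • a) (H *ᵥ ((a ⬝ᵥ a)⁻¹ • a))

lemma stripDisp_apply (H : Matrix β α ℝ) (a : α → ℝ) (t : ℝ) (z : β → ℝ) (j : α ⊕ β) :
    stripDisp H a t z j = (Sum.elim 0 z : α ⊕ β → ℝ) j + t * stripDir H a j := by
  rcases j with j | j <;> simp [stripDisp, stripDir]

lemma graphMap_sub_stripFrame (A H : Matrix β α ℝ) (a : α → ℝ) (j : α ⊕ β) (i : α) :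
    (graphMap A - stripFrame H a) j i =
      fromRows (0 : Matrix α α ℝ) (A - H) j i + a i * stripDir H a j := by
  rcases j with j | j
  · simp [graphMap, stripFrame, stripDir, tanProj, vecMulVec_apply]
    ring
  · simp [graphMap, stripFrame, stripDir, tanProj, Matrix.mul_sub, mul_vecMulVec, vecMulVec_apply,
      mulVec_smul]
    ring

/-- The projected displacement vector field near the boundary graph. -/
noncomputable def stripField (h : EuclideanSpace ℝ α → EuclideanSpace ℝ β)
    (u : EuclideanSpace ℝ α → ℝ) (k : α ⊕ β) (p : EuclideanSpace ℝ α × EuclideanSpace ℝ β) : ℝ :=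
  (stripProj (jac h p.1) (grad u p.1) *ᵥ
    stripDisp (jac h p.1) (grad u p.1) (u p.1) (fun b => p.2 b - h p.1 b)) k

lemma exists_bound_contDiffAt {κ : Type*} [Finite κ] {S : Set (EuclideanSpace ℝ α)}
    (hS : IsCompact S) {Y : κ → EuclideanSpace ℝ α → ℝ}
    (hY : ∀ k, ∀ x ∈ S, ContDiffAt ℝ 1 (Y k) x) :
    ∃ C, 0 ≤ C ∧ ∀ k, ∀ x ∈ S, |Y k x| ≤ C ∧ ∀ i, |grad (Y k) x i| ≤ C := by
  cases nonempty_fintype κ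
  have h1 : ∀ k, ∃ C, ∀ x ∈ S, ‖Y k x‖ ≤ C := fun k =>
    hS.exists_bound_of_continuousOn fun x hx => (hY k x hx).continuousAt.continuousWithinAt
  have h2 : ∀ k, ∃ C, ∀ x ∈ S, ‖fderiv ℝ (Y k) x‖ ≤ C := fun k =>
    hS.exists_bound_of_continuousOn fun x hx =>
      ((hY k x hx).fderiv_right (m := 0) (by norm_num)).continuousAt.continuousWithinAt
  choose C₁ hC₁ using h1
  choose C₂ hC₂ using h2
  have hle : ∀ k, |C₁ k| + |C₂ k| ≤ ∑ k, (|C₁ k| + |C₂ k|) := fun k =>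
    Finset.single_le_sum (f := fun k => |C₁ k| + |C₂ k|) (fun _ _ => by positivity)
      (Finset.mem_univ k)
  refine ⟨∑ k, (|C₁ k| + |C₂ k|), Finset.sum_nonneg fun _ _ => by positivity,
    fun k x hx => ⟨?_, fun i => ?_⟩⟩
  · have := hC₁ k x hx
    rw [Real.norm_eq_abs] at this
    linarith [hle k, le_abs_self (C₁ k), abs_nonneg (C₂ k)]
  · have := (fderiv ℝ (Y k) x).le_opNorm (EuclideanSpace.single i 1)
    rw [PiLp.norm_single, norm_one, mul_one, Real.norm_eq_abs] at this
    have h3 := hC₂ k x hx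
    change |fderiv ℝ (Y k) x (EuclideanSpace.single i 1)| ≤ _
    linarith [hle k, le_abs_self (C₂ k), abs_nonneg (C₁ k)]

lemma hasFDerivAt_coord {F : EuclideanSpace ℝ α → EuclideanSpace ℝ β} {x : EuclideanSpace ℝ α}
    (hF : DifferentiableAt ℝ F x) (b : β) :
    DifferentiableAt ℝ (fun y => F y b) x ∧ ∀ i, grad (fun y => F y b) x i = jac F x b i := by
  have h := (EuclideanSpace.proj (𝕜 := ℝ) b).hasFDerivAt.comp x hF.hasFDerivAt
  refine ⟨h.differentiableAt, fun i => ?_⟩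
  have : (fun y => F y b) = (EuclideanSpace.proj (𝕜 := ℝ) b) ∘ F := rfl
  rw [grad, this, h.fderiv]
  rfl

lemma grad_add_apply {f g : EuclideanSpace ℝ α → ℝ} {x : EuclideanSpace ℝ α}
    (hf : DifferentiableAt ℝ f x) (hg : DifferentiableAt ℝ g x) (i : α) :
    grad (fun y => f y + g y) x i = grad f x i + grad g x i := by
  simp only [grad]
  rw [fderiv_fun_add hf hg, _root_.add_apply]

lemma grad_sub_apply {f g : EuclideanSpace ℝ α → ℝ} {x : EuclideanSpace ℝ α}
    (hf : DifferentiableAt ℝ f x) (hg : DifferentiableAt ℝ g x) (i : α) :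
    grad (fun y => f y - g y) x i = grad f x i - grad g x i := by
  simp only [grad]
  rw [fderiv_fun_sub hf hg, _root_.sub_apply]

lemma grad_mul_apply {f g : EuclideanSpace ℝ α → ℝ} {x : EuclideanSpace ℝ α}
    (hf : DifferentiableAt ℝ f x) (hg : DifferentiableAt ℝ g x) (i : α) :
    grad (fun y => f y * g y) x i = f x * grad g x i + grad f x i * g x := by
  simp only [grad]
  rw [fderiv_fun_mul hf hg, _root_.add_apply, _root_.smul_apply, _root_.smul_apply, smul_eq_mul,
    smul_eq_mul, mul_comm (g x)]

lemma grad_sum_apply {κ : Type*} [Fintype κ] {f : κ → EuclideanSpace ℝ α → ℝ}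
    {x : EuclideanSpace ℝ α} (hf : ∀ k, DifferentiableAt ℝ (f k) x) (i : α) :
    grad (fun y => ∑ k, f k y) x i = ∑ k, grad (f k) x i := by
  simp only [grad]
  rw [fderiv_fun_sum fun k _ => hf k, _root_.sum_apply]

namespace IsDefining
variable {Ω : Set (EuclideanSpace ℝ α)} {u : EuclideanSpace ℝ α → ℝ} {c : ℝ}
  {h : EuclideanSpace ℝ α → EuclideanSpace ℝ β}

lemma isCompact_strip (hd : IsDefining Ω u c) : IsCompact {x | 0 ≤ u x ∧ u x ≤ c} :=
  hd.compact.of_isClosed_subset ((isClosed_le continuous_const hd.cont).inter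
    (isClosed_le hd.cont continuous_const)) fun _ hx => hx.1

lemma entryC1_jac {x : EuclideanSpace ℝ α} (hh : ContDiffAt ℝ 2 h x) : EntryC1 (jac h) x :=
  fun b i => by
  have : ContDiffAt ℝ 1 (fderiv ℝ h) x := hh.fderiv_right (by norm_num)
  exact (EuclideanSpace.proj (𝕜 := ℝ) b).contDiff.contDiffAt.comp x
    (this.clm_apply contDiffAt_const)

lemma entryC1_proj
    (hd : IsDefining Ω u c) (hh : ∀ x, 0 ≤ u x → u x ≤ c → ContDiffAt ℝ 2 h x)
    {x : EuclideanSpace ℝ α} (hx : 0 ≤ u x) (hxc : u x ≤ c) :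
    EntryC1 (fun y => stripProj (jac h y) (grad u y)) x :=
  entryC1_stripProj (hd.contDiffAt_grad hx) (entryC1_jac (hh x hx hxc)) (hd.grad_ne x hx hxc)

lemma contDiffAt_dir
    (hd : IsDefining Ω u c) (hh : ∀ x, 0 ≤ u x → u x ≤ c → ContDiffAt ℝ 2 h x)
    {x : EuclideanSpace ℝ α} (hx : 0 ≤ u x) (hxc : u x ≤ c) (j : α ⊕ β) :
    ContDiffAt ℝ 1 (fun y => stripDir (jac h y) (grad u y) j) x := by
  have hN := contDiffAt_normal (hd.contDiffAt_grad hx) (hd.grad_ne x hx hxc)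
  rcases j with j | j
  · exact hN j
  · exact contDiffAt_dotProduct (fun i => entryC1_jac (hh x hx hxc) j i) hN

lemma contDiffAt_stripField
    (hd : IsDefining Ω u c) (hh : ∀ x, 0 ≤ u x → u x ≤ c → ContDiffAt ℝ 2 h x)
    {x : EuclideanSpace ℝ α} (hx : 0 ≤ u x) (hxc : u x ≤ c)
    (y : EuclideanSpace ℝ β) (k : α ⊕ β) : ContDiffAt ℝ 1 (stripField h u k) (x, y) := by
  have hfst : ∀ {g : EuclideanSpace ℝ α → ℝ}, ContDiffAt ℝ 1 g x →
      ContDiffAt ℝ 1 (fun p : EuclideanSpace ℝ α × EuclideanSpace ℝ β => g p.1) (x, y) :=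
    fun hg => ContDiffAt.comp (x, y) (g := _) (f := Prod.fst) hg contDiffAt_fst
  unfold stripField
  refine contDiffAt_dotProduct (fun j => hfst (hd.entryC1_proj hh hx hxc k j)) fun j => ?_
  simp only [stripDisp_apply]
  refine ContDiffAt.add ?_ ((hfst ((hd.smooth x hx).of_le (by norm_num))).mul
    (hfst (hd.contDiffAt_dir hh hx hxc j)))
  rcases j with j | j
  · exact contDiffAt_const
  · refine ContDiffAt.sub ?_ (hfst (g := fun y => h y j) ?_)
    · exact ((EuclideanSpace.proj (𝕜 := ℝ) j).contDiff.comp contDiff_snd).contDiffAt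
    · exact (EuclideanSpace.proj (𝕜 := ℝ) j).contDiff.contDiffAt.comp x
        ((hh x hx hxc).of_le (by norm_num))

lemma famJac_stripField
    (hd : IsDefining Ω u c) (hh : ∀ x, 0 ≤ u x → u x ≤ c → ContDiffAt ℝ 2 h x)
    {x : EuclideanSpace ℝ α} (hx : 0 ≤ u x) (hxc : u x ≤ c)
    {F : EuclideanSpace ℝ α → EuclideanSpace ℝ β} (hF : DifferentiableAt ℝ F x)
    (k : α ⊕ β) (i : α) :
    (famJac (fun k x => stripField h u k (x, F x)) x -
        stripProj (jac h x) (grad u x) * graphMap (jac F x)) k i =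
      ∑ j, (stripProj (jac h x) (grad u x) k j *
          (u x * grad (fun y => stripDir (jac h y) (grad u y) j) x i) +
        grad (fun y => stripProj (jac h y) (grad u y) k j) x i *
          stripDisp (jac h x) (grad u x) (u x) (fun b => F x b - h x b) j) := by
  have hP := fun j => (hd.entryC1_proj hh hx hxc k j).differentiableAt one_ne_zero
  have hM := fun j => (hd.contDiffAt_dir hh hx hxc j).differentiableAt one_ne_zero
  have hu := hd.differentiableAt hx
  have hhx := (hh x hx hxc).differentiableAt two_ne_zero
  have hz : ∀ j : α ⊕ β, DifferentiableAt ℝ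
      (fun y => (Sum.elim 0 (fun b => F y b - h y b) : α ⊕ β → ℝ) j) x ∧
      ∀ i, grad (fun y => (Sum.elim 0 (fun b => F y b - h y b) : α ⊕ β → ℝ) j) x i =
        fromRows (0 : Matrix α α ℝ) (jac F x - jac h x) j i := by
    rintro (j | j)
    · exact ⟨differentiableAt_const 0, fun i => by simp [grad]⟩
    · refine ⟨(hasFDerivAt_coord hF j).1.sub (hasFDerivAt_coord hhx j).1, fun i => ?_⟩
      simp only [Sum.elim_inr, fromRows_apply_inr, Matrix.sub_apply]
      rw [grad_sub_apply (hasFDerivAt_coord hF j).1 (hasFDerivAt_coord hhx j).1,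
        (hasFDerivAt_coord hF j).2, (hasFDerivAt_coord hhx j).2]
  have hw : ∀ j, DifferentiableAt ℝ
      (fun y => stripDisp (jac h y) (grad u y) (u y) (fun b => F y b - h y b) j) x ∧
      ∀ i, grad (fun y => stripDisp (jac h y) (grad u y) (u y) (fun b => F y b - h y b) j) x i =
        (graphMap (jac F x) - stripFrame (jac h x) (grad u x)) j i +
          u x * grad (fun y => stripDir (jac h y) (grad u y) j) x i := by
    intro j
    simp only [stripDisp_apply]
    have hm : DifferentiableAt ℝ (fun y => u y * stripDir (jac h y) (grad u y) j) x :=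
      hu.mul (hM j)
    refine ⟨(hz j).1.add hm, fun i => ?_⟩
    rw [grad_add_apply (hz j).1 hm, (hz j).2, grad_mul_apply hu (hM j),
      graphMap_sub_stripFrame]
    ring
  have hfam : famJac (fun k x => stripField h u k (x, F x)) x k i =
      ∑ j, grad (fun y => stripProj (jac h y) (grad u y) k j *
        stripDisp (jac h y) (grad u y) (u y) (fun b => F y b - h y b) j) x i :=
    grad_sum_apply (f := fun j y => stripProj (jac h y) (grad u y) k j *
      stripDisp (jac h y) (grad u y) (u y) (fun b => F y b - h y b) j)
      (fun j => (hP j).mul (hw j).1) i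
  have hPT : stripProj (jac h x) (grad u x) * graphMap (jac F x) =
      stripProj (jac h x) (grad u x) * (graphMap (jac F x) - stripFrame (jac h x) (grad u x)) := by
    rw [Matrix.mul_sub, stripProj_mul_frame _ (hd.grad_ne x hx hxc), sub_zero]
  rw [Matrix.sub_apply, hfam, hPT, Matrix.mul_apply, ← Finset.sum_sub_distrib]
  refine Finset.sum_congr rfl fun j _ => ?_
  rw [grad_mul_apply (hP j) (hw j).1, (hw j).2]
  ring

lemma exists_stripField_bound
    (hd : IsDefining Ω u c) (hh : ∀ x, 0 ≤ u x → u x ≤ c → ContDiffAt ℝ 2 h x)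
    (C₁ : ℝ) : ∃ C, 0 < C ∧
    ∀ (F : EuclideanSpace ℝ α → EuclideanSpace ℝ β) (x : EuclideanSpace ℝ α), 0 ≤ u x → u x ≤ c →
    DifferentiableAt ℝ F x → ‖F x - h x‖ ≤ C₁ * u x →
    (∀ k i, |(famJac (fun k x => stripField h u k (x, F x)) x -
        stripProj (jac h x) (grad u x) * graphMap (jac F x)) k i| ≤ C * u x) ∧
    ((fun k => stripField h u k (x, F x)) ⬝ᵥ fun k => stripField h u k (x, F x)) ≤
      (C * u x) ^ 2 := by
  obtain ⟨A, hA0, hA⟩ := exists_bound_contDiffAt (κ := (α ⊕ β) × (α ⊕ β)) hd.isCompact_strip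
    (Y := fun k y => stripProj (jac h y) (grad u y) k.1 k.2)
    fun k x hx => hd.entryC1_proj hh hx.1 hx.2 k.1 k.2
  obtain ⟨B, hB0, hB⟩ := exists_bound_contDiffAt (κ := α ⊕ β) hd.isCompact_strip
    (Y := fun k y => stripDir (jac h y) (grad u y) k)
    fun k x hx => hd.contDiffAt_dir hh hx.1 hx.2 k
  set n : ℝ := ((Fintype.card (α ⊕ β) : ℕ) : ℝ) with hn
  have hn0 : (0 : ℝ) ≤ n := Nat.cast_nonneg _
  set C₀ := |C₁| + B with hC₀
  refine ⟨n * (A * B + A * C₀) + n * (n * (A * C₀)) + 1, by positivity,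
    fun F x hx hxc hF hFh => ?_⟩
  have hw : ∀ j, |stripDisp (jac h x) (grad u x) (u x) (fun b => F x b - h x b) j| ≤
      C₀ * u x := by
    intro j
    rw [stripDisp_apply]
    have h1 : |(Sum.elim 0 (fun b => F x b - h x b) : α ⊕ β → ℝ) j| ≤ |C₁| * u x := by
      rcases j with j | j
      · simp; positivity
      · refine (abs_euclidean_apply_le (F x - h x) j).trans (hFh.trans ?_)
        gcongr
        exact le_abs_self _
    have h2 := (hB j x ⟨hx, hxc⟩).1
    calc _ ≤ |(Sum.elim 0 (fun b => F x b - h x b) : α ⊕ β → ℝ) j| +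
          |u x * stripDir (jac h x) (grad u x) j| := abs_add_le _ _
      _ ≤ |C₁| * u x + u x * B := by
          rw [abs_mul, abs_of_nonneg hx]
          gcongr
      _ = C₀ * u x := by rw [hC₀]; ring
  refine ⟨fun k i => ?_, ?_⟩
  · rw [hd.famJac_stripField hh hx hxc hF]
    calc _ ≤ ∑ j, |stripProj (jac h x) (grad u x) k j *
          (u x * grad (fun y => stripDir (jac h y) (grad u y) j) x i) +
        grad (fun y => stripProj (jac h y) (grad u y) k j) x i *
          stripDisp (jac h x) (grad u x) (u x) (fun b => F x b - h x b) j| :=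
          Finset.abs_sum_le_sum_abs _ _
      _ ≤ ∑ _j : α ⊕ β, (A * (u x * B) + A * (C₀ * u x)) := by
          refine Finset.sum_le_sum fun j _ => (abs_add_le _ _).trans ?_
          rw [abs_mul, abs_mul, abs_mul, abs_of_nonneg hx]
          have h1 := (hA (k, j) x ⟨hx, hxc⟩)
          have h2 := (hB j x ⟨hx, hxc⟩).2 i
          have h3 := hw j
          have h4 := h1.1
          have h5 := h1.2 i
          gcongr
      _ = n * (A * B + A * C₀) * u x := by
          rw [Finset.sum_const, Finset.card_univ, nsmul_eq_mul, ← hn]; ring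
      _ ≤ _ := by
          gcongr
          have : 0 ≤ n * (n * (A * C₀)) := by positivity
          linarith
  · have hX : ∀ k, |stripField h u k (x, F x)| ≤ n * (A * C₀) * u x := fun k => by
      calc |stripField h u k (x, F x)| ≤ ∑ j, |stripProj (jac h x) (grad u x) k j *
          stripDisp (jac h x) (grad u x) (u x) (fun b => F x b - h x b) j| :=
            Finset.abs_sum_le_sum_abs _ _
        _ ≤ ∑ _j : α ⊕ β, A * (C₀ * u x) := by
            refine Finset.sum_le_sum fun j _ => ?_
            rw [abs_mul]
            have h1 := (hA (k, j) x ⟨hx, hxc⟩).1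
            have h3 := hw j
            gcongr
        _ = _ := by rw [Finset.sum_const, Finset.card_univ, nsmul_eq_mul, ← hn]; ring
    have hE : ∀ k, stripField h u k (x, F x) * stripField h u k (x, F x) ≤
        (n * (A * C₀) * u x) ^ 2 := fun k => by
      rw [← abs_mul_abs_self, ← sq]
      exact pow_le_pow_left₀ (abs_nonneg _) (hX k) 2
    calc _ ≤ ∑ _k : α ⊕ β, (n * (A * C₀) * u x) ^ 2 := Finset.sum_le_sum fun k _ => hE k
      _ = n * (n * (A * C₀) * u x) ^ 2 := by
          rw [Finset.sum_const, Finset.card_univ, nsmul_eq_mul, ← hn]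
      _ ≤ (n * (n * (A * C₀)) * u x) ^ 2 := by
          have : n ≤ n ^ 2 := by
            rw [hn]
            exact_mod_cast Nat.le_self_pow two_ne_zero _
          have h2 : (n * (n * (A * C₀)) * u x) ^ 2 = n ^ 2 * (n * (A * C₀) * u x) ^ 2 := by ring
          rw [h2]
          gcongr
      _ ≤ _ := by
          have h0 : 0 ≤ n * (A * B + A * C₀) := by positivity
          gcongr
          linarith

end IsDefining
end StripField

section StripEstimate
open MeasureTheory Filter Topology Matrix
variable {α β : Type*} [Fintype α] [DecidableEq α] [Fintype β] [DecidableEq β]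

/-- The squared size of the tangential part of the difference of two Jacobians. -/
noncomputable def tiltSq (F h : EuclideanSpace ℝ α → EuclideanSpace ℝ β)
    (u : EuclideanSpace ℝ α → ℝ) (x : EuclideanSpace ℝ α) : ℝ :=
  frobSq ((jac F x - jac h x) * tanProj (grad u x))

lemma measurable_grad_apply (u : EuclideanSpace ℝ α → ℝ) (i : α) :
    Measurable fun x => grad u x i := measurable_fderiv_apply_const ℝ u _

lemma measurable_jac_apply (F : EuclideanSpace ℝ α → EuclideanSpace ℝ β) (b : β) (i : α) :
    Measurable fun x => jac F x b i :=
  (EuclideanSpace.proj (𝕜 := ℝ) b).continuous.measurable.comp (measurable_fderiv_apply_const ℝ F _)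

lemma measurable_tanProj_apply (u : EuclideanSpace ℝ α → ℝ) (i j : α) :
    Measurable fun x => tanProj (grad u x) i j := by
  have h : Measurable fun x => grad u x ⬝ᵥ grad u x :=
    Finset.measurable_sum _ fun i _ => (measurable_grad_apply u i).mul (measurable_grad_apply u i)
  exact measurable_const.sub
    ((h.inv.mul (measurable_grad_apply u i)).mul (measurable_grad_apply u j))

lemma measurable_tiltSq (F h : EuclideanSpace ℝ α → EuclideanSpace ℝ β)
    (u : EuclideanSpace ℝ α → ℝ) : Measurable (tiltSq F h u) := by
  unfold tiltSq frobSq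
  refine Finset.measurable_sum _ fun b _ => Finset.measurable_sum _ fun i _ =>
    Measurable.pow_const ?_ 2
  simp only [Matrix.mul_apply]
  exact Finset.measurable_sum _ fun j _ =>
    ((measurable_jac_apply F b j).sub (measurable_jac_apply h b j)).mul
      (measurable_tanProj_apply u j i)

lemma tiltSq_nonneg (F h : EuclideanSpace ℝ α → EuclideanSpace ℝ β)
    (u : EuclideanSpace ℝ α → ℝ) (x : EuclideanSpace ℝ α) : 0 ≤ tiltSq F h u x := frobSq_nonneg _

lemma exists_entry_bound {κ μ : Type*} [Finite κ] [Finite μ] {S : Set (EuclideanSpace ℝ α)}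
    (hS : IsCompact S) {M : EuclideanSpace ℝ α → Matrix κ μ ℝ}
    (hM : ∀ i j, ∀ x ∈ S, ContinuousAt (fun y => M y i j) x) :
    ∃ C, 0 ≤ C ∧ ∀ x ∈ S, ∀ i j, |M x i j| ≤ C := by
  cases nonempty_fintype κ
  cases nonempty_fintype μ
  have h1 : ∀ k : κ × μ, ∃ C, ∀ x ∈ S, ‖M x k.1 k.2‖ ≤ C := fun k =>
    hS.exists_bound_of_continuousOn fun x hx => (hM k.1 k.2 x hx).continuousWithinAt
  choose C hC using h1
  refine ⟨∑ k, |C k|, Finset.sum_nonneg fun _ _ => abs_nonneg _, fun x hx i j => ?_⟩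
  exact ((hC (i, j) x hx).trans (le_abs_self _)).trans
    (Finset.single_le_sum (f := fun k => |C k|) (fun _ _ => abs_nonneg _)
      (Finset.mem_univ (i, j)))

lemma one_le_sqrt_det_graphGram (A : Matrix β α ℝ) : 1 ≤ √(graphGram A).det := by
  have := one_le_det_one_add_mul_transpose Aᵀ
  rw [transpose_transpose] at this
  exact Real.one_le_sqrt.2 this

lemma exists_sqrt_det_bound {F : EuclideanSpace ℝ α → EuclideanSpace ℝ β} {K : NNReal}
    (hF : LipschitzWith K F) : ∃ C, 0 < C ∧ ∀ x, √(graphGram (jac F x)).det ≤ C := by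
  obtain ⟨C, hC⟩ := exists_bound_of_continuous (α := α) (β := β)
    continuous_graphGram_det.sqrt K
  exact ⟨|C| + 1, by positivity, fun x => (le_abs_self _).trans
    ((hC _ (abs_jac_le hF x)).trans ((le_abs_self C).trans (by linarith)))⟩

namespace IsDefining
variable {Ω : Set (EuclideanSpace ℝ α)} {u : EuclideanSpace ℝ α → ℝ} {c : ℝ}
  {h F : EuclideanSpace ℝ α → EuclideanSpace ℝ β} {K : NNReal}

lemma exists_frob_bounds
    (hd : IsDefining Ω u c) (hh : ∀ x, 0 ≤ u x → u x ≤ c → ContDiffAt ℝ 2 h x)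
    (hF : LipschitzWith K F) : ∃ C, 0 < C ∧ ∀ x, 0 ≤ u x → u x ≤ c →
    2 * (1 + frobSq (jac F x)) * frobSq (stripFrame (jac h x) (grad u x)) ≤ C ∧
    tiltSq F h u x ≤ C := by
  have hQ : ∀ i j, ∀ x ∈ {x | 0 ≤ u x ∧ u x ≤ c},
      ContinuousAt (fun y => tanProj (grad u y) i j) x := fun i j x hx =>
    (entryC1_tanProj (hd.contDiffAt_grad hx.1) (hd.grad_ne x hx.1 hx.2) i j).continuousAt
  have hH : ∀ i j, ∀ x ∈ {x | 0 ≤ u x ∧ u x ≤ c}, ContinuousAt (fun y => jac h y i j) x :=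
    fun i j x hx => (entryC1_jac (hh x hx.1 hx.2) i j).continuousAt
  obtain ⟨A, hA0, hA⟩ := exists_entry_bound hd.isCompact_strip hQ
  obtain ⟨B, hB0, hB⟩ := exists_entry_bound hd.isCompact_strip hH
  obtain ⟨D, hD0, hD⟩ := exists_entry_bound hd.isCompact_strip
    (M := fun x => stripFrame (jac h x) (grad u x)) (by
      rintro (i | i) j x hx
      · exact hQ i j x hx
      · exact tendsto_finsetSum _ fun k _ => (hH i k x hx).mul (hQ k j x hx))
  have hJ : ∀ x, frobSq (jac F x) ≤ _ := fun x => frobSq_le_of_entries (abs_jac_le hF x)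
  set a : ℝ := ((Fintype.card α : ℕ) : ℝ)
  set b : ℝ := ((Fintype.card β : ℕ) : ℝ)
  set ab : ℝ := ((Fintype.card (α ⊕ β) : ℕ) : ℝ) with hab
  set M := b * a * (K : ℝ) ^ 2 with hM
  have hM0 : 0 ≤ M := by positivity
  have h1 : 0 ≤ 2 * (1 + M) * (ab * a * D ^ 2) := by positivity
  have h2 : 0 ≤ b * a * (a * ((K + B) * A)) ^ 2 := by positivity
  refine ⟨2 * (1 + M) * (ab * a * D ^ 2) + b * a * (a * ((K + B) * A)) ^ 2 + 1, by positivity,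
    fun x hx hxc => ⟨?_, ?_⟩⟩
  · have h3 : frobSq (stripFrame (jac h x) (grad u x)) ≤ ab * a * D ^ 2 :=
      frobSq_le_of_entries (hD x ⟨hx, hxc⟩)
    have h4 := hJ x
    have h5 := frobSq_nonneg (stripFrame (jac h x) (grad u x))
    calc _ ≤ 2 * (1 + M) * (ab * a * D ^ 2) := by gcongr
      _ ≤ _ := by linarith
  · have h3 : tiltSq F h u x ≤ b * a * (a * ((K + B) * A)) ^ 2 := by
      refine frobSq_le_of_entries fun i j => ?_
      rw [Matrix.mul_apply]
      calc _ ≤ ∑ k, |(jac F x - jac h x) i k * tanProj (grad u x) k j| :=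
            Finset.abs_sum_le_sum_abs _ _
        _ ≤ ∑ _k : α, (K + B) * A := by
            refine Finset.sum_le_sum fun k _ => ?_
            rw [abs_mul]
            have h6 : |(jac F x - jac h x) i k| ≤ K + B :=
              (abs_sub _ _).trans (add_le_add (abs_jac_le hF x i k) (hB x ⟨hx, hxc⟩ i k))
            have h7 := hA x ⟨hx, hxc⟩ k j
            gcongr
        _ = _ := by rw [Finset.sum_const, Finset.card_univ, nsmul_eq_mul]
    linarith

lemma exists_weighted_tilt_bound
    (hd : IsDefining Ω u c) (hh : ∀ x, 0 ≤ u x → u x ≤ c → ContDiffAt ℝ 2 h x)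
    (hF : LipschitzWith K F) (hw : IsWeakMSS Ω F) {C₁ : ℝ}
    (hFh : ∀ x, 0 ≤ u x → u x ≤ c → ‖F x - h x‖ ≤ C₁ * u x) :
    ∃ C, ∀ δ, 0 < δ → 4 * δ ≤ c →
      IntegrableOn (fun x => cutIn δ (u x) * cutOut c (u x) * ((u x)⁻¹ * tiltSq F h u x)) Ω ∧
      ∫ x in Ω, cutIn δ (u x) * cutOut c (u x) * ((u x)⁻¹ * tiltSq F h u x) ≤ C := by
  obtain ⟨CG, hCG, hfrob⟩ := hd.exists_frob_bounds hh hF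
  obtain ⟨CX, hCX, hX⟩ := hd.exists_stripField_bound hh C₁
  obtain ⟨CF, hCF, hdet⟩ := exists_sqrt_det_bound hF
  obtain ⟨CL, hCL, hlayer⟩ := hd.exists_layer_bound
  obtain ⟨Cu, hCu, hup⟩ := hd.exists_grad_upper
  obtain ⟨Cs, hCs, hst⟩ := exists_stepDeriv_le
  have hc := hd.c_pos
  set n : ℝ := ((Fintype.card (α ⊕ β) : ℕ) : ℝ) with hn
  set C₂ := 2 / c * Cs * Cu with hC₂
  set C₃ := CF * C₂ + CF * (2 * n ^ 2 * (CX * Cu)) with hC₃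
  set C₄ := CG * (CX + 1) with hC₄
  have hdiff : ∀ᵐ x ∂(volume.restrict Ω), DifferentiableAt ℝ F x :=
    ae_restrict_of_ae hF.ae_differentiableAt
  refine ⟨C₄ * (CF * CL + C₃ * (volume Ω).toReal), fun δ hδ hδc => ?_⟩
  set η : ℝ → ℝ := fun t => cutIn δ t * cutOut c t with hη
  set η' : ℝ → ℝ := fun t => δ⁻¹ * stepDeriv (t / δ - 1) * cutOut c t +
    cutIn δ t * (-(2 / c) * stepDeriv (2 - 2 * t / c)) with hη'
  have hηd : ∀ t, HasDerivAt η (η' t) t := fun t => (hasDerivAt_cutIn δ t).mul (hasDerivAt_cutOut c t)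
  have hη0 : ∀ t ≤ δ, η t = 0 := fun t ht => by simp [hη, cutIn_eq_zero hδ ht]
  have hηc : ∀ t, c ≤ t → η t = 0 := fun t ht => by simp [hη, cutOut_eq_zero hc ht]
  have hη'c : ∀ t, c < t → η' t = 0 := fun t ht => by
    have : stepDeriv (2 - 2 * t / c) = 0 := stepDeriv_eq_zero_of_nonpos (by
      have : 1 ≤ t / c := (one_le_div hc).2 ht.le
      rw [mul_div_assoc]
      linarith)
    simp [hη', cutOut_eq_zero hc ht.le, this]
  have hηn : ∀ t, 0 ≤ η t := fun t => mul_nonneg (cutIn_nonneg _ _) (cutOut_nonneg _ _)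
  have hη1 : ∀ t, η t ≤ 1 := fun t =>
    mul_le_one₀ (cutIn_le_one _ _) (cutOut_nonneg _ _) (cutOut_le_one _ _)
  have hη2 : ContDiff ℝ 2 η := (contDiff_cutIn δ).mul (contDiff_cutOut c)
  have hgrad : ∀ x, grad (fun x => η (u x)) x = η' (u x) • grad u x :=
    hd.grad_comp hηd hδ hη0
  have hsupp : tsupport (fun x => η (u x)) ⊆ Ω ∩ {x | 0 ≤ u x ∧ u x ≤ c} := by
    refine fun x hx => ⟨hd.tsupport_comp_subset_domain hδ hη0 hx, ?_⟩
    have h1 : tsupport (fun x => η (u x)) ⊆ {x | u x ≤ c} := by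
      refine closure_minimal (fun x hx => ?_) (isClosed_le hd.cont continuous_const)
      by_contra hlt
      exact hx (hηc _ (not_le.1 hlt).le)
    exact ⟨hδ.le.trans (hd.tsupport_comp_subset hη0 hx), h1 hx⟩
  obtain ⟨hI, hI0⟩ := weak_radial_test (S := {x | 0 ≤ u x ∧ u x ≤ c}) hd.isOpen hd.volume_ne_top
    hF hw ((hd.contDiff_comp hη2 hδ hη0).of_le (by norm_num)) (hd.hasCompactSupport_comp hδ hη0)
    hsupp (X := fun k => stripField h u k)
    (fun k x hx y => hd.contDiffAt_stripField hh hx.1 hx.2 y k) hδ 1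
    (Xh := fun k x => stripField h u k (x, F x)) (fun _ _ => rfl)
  set I := fun x => √(graphGram (jac F x)).det * testDensity (jac F x)
    ((√((fun k => stripField h u k (x, F x)) ⬝ᵥ (fun k => stripField h u k (x, F x)) + δ ^ 2))⁻¹ ^ 1)
    (-(((1 : ℕ) : ℝ) / 2) *
      (√((fun k => stripField h u k (x, F x)) ⬝ᵥ (fun k => stripField h u k (x, F x)) +
        δ ^ 2))⁻¹ ^ (1 + 2)) (η (u x)) (grad (fun x => η (u x)) x)
    (fun k => stripField h u k (x, F x)) (famJac (fun k x => stripField h u k (x, F x)) x) with hIdef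
  have key : ∀ᵐ x ∂(volume.restrict Ω), η (u x) * ((u x)⁻¹ * tiltSq F h u x) ≤
      C₄ * (I x + CF * layer u δ x + C₃) := by
    filter_upwards [hdiff, ae_restrict_mem hd.isOpen.measurableSet] with x hFx hxΩ
    have hu : 0 < u x := (hd.pos_iff x).1 hxΩ
    have hL := layer_nonneg (u := u) hδ x
    by_cases hxc : u x ≤ c
    swap
    · have h1 : I x = 0 := by
        simp only [hIdef]
        rw [hgrad, hη'c _ (not_le.1 hxc), hηc _ (not_le.1 hxc).le]
        simp [testDensity]
      rw [h1, hηc _ (not_le.1 hxc).le]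
      simp only [zero_mul, zero_add]
      positivity
    obtain ⟨hE, hXX⟩ := hX F x hu.le hxc hFx (hFh x hu.le hxc)
    have ha := hd.grad_ne x hu.le hxc
    set P := stripProj (jac h x) (grad u x) with hP
    set y : α ⊕ β → ℝ := fun k => stripField h u k (x, F x) with hy
    have hyP : y = P *ᵥ stripDisp (jac h x) (grad u x) (u x) (fun b => F x b - h x b) := rfl
    have hPy : P *ᵥ y = y := by
      rw [hyP, mulVec_mulVec, stripProj_mul_self _ ha]
    have hyy := dotProduct_self_nonneg' y
    have hlow := testDensity_strip_ge (jac F x) hδ (hηn (u x)) (by positivity : 0 ≤ CX * u x)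
      (grad (fun x => η (u x)) x) y (stripProj_transpose (jac h x) (grad u x)) hPy hE
    rw [trace_proj_sub_one (jac F x) (stripProj_transpose (jac h x) (grad u x))
      (stripProj_mul_self _ ha) (trace_one_sub_stripProj _ ha), ← hn] at hlow
    set E := frobSq ((1 - graphProj (jac F x)) * (1 - P)) with hEdef
    set q := (√(y ⬝ᵥ y + δ ^ 2))⁻¹ with hq
    have hq0 : 0 < q := inv_pos.2 (Real.sqrt_pos.2 (by positivity))
    have hE0 : 0 ≤ E := frobSq_nonneg _
    have hGE : tiltSq F h u x ≤ CG * E := by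
      refine (frobSq_tilt_le (jac F x) (jac h x) (tanProj (grad u x))
        (stripProj_mul_frame (jac h x) ha)).trans ?_
      exact mul_le_mul_of_nonneg_right (hfrob x hu.le hxc).1 hE0
    have hqu : q * u x ≤ Cu := by
      have h1 := sq_le_strip (jac h x) ha (u x) (fun b => F x b - h x b)
      change u x ^ 2 ≤ (grad u x ⬝ᵥ grad u x) * (y ⬝ᵥ y) at h1
      have h2 : u x ≤ √(grad u x ⬝ᵥ grad u x) * √(y ⬝ᵥ y + δ ^ 2) := by
        rw [← Real.sqrt_mul (dotProduct_self_nonneg' _)]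
        refine Real.le_sqrt_of_sq_le (h1.trans ?_)
        have := dotProduct_self_nonneg' (grad u x)
        gcongr
        linarith [sq_nonneg δ]
      rw [hq, inv_mul_le_iff₀ (Real.sqrt_pos.2 (by positivity)), mul_comm]
      exact h2.trans (mul_le_mul_of_nonneg_right (hup x hu.le) (Real.sqrt_nonneg _))
    have hgradn : √(grad (fun x => η (u x)) x ⬝ᵥ grad (fun x => η (u x)) x) ≤
        layer u δ x + C₂ := by
      rw [hgrad, smul_dotProduct, dotProduct_smul, smul_eq_mul, smul_eq_mul, ← mul_assoc,
        Real.sqrt_mul (mul_self_nonneg _), Real.sqrt_mul_self_eq_abs]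
      have h1 : |η' (u x)| ≤ δ⁻¹ * stepDeriv (u x / δ - 1) + 2 / c * Cs := by
        refine (abs_add_le _ _).trans ?_
        rw [abs_mul, abs_mul (cutIn δ (u x)), abs_mul (-(2 / c)), abs_neg,
          abs_of_nonneg (cutIn_nonneg _ _), abs_of_nonneg (cutOut_nonneg _ _),
          abs_of_nonneg (stepDeriv_nonneg _), abs_of_pos (by positivity : 0 < 2 / c),
          abs_of_nonneg (mul_nonneg (inv_nonneg.2 hδ.le) (stepDeriv_nonneg _))]
        have h2 : 0 ≤ δ⁻¹ * stepDeriv (u x / δ - 1) :=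
          mul_nonneg (inv_nonneg.2 hδ.le) (stepDeriv_nonneg _)
        have h3 : 0 ≤ 2 / c * stepDeriv (2 - 2 * u x / c) :=
          mul_nonneg (by positivity) (stepDeriv_nonneg _)
        refine add_le_add (mul_le_of_le_one_right h2 (cutOut_le_one _ _))
          ((mul_le_of_le_one_left h3 (cutIn_le_one _ _)).trans ?_)
        have := hst (2 - 2 * u x / c)
        gcongr
      calc _ ≤ (δ⁻¹ * stepDeriv (u x / δ - 1) + 2 / c * Cs) * √(grad u x ⬝ᵥ grad u x) := by gcongr
        _ = layer u δ x + 2 / c * Cs * √(grad u x ⬝ᵥ grad u x) := by rw [layer]; ring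
        _ ≤ _ := by
          rw [hC₂]
          have := hup x hu.le
          gcongr
    have hθqE : η (u x) * ((u x)⁻¹ * tiltSq F h u x) ≤ C₄ * (η (u x) * q * E) := by
      rcases le_or_gt (u x) δ with hle | hgt
      · rw [hη0 _ hle]; simp
      have h1 : (u x)⁻¹ ≤ (CX + 1) * q := by
        have h2 : √(y ⬝ᵥ y + δ ^ 2) ≤ (CX + 1) * u x := by
          refine Real.sqrt_le_iff.2 ⟨by positivity, ?_⟩
          have : δ ^ 2 ≤ u x ^ 2 := by gcongr
          nlinarith [mul_pos hCX (pow_pos hu 2)]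
        rw [hq, ← div_eq_mul_inv, inv_eq_one_div, div_le_div_iff₀ hu (Real.sqrt_pos.2 (by positivity)),
          one_mul]
        exact h2
      have h3 := hηn (u x)
      have h4 := tiltSq_nonneg F h u x
      calc _ ≤ η (u x) * (((CX + 1) * q) * (CG * E)) := by gcongr
        _ = _ := by rw [hC₄]; ring
    have hIge : η (u x) * q * E ≤ I x + CF * layer u δ x + C₃ := by
      have hg1 := one_le_sqrt_det_graphGram (jac F x)
      have hg2 := hdet x
      have hIx : I x = √(graphGram (jac F x)).det * testDensity (jac F x) (q ^ 1)
          (-(1 / 2) * q ^ (1 + 2)) (η (u x)) (grad (fun x => η (u x)) x) y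
          (famJac (fun k x => stripField h u k (x, F x)) x) := by
        simp only [hIdef, Nat.cast_one, hq, hy]
      rw [hIx]
      set g := √(graphGram (jac F x)).det
      have h1 : η (u x) * q * (2 * n ^ 2 * (CX * u x)) ≤ 2 * n ^ 2 * (CX * Cu) := by
        calc _ = η (u x) * (2 * n ^ 2 * (CX * (q * u x))) := by ring
          _ ≤ 1 * (2 * n ^ 2 * (CX * Cu)) := by
            have := hη1 (u x)
            gcongr
          _ = _ := one_mul _
      have h2 : η (u x) * q * E - (layer u δ x + C₂) - 2 * n ^ 2 * (CX * Cu) ≤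
          testDensity (jac F x) (q ^ 1)
          (-(1 / 2) * q ^ (1 + 2)) (η (u x)) (grad (fun x => η (u x)) x) y
          (famJac (fun k x => stripField h u k (x, F x)) x) := by
        refine le_trans ?_ hlow
        rw [mul_sub (η (u x) * q)]
        linarith
      set T := testDensity (jac F x) (q ^ 1)
          (-(1 / 2) * q ^ (1 + 2)) (η (u x)) (grad (fun x => η (u x)) x) y
          (famJac (fun k x => stripField h u k (x, F x)) x)
      have h3 : 0 ≤ η (u x) * q * E := mul_nonneg (mul_nonneg (hηn _) hq0.le) hE0
      have h4 : 0 ≤ layer u δ x + C₂ + 2 * n ^ 2 * (CX * Cu) := by positivity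
      have h5 : g * (η (u x) * q * E - (layer u δ x + C₂) - 2 * n ^ 2 * (CX * Cu)) ≤ g * T :=
        mul_le_mul_of_nonneg_left h2 (by linarith)
      have h6 : η (u x) * q * E ≤ g * (η (u x) * q * E) := le_mul_of_one_le_left h3 hg1
      have h7 : g * (layer u δ x + C₂ + 2 * n ^ 2 * (CX * Cu)) ≤
          CF * (layer u δ x + C₂ + 2 * n ^ 2 * (CX * Cu)) := mul_le_mul_of_nonneg_right hg2 h4
      rw [hC₃]
      linarith
    refine hθqE.trans (mul_le_mul_of_nonneg_left hIge (by positivity))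
  have hint : IntegrableOn (fun x => C₄ * (I x + CF * layer u δ x + C₃)) Ω := by
    refine Integrable.const_mul ((hI.add ((hd.integrableOn_layer hδ).const_mul CF)).add ?_) C₄
    exact integrableOn_const hd.volume_ne_top
  have hnn : ∀ᵐ x ∂(volume.restrict Ω), 0 ≤ η (u x) * ((u x)⁻¹ * tiltSq F h u x) := by
    filter_upwards [ae_restrict_mem hd.isOpen.measurableSet] with x hxΩ
    have hu : 0 < u x := (hd.pos_iff x).1 hxΩ
    exact mul_nonneg (hηn _) (mul_nonneg (inv_nonneg.2 hu.le) (tiltSq_nonneg F h u x))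
  have hmeas : Measurable fun x => η (u x) * ((u x)⁻¹ * tiltSq F h u x) :=
    (hη2.continuous.measurable.comp hd.cont.measurable).mul
      (hd.cont.measurable.inv.mul (measurable_tiltSq F h u))
  refine ⟨Integrable.mono' hint hmeas.aestronglyMeasurable ?_, ?_⟩
  · filter_upwards [key, hnn] with x h1 h2
    rw [Real.norm_of_nonneg h2]
    exact h1
  · refine (integral_mono_of_nonneg hnn hint key).trans ?_
    rw [integral_const_mul]
    have h1 : ∫ x in Ω, (I x + CF * layer u δ x + C₃) =
        (∫ x in Ω, I x) + CF * (∫ x in Ω, layer u δ x) + C₃ * (volume Ω).toReal := by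
      have h2 : IntegrableOn (fun x => CF * layer u δ x) Ω :=
        (hd.integrableOn_layer hδ).const_mul CF
      have h3 : IntegrableOn (fun x => I x + CF * layer u δ x) Ω := hI.add h2
      rw [integral_add h3 (integrableOn_const hd.volume_ne_top), integral_add hI h2,
        integral_const_mul, setIntegral_const, smul_eq_mul, mul_comm C₃]
      rfl
    rw [h1, hI0, zero_add]
    have := hlayer δ hδ hδc
    gcongr

lemma integrableOn_layer_mul_tilt
    (hd : IsDefining Ω u c) (hh : ∀ x, 0 ≤ u x → u x ≤ c → ContDiffAt ℝ 2 h x)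
    (hF : LipschitzWith K F) {δ : ℝ} (hδ : 0 < δ)
    (hδc : 4 * δ ≤ c) : IntegrableOn (fun x => layer u δ x * tiltSq F h u x) Ω := by
  obtain ⟨CG, hCG, hfrob⟩ := hd.exists_frob_bounds hh hF
  refine Integrable.mono' ((hd.integrableOn_layer hδ).const_mul CG)
    ((hd.continuous_layer hδ).measurable.mul (measurable_tiltSq F h u)).aestronglyMeasurable ?_
  filter_upwards [ae_restrict_mem hd.isOpen.measurableSet] with x hxΩ
  have hu : 0 < u x := (hd.pos_iff x).1 hxΩ
  have hL := layer_nonneg (u := u) hδ x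
  rw [Real.norm_of_nonneg (mul_nonneg hL (tiltSq_nonneg F h u x)), mul_comm]
  rcases le_or_gt (2 * δ) (u x) with h2 | h2
  · rw [layer_eq_zero_of_ge hδ h2]; simp
  · exact mul_le_mul_of_nonneg_right (hfrob x hu.le (by linarith)).2 hL

lemma integrableOn_inv_mul_tilt
    (hd : IsDefining Ω u c) (hh : ∀ x, 0 ≤ u x → u x ≤ c → ContDiffAt ℝ 2 h x)
    (hF : LipschitzWith K F) (hw : IsWeakMSS Ω F) {C₁ : ℝ}
    (hFh : ∀ x, 0 ≤ u x → u x ≤ c → ‖F x - h x‖ ≤ C₁ * u x) :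
    IntegrableOn ({x | u x ≤ c / 2}.indicator fun x => (u x)⁻¹ * tiltSq F h u x) Ω := by
  obtain ⟨C, hC⟩ := hd.exists_weighted_tilt_bound hh hF hw hFh
  have hc := hd.c_pos
  set f := {x | u x ≤ c / 2}.indicator fun x => (u x)⁻¹ * tiltSq F h u x with hf
  set d : ℕ → ℝ := fun k => c / 4 * (1 / ((k : ℝ) + 1)) with hdd
  have hd0 : ∀ k, 0 < d k := fun k => by positivity
  have hdc : ∀ k, 4 * d k ≤ c := fun k => by
    have h1 : 1 / ((k : ℝ) + 1) ≤ 1 := div_le_self zero_le_one (by simp)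
    have : d k ≤ c / 4 := mul_le_of_le_one_right (by positivity) h1
    linarith
  have hdlim : Tendsto d atTop (𝓝 0) := by
    simpa [hdd] using (tendsto_one_div_add_atTop_nhds_zero_nat (𝕜 := ℝ)).const_mul (c / 4)
  have hS : MeasurableSet {x | u x ≤ c / 2} := measurableSet_le hd.cont.measurable measurable_const
  have hmeas : Measurable f := (hd.cont.measurable.inv.mul (measurable_tiltSq F h u)).indicator hS
  have hnn : ∀ᵐ x ∂(volume.restrict Ω), 0 ≤ f x := by
    filter_upwards [ae_restrict_mem hd.isOpen.measurableSet] with x hxΩ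
    have hu : 0 < u x := (hd.pos_iff x).1 hxΩ
    exact Set.indicator_apply_nonneg fun _ => (mul_nonneg (inv_nonneg.2 hu.le) (tiltSq_nonneg F h u x))
  have hmS : ∀ k, MeasurableSet {x | 2 * d k ≤ u x} := fun k =>
    measurableSet_le measurable_const hd.cont.measurable
  have hle : ∀ k, ∀ᵐ x ∂(volume.restrict Ω), {x | 2 * d k ≤ u x}.indicator f x ≤
      cutIn (d k) (u x) * cutOut c (u x) * ((u x)⁻¹ * tiltSq F h u x) := by
    intro k
    filter_upwards [ae_restrict_mem hd.isOpen.measurableSet] with x hxΩ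
    have hu : 0 < u x := (hd.pos_iff x).1 hxΩ
    have h0 : 0 ≤ (u x)⁻¹ * tiltSq F h u x :=
      mul_nonneg (inv_nonneg.2 hu.le) (tiltSq_nonneg F h u x)
    have h1 : 0 ≤ cutIn (d k) (u x) * cutOut c (u x) * ((u x)⁻¹ * tiltSq F h u x) :=
      mul_nonneg (mul_nonneg (cutIn_nonneg _ _) (cutOut_nonneg _ _)) h0
    by_cases h2 : 2 * d k ≤ u x
    · rw [Set.indicator_of_mem (by exact h2)]
      by_cases h3 : u x ≤ c / 2
      · rw [hf, Set.indicator_of_mem (by exact h3), cutIn_eq_one (hd0 k) h2, cutOut_eq_one hc h3]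
        simp
      · rw [hf, Set.indicator_of_notMem (by exact h3)]
        exact h1
    · rw [Set.indicator_of_notMem (by exact h2)]
      exact h1
  have hnn' : ∀ k, ∀ᵐ x ∂(volume.restrict Ω), 0 ≤ {x | 2 * d k ≤ u x}.indicator f x := by
    intro k
    filter_upwards [hnn] with x hx
    exact Set.indicator_apply_nonneg fun _ => hx
  have hcover : AECover (volume.restrict Ω) atTop fun k => {x | 2 * d k ≤ u x} := by
    refine ⟨?_, hmS⟩
    filter_upwards [ae_restrict_mem hd.isOpen.measurableSet] with x hxΩ
    have hu : 0 < u x := (hd.pos_iff x).1 hxΩ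
    filter_upwards [hdlim.eventually_lt_const (half_pos hu)] with k hk
    linarith
  refine hcover.integrable_of_integral_bounded_of_nonneg_ae C (fun k => ?_) hnn
    (Eventually.of_forall fun k => ?_)
  · rw [← integrable_indicator_iff (hmS k)]
    refine Integrable.mono' (hC (d k) (hd0 k) (hdc k)).1
      (hmeas.indicator (hmS k)).aestronglyMeasurable ?_
    filter_upwards [hle k, hnn' k] with x h1 h2
    rwa [Real.norm_of_nonneg h2]
  · rw [← integral_indicator (hmS k)]
    exact (integral_mono_of_nonneg (hnn' k) (hC (d k) (hd0 k) (hdc k)).1 (hle k)).trans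
      (hC (d k) (hd0 k) (hdc k)).2

lemma tendsto_layer_tilt
    (hd : IsDefining Ω u c) (hh : ∀ x, 0 ≤ u x → u x ≤ c → ContDiffAt ℝ 2 h x)
    (hF : LipschitzWith K F) (hw : IsWeakMSS Ω F) {C₁ : ℝ}
    (hFh : ∀ x, 0 ≤ u x → u x ≤ c → ‖F x - h x‖ ≤ C₁ * u x) :
    Tendsto (fun δ => ∫ x in Ω, layer u δ x * tiltSq F h u x) (𝓝[>] 0) (𝓝 0) := by
  have hint := hd.integrableOn_inv_mul_tilt hh hF hw hFh
  obtain ⟨Cu, hCu, hup⟩ := hd.exists_grad_upper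
  obtain ⟨Cs, hCs, hst⟩ := exists_stepDeriv_le
  have hc := hd.c_pos
  have hev : ∀ᶠ δ : ℝ in 𝓝[>] 0, 0 < δ ∧ 4 * δ ≤ c := by
    filter_upwards [Ioo_mem_nhdsGT (by positivity : 0 < c / 4)] with δ hδ
    exact ⟨hδ.1, by linarith [hδ.2]⟩
  have h0 : ∫ _x in Ω, (0 : ℝ) = 0 := integral_zero _ _
  conv => enter [3, 1]; rw [← h0]
  refine tendsto_integral_filter_of_dominated_convergence _ ?_ ?_
    (hint.const_mul (2 * Cs * Cu)) ?_
  · filter_upwards [hev] with δ hδ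
    exact (hd.integrableOn_layer_mul_tilt hh hF hδ.1 hδ.2).aestronglyMeasurable
  · filter_upwards [hev] with δ hδ
    filter_upwards [ae_restrict_mem hd.isOpen.measurableSet] with x hxΩ
    have hu : 0 < u x := (hd.pos_iff x).1 hxΩ
    have hL := layer_nonneg (u := u) hδ.1 x
    have hG := tiltSq_nonneg F h u x
    rw [Real.norm_of_nonneg (mul_nonneg hL hG)]
    have hnn : 0 ≤ {x | u x ≤ c / 2}.indicator (fun x => (u x)⁻¹ * tiltSq F h u x) x :=
      Set.indicator_apply_nonneg fun _ => (mul_nonneg (inv_nonneg.2 hu.le) hG)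
    rcases le_or_gt (2 * δ) (u x) with h2 | h2
    · rw [layer_eq_zero_of_ge hδ.1 h2, zero_mul]
      positivity
    · rw [Set.indicator_of_mem (show x ∈ {x | u x ≤ c / 2} from by
        change u x ≤ c / 2
        linarith [hδ.2]), ← mul_assoc]
      refine mul_le_mul_of_nonneg_right ?_ hG
      have h3 : δ⁻¹ ≤ 2 * (u x)⁻¹ := by
        rw [← div_eq_mul_inv, inv_eq_one_div, div_le_div_iff₀ hδ.1 hu]
        linarith
      have h4 := hst (u x / δ - 1)
      have h5 := hup x hu.le
      have h6 := stepDeriv_nonneg (u x / δ - 1)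
      calc layer u δ x ≤ 2 * (u x)⁻¹ * Cs * Cu := by
            rw [layer]
            gcongr
        _ = _ := by ring
  · filter_upwards [ae_restrict_mem hd.isOpen.measurableSet] with x hxΩ
    have hu : 0 < u x := (hd.pos_iff x).1 hxΩ
    refine tendsto_const_nhds.congr' ?_
    filter_upwards [Ioo_mem_nhdsGT (half_pos hu)] with δ hδ
    rw [layer_eq_zero_of_ge hδ.1 (by linarith [hδ.2]), zero_mul]

end IsDefining
end StripEstimate

section Density
open MeasureTheory Filter Topology Matrix
variable {α β : Type*} [Fintype α] [DecidableEq α] [Fintype β] [DecidableEq β]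

lemma exists_graphGram_factor (A : Matrix β α ℝ) : ∃ L : Matrix α α ℝ, Lᵀ * L = graphGram A := by
  open scoped MatrixOrder in
  obtain ⟨L, hL⟩ := CStarAlgebra.nonneg_iff_eq_star_mul_self.mp (graphGram_posDef A).posSemidef.nonneg
  exact ⟨L, by rw [hL, star_eq_conjTranspose, conjTranspose_eq_transpose_of_trivial]⟩

lemma euclidean_norm_sq (v : EuclideanSpace ℝ α) :
    ‖v‖ ^ 2 = (WithLp.ofLp v) ⬝ᵥ (WithLp.ofLp v) := by
  rw [EuclideanSpace.real_norm_sq_eq]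
  exact Finset.sum_congr rfl fun i _ => sq _

lemma fderiv_eq_jac_mulVec (F : EuclideanSpace ℝ α → EuclideanSpace ℝ β)
    (x v : EuclideanSpace ℝ α) :
    WithLp.ofLp (fderiv ℝ F x v) = jac F x *ᵥ WithLp.ofLp v := by
  have hv : v = ∑ i, v i • EuclideanSpace.single i (1 : ℝ) := by
    ext j
    simp [Pi.single_apply]
  funext b
  conv_lhs => rw [hv]
  simp [jac, mulVec, dotProduct, mul_comm]

lemma mulVec_dotProduct_mulVec (M : Matrix β α ℝ) (w : α → ℝ) :
    (M *ᵥ w) ⬝ᵥ (M *ᵥ w) = w ⬝ᵥ ((Mᵀ * M) *ᵥ w) := by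
  rw [← mulVec_mulVec, dotProduct_mulVec w, vecMul_transpose]

lemma norm_sq_add_norm_sq_fderiv {F : EuclideanSpace ℝ α → EuclideanSpace ℝ β}
    {x : EuclideanSpace ℝ α} {L : Matrix α α ℝ} (hL : Lᵀ * L = graphGram (jac F x))
    (v : EuclideanSpace ℝ α) :
    ‖Matrix.toLpLin 2 2 L v‖ ^ 2 = ‖v‖ ^ 2 + ‖fderiv ℝ F x v‖ ^ 2 := by
  rw [euclidean_norm_sq, euclidean_norm_sq, euclidean_norm_sq, fderiv_eq_jac_mulVec,
    Matrix.toLpLin_apply]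
  set w := WithLp.ofLp v
  change (L *ᵥ w) ⬝ᵥ (L *ᵥ w) = _
  rw [mulVec_dotProduct_mulVec, hL, mulVec_dotProduct_mulVec, graphGram, add_mulVec, one_mulVec, dotProduct_add]

lemma ae_graph_density [Nonempty α] {F : EuclideanSpace ℝ α → EuclideanSpace ℝ β} {K : NNReal}
    (hF : LipschitzWith K F) : ∀ᵐ x₀ : EuclideanSpace ℝ α, ∀ᶠ s in 𝓝[>] (0 : ℝ),
      volume.real (Metric.ball (0 : EuclideanSpace ℝ α) 1) / 2 * (s / 2) ^ Fintype.card α ≤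
      ∫ x in {x | ‖x - x₀‖ ^ 2 + ‖F x - F x₀‖ ^ 2 < s ^ 2}, √(graphGram (jac F x)).det := by
  obtain ⟨C, hC0, hC⟩ := exists_sqrt_det_bound hF
  set w : EuclideanSpace ℝ α → ℝ := fun x => √(graphGram (jac F x)).det with hw
  have hwm : Measurable w := measurable_comp_jac continuous_graphGram_det.sqrt F
  have hwi : ∀ S, volume S ≠ ⊤ → IntegrableOn w S := fun S hS => by
    refine Measure.integrableOn_of_bounded (M := C) hS hwm.aestronglyMeasurable
      (ae_of_all _ fun x => ?_)
    rw [Real.norm_of_nonneg (Real.sqrt_nonneg _)]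
    exact hC x
  have hwl : LocallyIntegrable w volume := fun x =>
    ⟨Metric.ball x 1, Metric.ball_mem_nhds x one_pos, hwi _ measure_ball_lt_top.ne⟩
  have hcard : Module.finrank ℝ (EuclideanSpace ℝ α) = Fintype.card α := finrank_euclideanSpace
  set D := Fintype.card α
  set ω := volume.real (Metric.ball (0 : EuclideanSpace ℝ α) 1) with hω
  have hω0 : 0 < ω := ENNReal.toReal_pos
    (Metric.measure_ball_pos volume _ one_pos).ne' measure_ball_lt_top.ne
  filter_upwards [IsUnifLocDoublingMeasure.ae_tendsto_average_norm_sub volume hwl 1,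
    hF.ae_differentiableAt] with x₀ hav hd
  have hav := hav (fun _ : ℝ => x₀) id tendsto_id (by
    filter_upwards [self_mem_nhdsWithin] with s hs
    simpa using (le_of_lt hs : (0:ℝ) ≤ s))
  obtain ⟨L, hL⟩ := exists_graphGram_factor (jac F x₀)
  have hLd : |L.det| = w x₀ := by
    rw [hw]
    simp only
    rw [← hL, det_mul, det_transpose, Real.sqrt_mul_self_eq_abs]
  have hw1 : 1 ≤ w x₀ := one_le_sqrt_det_graphGram _
  have hLdet : LinearMap.det (Matrix.toLpLin 2 2 L) ≠ 0 := by
    rw [LinearMap.det_toLpLin]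
    intro h0
    rw [h0, abs_zero] at hLd
    linarith
  set f := Matrix.toLpLin 2 2 L with hf
  have hfn : ∀ v, ‖f v‖ ^ 2 = ‖v‖ ^ 2 + ‖fderiv ℝ F x₀ v‖ ^ 2 := norm_sq_add_norm_sq_fderiv hL
  have hfc : Continuous f := f.continuous_of_finiteDimensional
  have hlin := hd.hasFDerivAt.isLittleO.def (c := 1 / 2) (by norm_num)
  obtain ⟨r, hr, hlin⟩ := Metric.eventually_nhds_iff.1 hlin
  have hη : (0 : ℝ) < (1 / 2) ^ D / 2 := by positivity
  filter_upwards [self_mem_nhdsWithin, hav.eventually (gt_mem_nhds hη),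
    mem_nhdsWithin_of_mem_nhds (gt_mem_nhds hr)] with s (hs : 0 < s) hsa (hsr : s < r)
  simp only [id] at hsa
  set E := f ⁻¹' Metric.ball (f x₀) (s / 2) with hE
  have hEmem : ∀ x ∈ E, ‖x - x₀‖ ^ 2 + ‖fderiv ℝ F x₀ (x - x₀)‖ ^ 2 < (s / 2) ^ 2 := fun x hx => by
    have hx : dist (f x) (f x₀) < s / 2 := hx
    rw [← hfn, map_sub, ← dist_eq_norm]
    exact pow_lt_pow_left₀ hx dist_nonneg two_ne_zero
  have hEn : ∀ x ∈ E, ‖x - x₀‖ < s := fun x hx => by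
    refine lt_of_pow_lt_pow_left₀ 2 hs.le ?_
    nlinarith [hEmem x hx, sq_nonneg ‖fderiv ℝ F x₀ (x - x₀)‖]
  have hEball : E ⊆ Metric.closedBall x₀ s := fun x hx => by
    rw [Metric.mem_closedBall, dist_eq_norm]
    exact (hEn x hx).le
  have hEB : E ⊆ {x | ‖x - x₀‖ ^ 2 + ‖F x - F x₀‖ ^ 2 < s ^ 2} := fun x hx => by
    have h1 := hlin (y := x) (by rw [dist_eq_norm]; exact (hEn x hx).trans hsr)
    have h2 := hEmem x hx
    have h3 : ‖F x - F x₀‖ ≤ ‖fderiv ℝ F x₀ (x - x₀)‖ + 1 / 2 * ‖x - x₀‖ := by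
      calc ‖F x - F x₀‖ = ‖fderiv ℝ F x₀ (x - x₀) + (F x - F x₀ - fderiv ℝ F x₀ (x - x₀))‖ := by
            congr 1; abel
        _ ≤ _ := norm_add_le _ _
        _ ≤ _ := by gcongr
    have h4 : ‖F x - F x₀‖ ^ 2 ≤ (‖fderiv ℝ F x₀ (x - x₀)‖ + 1 / 2 * ‖x - x₀‖) ^ 2 :=
      pow_le_pow_left₀ (norm_nonneg _) h3 2
    show ‖x - x₀‖ ^ 2 + ‖F x - F x₀‖ ^ 2 < s ^ 2
    nlinarith [sq_nonneg (‖fderiv ℝ F x₀ (x - x₀)‖ - 1 / 2 * ‖x - x₀‖), sq_nonneg ‖x - x₀‖,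
      pow_pos hs 2]
  have hEm : MeasurableSet E := hfc.measurable Metric.isOpen_ball.measurableSet
  have hEv : volume.real E * w x₀ = (s / 2) ^ D * ω := by
    rw [hE, measureReal_def, Measure.addHaar_preimage_linearMap _ hLdet,
      Measure.addHaar_ball _ _ (by positivity), hcard, ENNReal.toReal_mul, ENNReal.toReal_mul,
      ENNReal.toReal_ofReal (abs_nonneg _), ENNReal.toReal_ofReal (by positivity),
      LinearMap.det_toLpLin, abs_inv, hLd]
    change (w x₀)⁻¹ * ((s / 2) ^ D * ω) * w x₀ = _
    field_simp
  have hBv : volume.real (Metric.closedBall x₀ s) = s ^ D * ω := by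
    rw [measureReal_def, Measure.addHaar_closedBall _ _ hs.le, hcard, ENNReal.toReal_mul,
      ENNReal.toReal_ofReal (by positivity)]
    rfl
  have hBfin : volume (Metric.closedBall x₀ s) ≠ ⊤ := measure_closedBall_lt_top.ne
  have hEfin : volume E ≠ ⊤ := ((measure_mono hEball).trans_lt measure_closedBall_lt_top).ne
  have hdi : IntegrableOn (fun y => ‖w y - w x₀‖) (Metric.closedBall x₀ s) :=
    ((hwi _ hBfin).sub (integrableOn_const hBfin)).norm
  have hdev : ∫ x in E, ‖w x - w x₀‖ ≤ (s / 2) ^ D * ω / 2 := by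
    refine (setIntegral_mono_set hdi (ae_of_all _ fun _ => norm_nonneg _)
      hEball.eventuallyLE).trans ?_
    rw [setAverage_eq, smul_eq_mul, hBv, inv_mul_lt_iff₀ (by positivity)] at hsa
    refine hsa.le.trans (le_of_eq ?_)
    rw [div_pow, div_pow, one_pow]
    ring
  have hmain : (s / 2) ^ D * ω - (s / 2) ^ D * ω / 2 ≤ ∫ x in E, w x := by
    have h1 : ∫ x in E, (w x₀ - ‖w x - w x₀‖) ≤ ∫ x in E, w x := by
      refine setIntegral_mono ((integrableOn_const hEfin).sub (hdi.mono_set hEball))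
        (hwi _ hEfin) fun x => ?_
      have := neg_abs_le (w x - w x₀)
      simp only [Real.norm_eq_abs]
      linarith
    rw [integral_sub (integrableOn_const (C := w x₀) hEfin) (hdi.mono_set hEball), setIntegral_const,
      smul_eq_mul, hEv] at h1
    linarith
  refine le_trans (le_of_eq ?_) (hmain.trans (setIntegral_mono_set (hwi _ ?_)
    (ae_of_all _ fun _ => Real.sqrt_nonneg _) hEB.eventuallyLE))
  · ring
  · refine ((measure_mono fun x hx => ?_).trans_lt (measure_ball_lt_top (x := x₀) (r := s))).ne
    have hx : ‖x - x₀‖ ^ 2 + ‖F x - F x₀‖ ^ 2 < s ^ 2 := hx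
    rw [Metric.mem_ball, dist_eq_norm]
    refine lt_of_pow_lt_pow_left₀ 2 hs.le ?_
    nlinarith [sq_nonneg ‖F x - F x₀‖]

end Density

section FluxBound
open MeasureTheory Filter Topology Matrix
variable {α β : Type*} [Fintype α] [DecidableEq α] [Fintype β] [DecidableEq β]

/-- The Jacobian `√det (1 + B Bᵀ)` of the restriction of a graph to a hyperplane. -/
noncomputable def tanArea (B : Matrix β α ℝ) : ℝ := √(1 + B * Bᵀ).det

lemma tanArea_nonneg (B : Matrix β α ℝ) : 0 ≤ tanArea B := Real.sqrt_nonneg _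

lemma continuous_tanArea : Continuous (tanArea : Matrix β α ℝ → ℝ) := by
  unfold tanArea
  have : Continuous fun B : Matrix β α ℝ => 1 + B * Bᵀ :=
    continuous_const.add (continuous_id.matrix_mul continuous_id.matrix_transpose)
  exact this.matrix_det.sqrt

lemma exists_perturb_bound {G : Matrix β α ℝ → ℝ} (hG : Continuous G) (M : ℝ) {ε : ℝ} (hε : 0 < ε) :
    ∃ C, 0 ≤ C ∧ ∀ A B : Matrix β α ℝ, (∀ i j, |A i j| ≤ M) → (∀ i j, |B i j| ≤ M) →
      G A ≤ G B + ε + C * frobSq (A - B) := by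
  obtain ⟨C, hC⟩ := exists_bound_of_continuous hG M
  have hcomp : IsCompact (Set.univ.pi fun _ : β => Set.univ.pi fun _ : α => Set.Icc (-M) M) :=
    isCompact_univ_pi fun _ => isCompact_univ_pi fun _ => isCompact_Icc
  have hG' : ContinuousOn (fun A : β → α → ℝ => G (Matrix.of A))
      (Set.univ.pi fun _ : β => Set.univ.pi fun _ : α => Set.Icc (-M) M) :=
    Continuous.continuousOn hG
  obtain ⟨η, hη, hu⟩ := Metric.uniformContinuousOn_iff.1
    (hcomp.uniformContinuousOn_of_continuous hG') ε hε
  refine ⟨2 * |C| / η ^ 2, by positivity, fun A B hA hB => ?_⟩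
  have hmem : ∀ A : Matrix β α ℝ, (∀ i j, |A i j| ≤ M) →
      (A : β → α → ℝ) ∈ Set.univ.pi fun _ : β => Set.univ.pi fun _ : α => Set.Icc (-M) M :=
    fun A hA i _ j _ => abs_le.1 (hA i j)
  have h0 := frobSq_nonneg (A - B)
  have h1 : 0 ≤ 2 * |C| / η ^ 2 * frobSq (A - B) := by positivity
  by_cases h : ∀ i j, |A i j - B i j| < η
  · have h2 := hu A (hmem A hA) B (hmem B hB)
      ((dist_pi_lt_iff hη).2 fun i => (dist_pi_lt_iff hη).2 fun j => h i j)
    have h3 := (abs_lt.1 h2).2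
    change G A - G B < ε at h3
    linarith
  · push Not at h
    obtain ⟨i, j, hij⟩ := h
    have h2 : η ^ 2 ≤ frobSq (A - B) := by
      refine le_trans ?_ (sq_le_frobSq (A - B) i j)
      rw [Matrix.sub_apply, ← sq_abs (A i j - B i j)]
      gcongr
    have h3 : 2 * |C| ≤ 2 * |C| / η ^ 2 * frobSq (A - B) := by
      rw [div_mul_eq_mul_div, le_div_iff₀ (by positivity)]
      gcongr
    have h4 := (le_abs_self _).trans (hC A hA)
    have h5 := (neg_abs_le _).trans' (neg_le_neg (hC B hB))
    have h6 := le_abs_self C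
    linarith

namespace IsDefining
variable {Ω : Set (EuclideanSpace ℝ α)} {u : EuclideanSpace ℝ α → ℝ} {c : ℝ}
  {F h : EuclideanSpace ℝ α → EuclideanSpace ℝ β} {K : NNReal}

lemma exists_lt_near_zero
    (hd : IsDefining Ω u c)
    {g : EuclideanSpace ℝ α → ℝ}
    (hg : ContinuousOn g {x | 0 ≤ u x ∧ u x ≤ c}) {m : ℝ} (hm : ∀ x, u x = 0 → g x < m) :
    ∃ d, 0 < d ∧ d ≤ c ∧ ∀ x, 0 ≤ u x → u x ≤ d → g x < m := by
  have hS := hd.isCompact_strip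
  have hT : IsCompact ({x | 0 ≤ u x ∧ u x ≤ c} ∩ g ⁻¹' Set.Ici m) :=
    hS.of_isClosed_subset (hg.preimage_isClosed_of_isClosed hS.isClosed isClosed_Ici)
      Set.inter_subset_left
  obtain hE | hE := ({x | 0 ≤ u x ∧ u x ≤ c} ∩ g ⁻¹' Set.Ici m).eq_empty_or_nonempty
  · refine ⟨c, hd.c_pos, le_rfl, fun x hx hxc => ?_⟩
    by_contra hlt
    have : x ∈ ({x | 0 ≤ u x ∧ u x ≤ c} ∩ g ⁻¹' Set.Ici m) := ⟨⟨hx, hxc⟩, not_lt.1 hlt⟩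
    rw [hE] at this
    exact this
  · obtain ⟨x₀, ⟨⟨h0, h0c⟩, hx₀⟩, hmin⟩ := hT.exists_isMinOn hE hd.cont.continuousOn
    have hpos : 0 < u x₀ := h0.lt_of_ne fun h => not_le.2 (hm x₀ h.symm) hx₀
    refine ⟨u x₀ / 2, by positivity, by linarith, fun x hx hxd => ?_⟩
    by_contra hlt
    have : u x₀ ≤ u x := hmin ⟨⟨hx, by linarith⟩, not_lt.1 hlt⟩
    linarith

lemma exists_flux_bound
    (hd : IsDefining Ω u c) (hh : ∀ x, 0 ≤ u x → u x ≤ c → ContDiffAt ℝ 2 h x)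
    (hF : LipschitzWith K F) {Λ : ℝ}
    (hΛ : ∀ x, u x = 0 → tanArea (jac h x * tanProj (grad u x)) ≤ Λ) {ε : ℝ} (hε : 0 < ε) :
    ∃ d, 0 < d ∧ d ≤ c ∧ ∃ C, 0 ≤ C ∧ ∀ x, 0 ≤ u x → u x ≤ d →
      tanArea (jac F x * tanProj (grad u x)) ≤ Λ + ε + C * tiltSq F h u x := by
  have hB : ∀ i j, ∀ x ∈ {x | 0 ≤ u x ∧ u x ≤ c},
      ContinuousAt (fun y => (jac h y * tanProj (grad u y)) i j) x := fun i j x hx =>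
    ((entryC1_jac (hh x hx.1 hx.2)).mul
      (entryC1_tanProj (hd.contDiffAt_grad hx.1) (hd.grad_ne x hx.1 hx.2)) i j).continuousAt
  obtain ⟨M, hM0, hM⟩ := exists_entry_bound hd.isCompact_strip hB
  obtain ⟨T, hT0, hT⟩ := hd.exists_frob_bounds hh hF
  have hcont : ContinuousOn (fun x => tanArea (jac h x * tanProj (grad u x)))
      {x | 0 ≤ u x ∧ u x ≤ c} := fun x hx => by
    have h1 : ContinuousAt (fun y => jac h y * tanProj (grad u y)) x :=
      tendsto_pi_nhds.2 fun i => tendsto_pi_nhds.2 fun j => hB i j x hx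
    exact (continuous_tanArea.continuousAt.comp h1).continuousWithinAt
  obtain ⟨d, hd0, hdc, hd1⟩ := hd.exists_lt_near_zero hcont (m := Λ + ε / 2)
    fun x hx => (hΛ x hx).trans_lt (by linarith)
  obtain ⟨C, hC0, hC⟩ := exists_perturb_bound (α := α) (β := β) continuous_tanArea (M + √T)
    (half_pos hε)
  refine ⟨d, hd0, hdc, C, hC0, fun x hx hxd => ?_⟩
  have h1 := hM x ⟨hx, hxd.trans hdc⟩
  have h2 : ∀ i j, |(jac F x * tanProj (grad u x) - jac h x * tanProj (grad u x)) i j| ≤ √T :=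
    fun i j => by
      rw [← Matrix.sub_mul]
      exact Real.abs_le_sqrt ((sq_le_frobSq _ i j).trans (hT x hx (hxd.trans hdc)).2)
  have h3 := hC (jac F x * tanProj (grad u x)) (jac h x * tanProj (grad u x))
    (fun i j => by
      have h4 := h2 i j
      rw [Matrix.sub_apply] at h4
      have h5 := h1 i j
      rw [abs_le] at h4 h5 ⊢
      constructor <;> linarith)
    (fun i j => (h1 i j).trans (by linarith [Real.sqrt_nonneg T]))
  rw [← Matrix.sub_mul] at h3
  have h6 := hd1 x hx hxd
  simp only [tiltSq]
  linarith

end IsDefining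
end FluxBound

section Core
open MeasureTheory Filter Topology Matrix
variable {α β : Type*} [Fintype α] [DecidableEq α] [Fintype β] [DecidableEq β]

/-- Displacement in the graph from the point `(a, b)`. -/
noncomputable def graphDisp (a : EuclideanSpace ℝ α) (b : EuclideanSpace ℝ β) (k : α ⊕ β)
    (p : EuclideanSpace ℝ α × EuclideanSpace ℝ β) : ℝ :=
  Sum.elim (fun i => p.1 i - a i) (fun j => p.2 j - b j) k

lemma contDiff_graphDisp (a : EuclideanSpace ℝ α) (b : EuclideanSpace ℝ β) (k : α ⊕ β) :
    ContDiff ℝ 1 (graphDisp a b k) := by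
  cases k with
  | inl i =>
    exact (((EuclideanSpace.proj (𝕜 := ℝ) i).contDiff).comp contDiff_fst).sub contDiff_const
  | inr j =>
    exact (((EuclideanSpace.proj (𝕜 := ℝ) j).contDiff).comp contDiff_snd).sub contDiff_const

lemma graphDisp_dotProduct_self (a x : EuclideanSpace ℝ α) (b y : EuclideanSpace ℝ β) :
    (fun k => graphDisp a b k (x, y)) ⬝ᵥ (fun k => graphDisp a b k (x, y)) =
      ‖x - a‖ ^ 2 + ‖y - b‖ ^ 2 := by
  rw [euclidean_norm_sq, euclidean_norm_sq]
  simp [dotProduct, graphDisp]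

lemma famJac_graphDisp {F : EuclideanSpace ℝ α → EuclideanSpace ℝ β} (a : EuclideanSpace ℝ α)
    (b : EuclideanSpace ℝ β) {x : EuclideanSpace ℝ α} (hF : DifferentiableAt ℝ F x) :
    famJac (fun k x => graphDisp a b k (x, F x)) x = graphMap (jac F x) := by
  ext (i | j) k
  · simp only [famJac, graphDisp, Sum.elim_inl, of_apply, graphMap, fromRows_apply_inl]
    have h : HasFDerivAt (fun y : EuclideanSpace ℝ α => y i - a i)
        (EuclideanSpace.proj (𝕜 := ℝ) i) x :=
      ((EuclideanSpace.proj (𝕜 := ℝ) i).hasFDerivAt).sub_const _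
    rw [h.fderiv]
    simp [Matrix.one_apply]
  · simp only [famJac, graphDisp, Sum.elim_inr, of_apply, graphMap, fromRows_apply_inr]
    have h := (((EuclideanSpace.proj (𝕜 := ℝ) j).hasFDerivAt).comp x hF.hasFDerivAt).sub_const
      (c := b j)
    have h' : fderiv ℝ (fun y => F y j - b j) x = _ := h.fderiv
    rw [h']
    rfl

namespace IsDefining
variable {Ω : Set (EuclideanSpace ℝ α)} {u : EuclideanSpace ℝ α → ℝ} {c : ℝ}

lemma flux_layer_le (hd : IsDefining Ω u c) (A : Matrix β α ℝ) {δ : ℝ} (hδ : 0 < δ) (hδc : 2 * δ ≤ c)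
    (x : EuclideanSpace ℝ α) (y : α ⊕ β → ℝ) :
    √(graphGram A).det * |grad (fun x => cutIn δ (u x)) x ⬝ᵥ
      (((graphGram A)⁻¹ * (graphMap A)ᵀ) *ᵥ y)| ≤
    layer u δ x * tanArea (A * tanProj (grad u x)) * √(y ⬝ᵥ y) := by
  rw [hd.grad_cutIn hδ]
  by_cases hx : 0 ≤ u x ∧ u x ≤ c
  · have ha := hd.grad_ne x hx.1 hx.2
    have hpos := hd.grad_sq_pos hx.1 hx.2
    set a := grad u x
    set N := √(a ⬝ᵥ a) with hN
    have hN0 : 0 < N := Real.sqrt_pos.2 hpos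
    have hNN : N * N = a ⬝ᵥ a := Real.mul_self_sqrt hpos.le
    have hν : (N⁻¹ • a) ⬝ᵥ (N⁻¹ • a) = 1 := by
      rw [smul_dotProduct, dotProduct_smul, smul_eq_mul, smul_eq_mul, ← hNN]
      field_simp
    have hP : (1 - vecMulVec (N⁻¹ • a) (N⁻¹ • a) : Matrix α α ℝ) = tanProj a := by
      ext i j
      simp only [tanProj, Matrix.sub_apply, vecMulVec_apply, Pi.smul_apply, smul_eq_mul, ← hNN]
      field_simp
    have h1 := flux_le A (N⁻¹ • a) hν y
    rw [hP] at h1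
    have hL : layer u δ x = δ⁻¹ * stepDeriv (u x / δ - 1) * N := rfl
    have hs : 0 ≤ δ⁻¹ * stepDeriv (u x / δ - 1) :=
      mul_nonneg (inv_nonneg.2 hδ.le) (stepDeriv_nonneg _)
    have h2 : (δ⁻¹ * stepDeriv (u x / δ - 1)) • a = layer u δ x • (N⁻¹ • a) := by
      rw [hL, smul_smul, mul_assoc, mul_inv_cancel₀ hN0.ne', mul_one]
    rw [h2, smul_dotProduct, smul_eq_mul, abs_mul, abs_of_nonneg (layer_nonneg u hδ x),
      mul_left_comm, mul_assoc]
    exact mul_le_mul_of_nonneg_left h1 (layer_nonneg u hδ x)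
  · have h0 : stepDeriv (u x / δ - 1) = 0 := by
      rw [not_and_or, not_le, not_le] at hx
      obtain hx | hx := hx
      · refine stepDeriv_eq_zero_of_nonpos ?_
        have := div_neg_of_neg_of_pos hx hδ
        linarith
      · refine stepDeriv_eq_zero_of_one_le ?_
        have : 2 ≤ u x / δ := (le_div_iff₀ hδ).2 (by linarith)
        linarith
    rw [h0, layer, h0]
    simp

variable {F h : EuclideanSpace ℝ α → EuclideanSpace ℝ β} {K : NNReal}

lemma core_estimate [Nonempty α] (hd : IsDefining Ω u c)
    (hh : ∀ x, 0 ≤ u x → u x ≤ c → ContDiffAt ℝ 2 h x) (hF : LipschitzWith K F)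
    (hw : IsWeakMSS Ω F) {C₁ : ℝ}
    (hFh : ∀ x, 0 ≤ u x → u x ≤ c → ‖F x - h x‖ ≤ C₁ * u x) {Λ : ℝ} (hΛ0 : 0 ≤ Λ)
    (hΛ : ∀ x, u x = 0 → tanArea (jac h x * tanProj (grad u x)) ≤ Λ)
    {CL : ℝ} (hCL : ∀ δ, 0 < δ → 4 * δ ≤ c → ∫ x in Ω, layer u δ x ≤ CL)
    {x₁ : EuclideanSpace ℝ α} (hx₁ : 0 < u x₁) {b : ℝ} (hb : 0 < b) {d : ℝ} (hd0 : 0 < d)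
    (hfar : ∀ x, 0 ≤ u x → u x ≤ d → b ≤ ‖F x - F x₁‖) {ω : ℝ}
    (hdens : ∀ᶠ s in 𝓝[>] (0 : ℝ), ω * s ^ Fintype.card α ≤
      ∫ x in {x | ‖x - x₁‖ ^ 2 + ‖F x - F x₁‖ ^ 2 < s ^ 2}, √(graphGram (jac F x)).det) :
    Fintype.card α * ω * (√2)⁻¹ ^ (Fintype.card α + 2) ≤
      b⁻¹ ^ (Fintype.card α - 1) * (Λ * CL) := by
  have hlim : ∀ ε : ℝ, 0 < ε → Fintype.card α * ω * (√2)⁻¹ ^ (Fintype.card α + 2) ≤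
      b⁻¹ ^ (Fintype.card α - 1) * ((Λ + ε) * CL) := by
    intro ε hε
    obtain ⟨d₁, hd₁, hd₁c, C, hC0, hC⟩ := hd.exists_flux_bound hh hF hΛ hε
    set D := Fintype.card α with hD
    have hD1 : D = D - 1 + 1 := (Nat.succ_pred_eq_of_pos Fintype.card_pos).symm
    obtain ⟨r, hr, hball⟩ := Metric.isOpen_iff.1 (isOpen_lt continuous_const hd.cont)
      x₁ (show u x₁ / 2 < u x₁ by linarith)
    obtain ⟨s, hs, hs0, hsr⟩ := (hdens.and (Ioo_mem_nhdsGT hr)).exists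
    set B := {x | ‖x - x₁‖ ^ 2 + ‖F x - F x₁‖ ^ 2 < s ^ 2} with hB
    have hBu : ∀ x ∈ B, u x₁ / 2 < u x := fun x (hx : ‖x - x₁‖ ^ 2 + ‖F x - F x₁‖ ^ 2 < s ^ 2) => by
      refine hball ?_
      rw [Metric.mem_ball, dist_eq_norm]
      refine lt_trans (lt_of_pow_lt_pow_left₀ 2 hs0.le ?_) hsr
      linarith [sq_nonneg ‖F x - F x₁‖]
    have hBΩ : B ⊆ Ω := fun x hx => (hd.pos_iff x).2 (by linarith [hBu x hx])
    have hBm : MeasurableSet B := by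
      refine (isOpen_lt ?_ continuous_const).measurableSet
      have := hF.continuous
      fun_prop
    obtain ⟨CF, hCF0, hCF⟩ := exists_sqrt_det_bound hF
    have hgi : IntegrableOn (fun x => √(graphGram (jac F x)).det) Ω := by
      refine Measure.integrableOn_of_bounded (M := CF) hd.volume_ne_top
        (measurable_comp_jac continuous_graphGram_det.sqrt F).aestronglyMeasurable
        (ae_of_all _ fun x => ?_)
      rw [Real.norm_of_nonneg (Real.sqrt_nonneg _)]
      exact hCF x
    set κ : ℝ := D * s ^ 2 * (√2 * s)⁻¹ ^ (D + 2) with hκ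
    have hκ0 : 0 ≤ κ := by positivity
    have hmain : ∀ᶠ δ in 𝓝[>] (0 : ℝ), Fintype.card α * ω * (√2)⁻¹ ^ (Fintype.card α + 2) ≤
        b⁻¹ ^ (D - 1) * ((Λ + ε) * CL + C * ∫ x in Ω, layer u δ x * tiltSq F h u x) := by
      have hm : 0 < min (min c d) (min d₁ (u x₁)) :=
        lt_min (lt_min hd.c_pos hd0) (lt_min hd₁ hx₁)
      filter_upwards [Ioo_mem_nhdsGT (div_pos hm (by norm_num : (0 : ℝ) < 4))] with δ hδm
      obtain ⟨hδ, hδm⟩ := hδm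
      rw [lt_div_iff₀ (by norm_num), lt_min_iff, lt_min_iff, lt_min_iff] at hδm
      obtain ⟨⟨hδc, hδd⟩, hδd₁, hδu⟩ := hδm
      have hδ4 : 4 * δ ≤ c := by linarith
      have hη0 : ∀ t ≤ δ, cutIn δ t = 0 := fun t ht => cutIn_eq_zero hδ ht
      obtain ⟨hI, hI0⟩ := weak_radial_test (S := Set.univ) hd.isOpen hd.volume_ne_top
        hF hw ((hd.contDiff_comp (contDiff_cutIn δ) hδ hη0).of_le (by norm_num))
        (hd.hasCompactSupport_comp hδ hη0)
        (fun x hx => ⟨hd.tsupport_comp_subset_domain hδ hη0 hx, trivial⟩)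
        (X := graphDisp x₁ (F x₁)) (fun k x _ y => (contDiff_graphDisp x₁ (F x₁) k).contDiffAt)
        hs0 D (Xh := fun k x => graphDisp x₁ (F x₁) k (x, F x)) (fun _ _ => rfl)
      set I := fun x => √(graphGram (jac F x)).det * testDensity (jac F x)
        ((√((fun k => graphDisp x₁ (F x₁) k (x, F x)) ⬝ᵥ
          (fun k => graphDisp x₁ (F x₁) k (x, F x)) + s ^ 2))⁻¹ ^ D)
        (-((D : ℝ) / 2) * (√((fun k => graphDisp x₁ (F x₁) k (x, F x)) ⬝ᵥ
          (fun k => graphDisp x₁ (F x₁) k (x, F x)) + s ^ 2))⁻¹ ^ (D + 2))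
        (cutIn δ (u x)) (grad (fun x => cutIn δ (u x)) x)
        (fun k => graphDisp x₁ (F x₁) k (x, F x))
        (famJac (fun k x => graphDisp x₁ (F x₁) k (x, F x)) x) with hIdef
      have hlt := hd.integrableOn_layer_mul_tilt hh hF hδ hδ4
      have hlay := hd.integrableOn_layer hδ
      have hsum : IntegrableOn
          (fun x => (Λ + ε) * layer u δ x + C * (layer u δ x * tiltSq F h u x)) Ω :=
        (hlay.const_mul (Λ + ε)).add (hlt.const_mul C)
      have key : ∀ᵐ x ∂(volume.restrict Ω),
          B.indicator (fun x => κ * √(graphGram (jac F x)).det) x ≤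
          I x + b⁻¹ ^ (D - 1) * ((Λ + ε) * layer u δ x + C * (layer u δ x * tiltSq F h u x)) := by
        filter_upwards [ae_restrict_of_ae hF.ae_differentiableAt,
          ae_restrict_mem hd.isOpen.measurableSet] with x hFx hxΩ
        have hu : 0 < u x := (hd.pos_iff x).1 hxΩ
        have hlow := testDensity_radial_ge (jac F x) hs0 (cutIn_nonneg δ (u x))
          (grad (fun x => cutIn δ (u x)) x) (fun k => graphDisp x₁ (F x₁) k (x, F x))
        have hfl := hd.flux_layer_le (jac F x) hδ (by linarith) x
          (fun k => graphDisp x₁ (F x₁) k (x, F x))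
        simp only [hIdef, famJac_graphDisp x₁ (F x₁) hFx]
        rw [← hD] at hlow
        have hyy := dotProduct_self_nonneg' (fun k => graphDisp x₁ (F x₁) k (x, F x))
        have hyB : x ∈ B → (fun k => graphDisp x₁ (F x₁) k (x, F x)) ⬝ᵥ
            (fun k => graphDisp x₁ (F x₁) k (x, F x)) < s ^ 2 := fun hx => by
          rw [graphDisp_dotProduct_self]; exact hx
        have hyb : u x ≤ d → b ≤ √((fun k => graphDisp x₁ (F x₁) k (x, F x)) ⬝ᵥ
            (fun k => graphDisp x₁ (F x₁) k (x, F x))) := fun hx => by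
          rw [graphDisp_dotProduct_self]
          refine (hfar x hu.le hx).trans (Real.le_sqrt_of_sq_le ?_)
          linarith [sq_nonneg ‖x - x₁‖]
        set y : α ⊕ β → ℝ := fun k => graphDisp x₁ (F x₁) k (x, F x)
        set q := (√(y ⬝ᵥ y + s ^ 2))⁻¹ with hq
        have hsq0 : 0 < √(y ⬝ᵥ y + s ^ 2) := Real.sqrt_pos.2 (by positivity)
        have hq0 : 0 < q := inv_pos.2 hsq0
        set W := √(graphGram (jac F x)).det
        have hW0 : 0 ≤ W := Real.sqrt_nonneg _
        set v := grad (fun x => cutIn δ (u x)) x ⬝ᵥ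
          (((graphGram (jac F x))⁻¹ * (graphMap (jac F x))ᵀ) *ᵥ y)
        have h1 : B.indicator (fun x => κ * √(graphGram (jac F x)).det) x ≤
            W * (cutIn δ (u x) * (D * s ^ 2 * q ^ (D + 2))) := by
          by_cases hx : x ∈ B
          · rw [Set.indicator_of_mem hx, cutIn_eq_one hδ (by linarith [hBu x hx]), one_mul,
              mul_comm κ]
            refine mul_le_mul_of_nonneg_left ?_ hW0
            have h2 : √(y ⬝ᵥ y + s ^ 2) ≤ √2 * s := by
              rw [Real.sqrt_le_left (by positivity), mul_pow, Real.sq_sqrt (by norm_num)]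
              linarith [hyB hx]
            have h3 : (√2 * s)⁻¹ ≤ q := inv_anti₀ hsq0 h2
            rw [hκ]
            gcongr
          · rw [Set.indicator_of_notMem hx]
            have := cutIn_nonneg δ (u x)
            positivity
        have hL := layer_nonneg u hδ x
        have h4 : W * (q ^ D * |v|) ≤ b⁻¹ ^ (D - 1) *
            ((Λ + ε) * layer u δ x + C * (layer u δ x * tiltSq F h u x)) := by
          by_cases hx : u x < 2 * δ
          · have h5 := hyb (by linarith)
            have h6 : √(y ⬝ᵥ y) ≤ √(y ⬝ᵥ y + s ^ 2) :=
              Real.sqrt_le_sqrt (by linarith [sq_nonneg s])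
            have h7 : q ≤ b⁻¹ := inv_anti₀ hb (h5.trans h6)
            have h8 : q ^ D * √(y ⬝ᵥ y) ≤ b⁻¹ ^ (D - 1) := by
              rw [hD1, pow_succ, mul_assoc, Nat.add_sub_cancel]
              have h9 : q * √(y ⬝ᵥ y) ≤ 1 := by
                rw [hq, inv_mul_le_iff₀ hsq0, mul_one]; exact h6
              calc q ^ (D - 1) * (q * √(y ⬝ᵥ y)) ≤ b⁻¹ ^ (D - 1) * 1 := by gcongr
                _ = _ := mul_one _
            have h10 := hC x hu.le (by linarith)
            have h11 := tanArea_nonneg (jac F x * tanProj (grad u x))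
            calc W * (q ^ D * |v|) = q ^ D * (W * |v|) := by ring
              _ ≤ q ^ D * (layer u δ x * tanArea (jac F x * tanProj (grad u x)) * √(y ⬝ᵥ y)) := by
                gcongr
              _ = (q ^ D * √(y ⬝ᵥ y)) * (layer u δ x * tanArea (jac F x * tanProj (grad u x))) := by
                ring
              _ ≤ b⁻¹ ^ (D - 1) * (layer u δ x * (Λ + ε + C * tiltSq F h u x)) := by gcongr
              _ = _ := by ring
          · have h5 : layer u δ x = 0 := layer_eq_zero_of_ge hδ (not_lt.1 hx)
            rw [h5, zero_mul, zero_mul] at hfl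
            rw [h5]
            simp only [mul_zero, zero_mul, add_zero]
            calc W * (q ^ D * |v|) = q ^ D * (W * |v|) := by ring
              _ ≤ q ^ D * 0 := by gcongr
              _ = 0 := mul_zero _
        have h5 := mul_le_mul_of_nonneg_left hlow hW0
        have h6 : -(W * (q ^ D * |v|)) ≤ W * (q ^ D * v) := by
          rw [← mul_neg, ← mul_neg]
          have := neg_abs_le v
          gcongr
        rw [mul_add] at h5
        linarith
      have hint := integral_mono_ae ((hgi.const_mul κ).indicator hBm)
        (hI.add (hsum.const_mul (b⁻¹ ^ (D - 1)))) key
      rw [integral_indicator hBm, Measure.restrict_restrict hBm, Set.inter_eq_self_of_subset_left hBΩ,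
        integral_const_mul] at hint
      have hr : ∫ x in Ω, (I x + b⁻¹ ^ (D - 1) *
          ((Λ + ε) * layer u δ x + C * (layer u δ x * tiltSq F h u x))) =
          b⁻¹ ^ (D - 1) * ((Λ + ε) * (∫ x in Ω, layer u δ x) +
            C * ∫ x in Ω, layer u δ x * tiltSq F h u x) := by
        rw [integral_add hI (hsum.const_mul (b⁻¹ ^ (D - 1))), hI0,
          integral_const_mul, integral_add (hlay.const_mul (Λ + ε)) (hlt.const_mul C),
          integral_const_mul, integral_const_mul, zero_add]
      have hint' := hint.trans hr.le
      have hfin := mul_le_mul_of_nonneg_left hs hκ0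
      have hval : κ * (ω * s ^ D) = D * ω * (√2)⁻¹ ^ (D + 2) := by
        rw [hκ, mul_inv, mul_pow, inv_pow s, pow_add s]
        field_simp
      rw [hval] at hfin
      refine (hfin.trans hint').trans ?_
      have := hCL δ hδ hδ4
      gcongr
    have hT := (hd.tendsto_layer_tilt hh hF hw hFh).const_mul C
    have hT' := (hT.const_add ((Λ + ε) * CL)).const_mul (b⁻¹ ^ (D - 1))
    have := ge_of_tendsto hT' hmain
    simpa using this
  have hcont : Tendsto (fun ε : ℝ => b⁻¹ ^ (Fintype.card α - 1) * ((Λ + ε) * CL)) (𝓝[>] 0)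
      (𝓝 (b⁻¹ ^ (Fintype.card α - 1) * ((Λ + 0) * CL))) := by
    refine Tendsto.mono_left ?_ nhdsWithin_le_nhds
    exact Continuous.tendsto (by fun_prop) 0
  rw [add_zero] at hcont
  exact ge_of_tendsto hcont (by filter_upwards [self_mem_nhdsWithin] with ε hε using hlim ε hε)

end IsDefining
end Core

section Scale
open MeasureTheory Filter Topology Matrix
variable {α β : Type*} [Fintype α] [DecidableEq α] [Fintype β] [DecidableEq β]

lemma tanArea_smul_le {B : Matrix β α ℝ} {M R : ℝ} {l : ℕ} (hM : frobSq B ≤ M) (hl : B.rank ≤ l)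
    (hR : 1 ≤ R) : tanArea (R • B) ≤ (1 + M) ^ l * R ^ l := by
  have h0 := frobSq_nonneg B
  have hM0 : 0 ≤ M := h0.trans hM
  have hfrob : frobSq (R • B) = R ^ 2 * frobSq B := by
    simp only [frobSq, Matrix.smul_apply, smul_eq_mul, mul_pow, Finset.mul_sum]
  have hrank : (R • B).rank ≤ l := by
    have : R • B = (R • (1 : Matrix β β ℝ)) * B := by simp
    rw [this]
    exact (rank_mul_le_right _ _).trans hl
  have h1 := det_one_add_mul_transpose_le (R • B)
  rw [hfrob] at h1
  refine Real.sqrt_le_iff.2 ⟨by positivity, h1.trans ?_⟩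
  have hR2 : 1 ≤ R ^ 2 := one_le_pow₀ hR
  have hM1 : 1 ≤ 1 + M := by linarith
  calc (1 + R ^ 2 * frobSq B) ^ (R • B).rank ≤ (R ^ 2 * (1 + M)) ^ (R • B).rank := by
        refine pow_le_pow_left₀ (by positivity) ?_ _
        nlinarith
    _ ≤ (R ^ 2 * (1 + M)) ^ l := pow_le_pow_right₀ (one_le_mul_of_one_le_of_one_le hR2 hM1) hrank
    _ ≤ (R ^ 2 * (1 + M) ^ 2) ^ l := by
        refine pow_le_pow_left₀ (by positivity) (mul_le_mul_of_nonneg_left ?_ (by positivity)) _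
        nlinarith
    _ = _ := by rw [← mul_pow, ← mul_pow, ← pow_mul, ← pow_mul, mul_comm 2 l, mul_comm R]

namespace IsDefining
variable {Ω : Set (EuclideanSpace ℝ α)} {u : EuclideanSpace ℝ α → ℝ} {c : ℝ}

lemma far_estimate [Nonempty α] (hd : IsDefining Ω u c)
    {F h : EuclideanSpace ℝ α → EuclideanSpace ℝ β} {K : NNReal}
    (hh : ∀ x, 0 ≤ u x → u x ≤ c → ContDiffAt ℝ 2 h x) (hF : LipschitzWith K F)
    (hw : IsWeakMSS Ω F) {C₁ : ℝ}
    (hFh : ∀ x, 0 ≤ u x → u x ≤ c → ‖F x - h x‖ ≤ C₁ * u x) {Λ : ℝ} (hΛ0 : 0 ≤ Λ)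
    (hΛ : ∀ x, u x = 0 → tanArea (jac h x * tanProj (grad u x)) ≤ Λ)
    {CL : ℝ} (hCL : ∀ δ, 0 < δ → 4 * δ ≤ c → ∫ x in Ω, layer u δ x ≤ CL)
    {x₀ : EuclideanSpace ℝ α} (hx₀ : 0 < u x₀) {r : ℝ} (hr : 0 < r)
    (hfar : ∀ x, u x = 0 → r ≤ ‖F x - F x₀‖) :
    Fintype.card α * (volume.real (Metric.ball (0 : EuclideanSpace ℝ α) 1) / 2 *
      (1 / 2) ^ Fintype.card α) * (√2)⁻¹ ^ (Fintype.card α + 2) ≤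
      (r / 2)⁻¹ ^ (Fintype.card α - 1) * (Λ * CL) := by
  have hFc := hF.continuous
  obtain ⟨d, hd0, -, hd1⟩ := hd.exists_lt_near_zero (g := fun x => -‖F x - F x₀‖)
    (m := -(3 / 4 * r)) (by fun_prop) (fun x hx => by have := hfar x hx; linarith)
  have hnear : ∀ᶠ x₁ in 𝓝 x₀, 0 < u x₁ ∧ ‖F x₁ - F x₀‖ < r / 4 := by
    refine (hd.cont.tendsto x₀ |>.eventually (lt_mem_nhds hx₀)).and ?_
    have : Tendsto (fun x => ‖F x - F x₀‖) (𝓝 x₀) (𝓝 ‖F x₀ - F x₀‖) :=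
      Continuous.tendsto (by fun_prop) x₀
    rw [sub_self, norm_zero] at this
    exact this.eventually (gt_mem_nhds (by positivity))
  obtain ⟨N, hN, hNo, hxN⟩ := mem_nhds_iff.1 hnear
  obtain ⟨x₁, hx₁N, hdens⟩ : ∃ x₁ ∈ N, ∀ᶠ s in 𝓝[>] (0 : ℝ),
      volume.real (Metric.ball (0 : EuclideanSpace ℝ α) 1) / 2 * (s / 2) ^ Fintype.card α ≤
      ∫ x in {x | ‖x - x₁‖ ^ 2 + ‖F x - F x₁‖ ^ 2 < s ^ 2}, √(graphGram (jac F x)).det := by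
    by_contra hcon
    refine (hNo.measure_pos volume ⟨x₀, hxN⟩).ne' (measure_mono_null (fun x hx => ?_)
      (ae_graph_density hF))
    exact fun h' => hcon ⟨x, hx, h'⟩
  obtain ⟨hx₁, hx₁r⟩ := hN hx₁N
  refine hd.core_estimate hh hF hw hFh hΛ0 hΛ hCL hx₁ (half_pos hr) hd0 (fun x hx hxd => ?_)
    (hdens.mono fun s hs => le_trans (le_of_eq ?_) hs)
  · have h1 := hd1 x hx hxd
    have h2 := norm_sub_le_norm_sub_add_norm_sub (F x) (F x₁) (F x₀)
    linarith
  · ring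

lemma exists_scale_bound [Nonempty α] (hd : IsDefining Ω u c)
    {f : EuclideanSpace ℝ α → EuclideanSpace ℝ β}
    (hf : ∀ x, 0 ≤ u x → u x ≤ c → ContDiffAt ℝ 2 f x) {l : ℕ} (hl : l < Fintype.card α - 1)
    (hrank : ∀ x, u x = 0 → (jac f x).rank ≤ l) {ε : ℝ} (hε : 0 < ε) :
    ∃ R₀, 0 < R₀ ∧ ∀ R, R₀ ≤ R → ∀ (F : EuclideanSpace ℝ α → EuclideanSpace ℝ β) (K : NNReal),
      LipschitzWith K F → IsWeakMSS Ω F →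
      (∃ C₁, ∀ x, 0 ≤ u x → u x ≤ c → ‖F x - R • f x‖ ≤ C₁ * u x) →
      ∀ x₀, 0 < u x₀ → ∃ x, u x = 0 ∧ ‖F x - F x₀‖ < R * ε := by
  obtain ⟨CL, hCL0, hCL⟩ := hd.exists_layer_bound
  have hB : ∀ i j, ∀ x ∈ {x | 0 ≤ u x ∧ u x ≤ c},
      ContinuousAt (fun y => (jac f y * tanProj (grad u y)) i j) x := fun i j x hx =>
    ((entryC1_jac (hf x hx.1 hx.2)).mul
      (entryC1_tanProj (hd.contDiffAt_grad hx.1) (hd.grad_ne x hx.1 hx.2)) i j).continuousAt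
  obtain ⟨A, hA0, hA⟩ := exists_entry_bound hd.isCompact_strip hB
  set M := (Fintype.card β : ℝ) * Fintype.card α * A ^ 2 with hM
  have hM0 : 0 ≤ M := by positivity
  set n := Fintype.card α - 1 with hn
  set κ := Fintype.card α * (volume.real (Metric.ball (0 : EuclideanSpace ℝ α) 1) / 2 *
      (1 / 2) ^ Fintype.card α) * (√2)⁻¹ ^ (Fintype.card α + 2) with hκ
  have hκ0 : 0 < κ := by
    have h1 : 0 < volume.real (Metric.ball (0 : EuclideanSpace ℝ α) 1) := ENNReal.toReal_pos
      (Metric.measure_ball_pos volume _ one_pos).ne' measure_ball_lt_top.ne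
    have h2 : (0 : ℝ) < Fintype.card α := by exact_mod_cast Fintype.card_pos
    positivity
  set Q := (2 / ε) ^ n * ((1 + M) ^ l * CL) with hQ
  have hQ0 : 0 ≤ Q := by positivity
  refine ⟨1 + Q / κ, by positivity, fun R hR F K hF hw ⟨C₁, hC₁⟩ x₀ hx₀ => ?_⟩
  have hQκ : 0 ≤ Q / κ := by positivity
  have hR1 : 1 ≤ R := by linarith
  have hR0 : 0 < R := by linarith
  by_contra! hfar
  have hjac : ∀ x, 0 ≤ u x → u x ≤ c → jac (fun x => R • f x) x = R • jac f x := fun x hx hxc => by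
    ext b i
    have h1 := ((hf x hx hxc).differentiableAt two_ne_zero).hasFDerivAt.const_smul R
    have h2 : fderiv ℝ (fun x => R • f x) x = R • fderiv ℝ f x := h1.fderiv
    simp [jac, h2]
  have hkey := hd.far_estimate (h := fun x => R • f x) (fun x hx hxc => (hf x hx hxc).const_smul R)
    hF hw hC₁ (Λ := (1 + M) ^ l * R ^ l) (by positivity) (fun x hx => by
      rw [hjac x hx.ge (hx.le.trans hd.c_pos.le), Matrix.smul_mul]
      exact tanArea_smul_le
        (frobSq_le_of_entries (hA x ⟨hx.ge, hx.le.trans hd.c_pos.le⟩))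
        ((rank_mul_le_left _ _).trans (hrank x hx)) hR1) hCL hx₀ (by positivity) hfar
  rw [← hκ, ← hn] at hkey
  have h1 : (R * ε / 2)⁻¹ ^ n * ((1 + M) ^ l * R ^ l * CL) ≤ Q * R⁻¹ := by
    have h2 : (R * ε / 2)⁻¹ ^ n = (2 / ε) ^ n * R⁻¹ ^ n := by
      rw [← mul_pow]; congr 1; field_simp
    have h3 : R⁻¹ ^ n * R ^ l ≤ R⁻¹ := by
      rw [inv_pow, inv_mul_le_iff₀ (by positivity), ← div_eq_mul_inv, le_div_iff₀ hR0, ← pow_succ]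
      exact pow_le_pow_right₀ hR1 hl
    calc _ = Q * (R⁻¹ ^ n * R ^ l) := by rw [h2, hQ]; ring
      _ ≤ _ := by gcongr
  have h2 := hkey.trans h1
  rw [← div_eq_mul_inv, le_div_iff₀ hR0] at h2
  have h3 : κ * (1 + Q / κ) ≤ κ * R := by gcongr
  rw [mul_add, mul_div_cancel₀ _ hκ0.ne'] at h3
  linarith

end IsDefining
end Scale

section Torus
open Filter Topology
variable {n : ℕ}

/-- The distance to the axis of the solid torus. -/
noncomputable def axisDist (n : ℕ) (p : EuclideanSpace ℝ (Fin (n + 1))) : ℝ :=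
  √(p ⟨n - 1, by omega⟩ ^ 2 + p ⟨n, by omega⟩ ^ 2)

/-- The nearest point on the core circle of the solid torus. -/
noncomputable def torusCore (n : ℕ) (p : EuclideanSpace ℝ (Fin (n + 1))) :
    EuclideanSpace ℝ (Fin (n + 1)) :=
  WithLp.toLp 2 fun i => if (i : ℕ) < n - 1 then 0 else p i / axisDist n p

/-- Scaling by `s` about the core circle. -/
noncomputable def torusScale (n : ℕ) (s : ℝ) (p : EuclideanSpace ℝ (Fin (n + 1))) :
    EuclideanSpace ℝ (Fin (n + 1)) :=
  torusCore n p + s • (p - torusCore n p)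

lemma sum_fin_last_two (hn : 1 ≤ n) (g : Fin (n + 1) → ℝ) :
    ∑ i, g i = ∑ i : Fin (n - 1), g (Fin.castLE (by omega) i) + (g ⟨n - 1, by omega⟩ +
      g ⟨n, by omega⟩) := by
  obtain ⟨k, rfl⟩ : ∃ k, n = k + 1 := ⟨n - 1, by omega⟩
  rw [Fin.sum_univ_castSucc, Fin.sum_univ_castSucc, add_assoc]
  rfl

lemma continuous_axisDist : Continuous (axisDist n) := by
  unfold axisDist
  fun_prop

lemma axisDist_nonneg (p : EuclideanSpace ℝ (Fin (n + 1))) : 0 ≤ axisDist n p := Real.sqrt_nonneg _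

lemma axisDist_sq (p : EuclideanSpace ℝ (Fin (n + 1))) :
    axisDist n p ^ 2 = p ⟨n - 1, by omega⟩ ^ 2 + p ⟨n, by omega⟩ ^ 2 :=
  Real.sq_sqrt (by positivity)

lemma torusFun_eq (p : EuclideanSpace ℝ (Fin (n + 1))) :
    torusFun n p = ∑ i : Fin (n - 1), p (Fin.castLE (by omega) i) ^ 2 + (axisDist n p - 1) ^ 2 :=
  rfl

lemma continuous_torusFun : Continuous (torusFun n) := by
  unfold torusFun
  fun_prop

lemma norm_sq_eq_axisDist (hn : 1 ≤ n) (p : EuclideanSpace ℝ (Fin (n + 1))) :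
    ‖p‖ ^ 2 = ∑ i : Fin (n - 1), p (Fin.castLE (by omega) i) ^ 2 + axisDist n p ^ 2 := by
  rw [EuclideanSpace.norm_sq_eq, sum_fin_last_two hn, axisDist_sq]
  simp only [Real.norm_eq_abs, sq_abs]

lemma half_le_axisDist {p : EuclideanSpace ℝ (Fin (n + 1))} (hp : torusFun n p ≤ 1 / 4) :
    1 / 2 ≤ axisDist n p := by
  rw [torusFun_eq] at hp
  have h := Finset.sum_nonneg fun (i : Fin (n - 1)) (_ : i ∈ Finset.univ) =>
    sq_nonneg (p (Fin.castLE (by omega) i))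
  nlinarith [sq_nonneg (axisDist n p - 1 / 2)]

lemma sq_axisDist_sub_one_le (p : EuclideanSpace ℝ (Fin (n + 1))) :
    (axisDist n p - 1) ^ 2 ≤ torusFun n p := by
  rw [torusFun_eq]
  have h := Finset.sum_nonneg fun (i : Fin (n - 1)) (_ : i ∈ Finset.univ) =>
    sq_nonneg (p (Fin.castLE (by omega) i))
  linarith

lemma torusScale_apply_lt (s : ℝ) (p : EuclideanSpace ℝ (Fin (n + 1))) {i : Fin (n + 1)}
    (hi : (i : ℕ) < n - 1) : torusScale n s p i = s * p i := by
  simp [torusScale, torusCore, hi]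

lemma torusScale_apply_ge (s : ℝ) {p : EuclideanSpace ℝ (Fin (n + 1))} (hp : axisDist n p ≠ 0)
    {i : Fin (n + 1)} (hi : n - 1 ≤ (i : ℕ)) :
    torusScale n s p i = (1 + s * (axisDist n p - 1)) / axisDist n p * p i := by
  simp only [torusScale, torusCore, PiLp.add_apply, hi.not_gt, if_false, PiLp.smul_apply,
    PiLp.sub_apply, smul_eq_mul]
  field_simp

lemma axisDist_torusScale {s : ℝ} {p : EuclideanSpace ℝ (Fin (n + 1))} (hp : axisDist n p ≠ 0)
    (hs : 0 ≤ 1 + s * (axisDist n p - 1)) :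
    axisDist n (torusScale n s p) = 1 + s * (axisDist n p - 1) := by
  have h : ((1 + s * (axisDist n p - 1)) / axisDist n p * p ⟨n - 1, by omega⟩) ^ 2 +
      ((1 + s * (axisDist n p - 1)) / axisDist n p * p ⟨n, by omega⟩) ^ 2 =
      (1 + s * (axisDist n p - 1)) ^ 2 := by
    rw [mul_pow, mul_pow, ← mul_add, ← axisDist_sq]
    field_simp
  rw [axisDist, torusScale_apply_ge s hp (by simp), torusScale_apply_ge s hp (by simp), h,
    Real.sqrt_sq hs]

lemma torusFun_torusScale {s : ℝ} {p : EuclideanSpace ℝ (Fin (n + 1))} (hp : axisDist n p ≠ 0)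
    (hs : 0 ≤ 1 + s * (axisDist n p - 1)) :
    torusFun n (torusScale n s p) = s ^ 2 * torusFun n p := by
  rw [torusFun_eq, torusFun_eq, axisDist_torusScale hp hs, mul_add, Finset.mul_sum]
  congr 1
  · refine Finset.sum_congr rfl fun i _ => ?_
    rw [torusScale_apply_lt s p (by simp), mul_pow]
  · ring

lemma norm_sub_torusCore_sq (hn : 1 ≤ n) {p : EuclideanSpace ℝ (Fin (n + 1))}
    (hp : axisDist n p ≠ 0) : ‖p - torusCore n p‖ ^ 2 = torusFun n p := by
  rw [EuclideanSpace.norm_sq_eq, sum_fin_last_two hn, torusFun_eq]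
  congr 1
  · refine Finset.sum_congr rfl fun i _ => ?_
    simp [torusCore]
  · simp only [Real.norm_eq_abs, sq_abs, torusCore, PiLp.sub_apply, lt_irrefl, if_false,
      show ¬ n < n - 1 by omega]
    calc _ = ((axisDist n p - 1) / axisDist n p) ^ 2 *
          (p ⟨n - 1, by omega⟩ ^ 2 + p ⟨n, by omega⟩ ^ 2) := by field_simp
      _ = _ := by rw [← axisDist_sq]; field_simp

lemma torusScale_one (p : EuclideanSpace ℝ (Fin (n + 1))) : torusScale n 1 p = p := by
  simp [torusScale]

lemma torusScale_zero (p : EuclideanSpace ℝ (Fin (n + 1))) : torusScale n 0 p = torusCore n p := by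
  simp [torusScale]

lemma torusScale_nonneg_aux {s : ℝ} {p : EuclideanSpace ℝ (Fin (n + 1))}
    (hp : s ^ 2 * torusFun n p ≤ 1 / 4) : 0 < 1 + s * (axisDist n p - 1) := by
  have h := mul_le_mul_of_nonneg_left (sq_axisDist_sub_one_le p) (sq_nonneg s)
  have : (s * (axisDist n p - 1)) ^ 2 ≤ 1 / 4 := by rw [mul_pow]; linarith
  nlinarith

lemma contDiffAt_torusFun {p : EuclideanSpace ℝ (Fin (n + 1))} (hp : axisDist n p ≠ 0) :
    ContDiffAt ℝ 2 (torusFun n) p := by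
  have h := axisDist_sq p
  have h0 : p ⟨n - 1, by omega⟩ ^ 2 + p ⟨n, by omega⟩ ^ 2 ≠ 0 := by
    rw [← h]; positivity
  have hc : ∀ i : Fin (n + 1), ContDiffAt ℝ 2
      (fun p : EuclideanSpace ℝ (Fin (n + 1)) => p i) p := fun i => by fun_prop
  unfold torusFun
  refine ContDiffAt.add (ContDiffAt.sum fun i _ => (hc _).pow 2) ?_
  exact ((ContDiffAt.sqrt (((hc _).pow 2).add ((hc _).pow 2)) h0).sub contDiffAt_const).pow 2

lemma isCompact_torus (hn : 1 ≤ n) :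
    IsCompact {p : EuclideanSpace ℝ (Fin (n + 1)) | torusFun n p ≤ 1 / 4} := by
  refine Metric.isCompact_of_isClosed_isBounded
    (isClosed_le continuous_torusFun continuous_const) ?_
  refine (Metric.isBounded_closedBall (x := 0) (r := 2)).subset fun p hp => ?_
  rw [mem_closedBall_zero_iff]
  have h1 := norm_sq_eq_axisDist hn p
  have h2 := torusFun_eq p
  have h3 : torusFun n p ≤ 1 / 4 := hp
  have h4 := sq_axisDist_sub_one_le p
  have h5 : axisDist n p ≤ 3 / 2 := by nlinarith
  nlinarith [norm_nonneg p]

lemma continuousOn_torusCore :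
    ContinuousOn (torusCore n) {p | axisDist n p ≠ 0} := by
  unfold torusCore
  refine (PiLp.continuous_toLp 2 _).comp_continuousOn (continuousOn_pi.2 fun i => ?_)
  split_ifs
  · exact continuousOn_const
  · exact ContinuousOn.div (by fun_prop) continuous_axisDist.continuousOn fun p hp => hp

lemma fderiv_torusFun_ne_zero {p : EuclideanSpace ℝ (Fin (n + 1))} (hp : axisDist n p ≠ 0)
    (h0 : torusFun n p ≠ 0) : fderiv ℝ (torusFun n) p ≠ 0 := by
  intro hf
  have h1 : HasFDerivAt (torusFun n) (fderiv ℝ (torusFun n) p) (torusScale n 1 p) := by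
    rw [torusScale_one]
    exact ((contDiffAt_torusFun hp).differentiableAt (by norm_num)).hasFDerivAt
  have h2 : HasDerivAt (fun s : ℝ => torusScale n s p) ((1 : ℝ) • (p - torusCore n p)) 1 :=
    ((hasDerivAt_id 1).smul_const _).const_add _
  have h3 := h1.comp_hasDerivAt 1 h2
  rw [hf] at h3
  have h4 : HasDerivAt (fun s : ℝ => s ^ 2 * torusFun n p) (2 * torusFun n p) 1 := by
    simpa using (hasDerivAt_pow 2 (1 : ℝ)).mul_const (torusFun n p)
  have h5 : (torusFun n ∘ fun s : ℝ => torusScale n s p) =ᶠ[𝓝 1]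
      fun s : ℝ => s ^ 2 * torusFun n p := by
    have h6 : ∀ᶠ s : ℝ in 𝓝 1, 0 < 1 + s * (axisDist n p - 1) := by
      refine (Continuous.tendsto (by fun_prop) 1).eventually_const_lt ?_
      have := (axisDist_nonneg p).lt_of_ne hp.symm
      linarith
    filter_upwards [h6] with s hs using torusFun_torusScale hp hs.le
  have h7 := (h4.congr_of_eventuallyEq h5).unique h3
  simp at h7
  exact h0 h7

end Torus

section TorusDefining
open Filter Topology MeasureTheory Matrix
variable {n m : ℕ}

lemma exists_isDefining_torus (hn : 1 ≤ n) {W : Set (EuclideanSpace ℝ (Fin (n + 1)))}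
    (hW : IsOpen W) (hSW : {p | torusFun n p = 1 / 4} ⊆ W) :
    ∃ c, IsDefining {p | torusFun n p < 1 / 4} (fun p => 1 / 4 - torusFun n p) c ∧ c ≤ 1 / 8 ∧
      ∀ x, 0 ≤ 1 / 4 - torusFun n x → 1 / 4 - torusFun n x ≤ c → x ∈ W := by
  have hK : IsCompact ({p | torusFun n p ≤ 1 / 4} \ W) := (isCompact_torus hn).diff hW
  obtain ⟨c, hc0, hc⟩ : ∃ c, 0 < c ∧ ∀ x ∈ {p | torusFun n p ≤ 1 / 4} \ W,
      c < 1 / 4 - torusFun n x := by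
    rcases Set.eq_empty_or_nonempty ({p | torusFun n p ≤ 1 / 4} \ W) with h | h
    · exact ⟨1, one_pos, fun x hx => by rw [h] at hx; exact hx.elim⟩
    · obtain ⟨y, hy, hmin⟩ := hK.exists_isMinOn h
        (f := fun p => 1 / 4 - torusFun n p) (continuous_const.sub continuous_torusFun).continuousOn
      have hy0 : 0 < 1 / 4 - torusFun n y := by
        have h1 : torusFun n y ≤ 1 / 4 := hy.1
        have h2 : torusFun n y ≠ 1 / 4 := fun h2 => hy.2 (hSW h2)
        have := h1.lt_of_ne h2
        linarith
      refine ⟨(1 / 4 - torusFun n y) / 2, by linarith, fun x hx => ?_⟩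
      have := isMinOn_iff.1 hmin x hx
      linarith
  have hax : ∀ x, 0 ≤ 1 / 4 - torusFun n x → axisDist n x ≠ 0 := fun x hx => by
    have := half_le_axisDist (p := x) (by linarith)
    linarith
  refine ⟨min (1 / 8) c, ⟨continuous_const.sub continuous_torusFun, fun x => ?_, ?_, fun x hx => ?_,
    by positivity, fun x hx hxc h => ?_⟩, min_le_left _ _, fun x hx hxc => ?_⟩
  · simp
  · simpa using isCompact_torus hn
  · exact contDiffAt_const.sub (contDiffAt_torusFun (hax x hx))
  · refine fderiv_torusFun_ne_zero (hax x hx) ?_ ?_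
    · have := hxc.trans (min_le_left _ _)
      linarith
    · have h1 : fderiv ℝ (fun p => 1 / 4 - torusFun n p) x = -fderiv ℝ (torusFun n) x :=
        fderiv_const_sub _
      rw [← neg_eq_zero, ← h1]
      refine ContinuousLinearMap.coe_inj.1
        ((EuclideanSpace.basisFun (Fin (n + 1)) ℝ).toBasis.ext fun i => ?_)
      simpa [grad] using congrFun h i
  · by_contra hxW
    have h1 := hc x ⟨by simp at hx ⊢; linarith, hxW⟩
    have h2 := hxc.trans (min_le_right _ _)
    linarith

lemma exists_torus_strip_bound (hn : 1 ≤ n) {c : ℝ} (hc : c ≤ 1 / 8)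
    {f : EuclideanSpace ℝ (Fin (n + 1)) → EuclideanSpace ℝ (Fin (m + 1))}
    (hf : ∀ x, 0 ≤ 1 / 4 - torusFun n x → 1 / 4 - torusFun n x ≤ c → ContDiffAt ℝ 2 f x)
    {R : ℝ} {F : EuclideanSpace ℝ (Fin (n + 1)) → EuclideanSpace ℝ (Fin (m + 1))} {K : NNReal}
    (hF : LipschitzWith K F) (hbd : ∀ x, torusFun n x = 1 / 4 → F x = R • f x) :
    ∃ C₁, ∀ x, 0 ≤ 1 / 4 - torusFun n x → 1 / 4 - torusFun n x ≤ c →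
      ‖F x - R • f x‖ ≤ C₁ * (1 / 4 - torusFun n x) := by
  have hS : IsCompact {x | torusFun n x ≤ 1 / 4 ∧ 1 / 4 - torusFun n x ≤ c} := by
    refine (isCompact_torus hn).inter_right (t := {x | 1 / 4 - torusFun n x ≤ c}) ?_
    exact isClosed_le (continuous_const.sub continuous_torusFun) continuous_const
  obtain ⟨M, hM⟩ := hS.exists_bound_of_continuousOn (f := fderiv ℝ f) fun x hx =>
    ((hf x (by linarith [hx.1]) hx.2).continuousAt_fderiv (by norm_num)).continuousWithinAt
  refine ⟨(K + |R| * M) * 2, fun x hx0 hxc => ?_⟩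
  have hM0 : 0 ≤ M := (norm_nonneg _).trans (hM x ⟨by linarith, hxc⟩)
  have hax : axisDist n x ≠ 0 := by
    have := half_le_axisDist (p := x) (by linarith)
    linarith
  set t := torusFun n x with ht
  have ht0 : 1 / 8 ≤ t := by linarith
  have hs0 : 0 < √t := Real.sqrt_pos.2 (by linarith)
  have hst : √t ^ 2 = t := Real.sq_sqrt (by linarith)
  have hs2 : √t ≤ 1 / 2 := by nlinarith
  set a := 1 / (2 * √t) with ha
  have hast : a * √t = 1 / 2 := by rw [ha]; field_simp
  have ha1 : 1 ≤ a := by rw [ha, le_div_iff₀ (by positivity)]; linarith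
  have hscale : ∀ s, 1 ≤ s → s ≤ a → torusFun n (torusScale n s x) = s ^ 2 * t ∧
      t ≤ s ^ 2 * t ∧ s ^ 2 * t ≤ 1 / 4 := fun s hs1 hsa => by
    have h1 : s ^ 2 * t ≤ 1 / 4 := by
      have : s * √t ≤ 1 / 2 := hast ▸ (by gcongr)
      rw [← hst]
      nlinarith [mul_pos (by linarith : 0 < s) hs0]
    exact ⟨torusFun_torusScale hax (torusScale_nonneg_aux h1).le,
      le_mul_of_one_le_left (by linarith) (one_le_pow₀ hs1), h1⟩
  have hline : ∀ s, torusScale n s x - x = (s - 1) • (x - torusCore n x) := fun s => by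
    rw [torusScale]; module
  set y := torusScale n a x with hy
  have hyt : torusFun n y = 1 / 4 := by
    rw [(hscale a ha1 le_rfl).1, ← hst]
    nlinarith
  have hcore : ‖x - torusCore n x‖ = √t := by
    rw [ht, ← norm_sub_torusCore_sq hn hax, Real.sqrt_sq (norm_nonneg _)]
  have hyx : ‖y - x‖ ≤ 2 * (1 / 4 - t) := by
    rw [hline, norm_smul, hcore, Real.norm_of_nonneg (by linarith)]
    nlinarith
  have hseg : ∀ z ∈ segment ℝ x y, torusFun n z ≤ 1 / 4 ∧ 1 / 4 - torusFun n z ≤ c := by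
    intro z hz
    obtain ⟨θ, hθ, rfl⟩ := (segment_eq_image' ℝ x y) ▸ hz
    have h1 : x + θ • (y - x) = torusScale n (1 + θ * (a - 1)) x := by
      rw [hline, torusScale]; module
    have h2 := hscale (1 + θ * (a - 1)) (by nlinarith [hθ.1]) (by nlinarith [hθ.2])
    simp only [h1, h2.1]
    exact ⟨h2.2.2, by linarith⟩
  have h1 : ‖f y - f x‖ ≤ M * ‖y - x‖ :=
    Convex.norm_image_sub_le_of_norm_fderiv_le (𝕜 := ℝ)
      (fun z hz => (hf z (by linarith [(hseg z hz).1]) (hseg z hz).2).differentiableAt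
        (by norm_num)) (fun z hz => hM z (hseg z hz)) (convex_segment x y)
      (left_mem_segment ℝ x y) (right_mem_segment ℝ x y)
  have h2 : ‖F y - F x‖ ≤ K * ‖y - x‖ := by
    simpa [dist_eq_norm] using hF.dist_le_mul y x
  have h3 : F x - R • f x = R • (f y - f x) - (F y - F x) := by
    rw [hbd y hyt]; module
  rw [h3]
  calc _ ≤ ‖R • (f y - f x)‖ + ‖F y - F x‖ := norm_sub_le _ _
    _ ≤ |R| * (M * ‖y - x‖) + K * ‖y - x‖ := by
        rw [norm_smul, Real.norm_eq_abs]; gcongr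
    _ = (K + |R| * M) * ‖y - x‖ := by ring
    _ ≤ (K + |R| * M) * (2 * (1 / 4 - t)) := by gcongr
    _ = _ := by ring

lemma mem_closure_torus {x : EuclideanSpace ℝ (Fin (n + 1))} (hx : torusFun n x ≤ 1 / 4) :
    x ∈ closure {p | torusFun n p < 1 / 4} := by
  have hax : axisDist n x ≠ 0 := by
    have := half_le_axisDist hx
    linarith
  have h1 : Tendsto (fun s : ℝ => torusScale n s x) (𝓝[<] 1) (𝓝 x) := by
    have : Continuous fun s : ℝ => torusScale n s x := by unfold torusScale; fun_prop
    have h2 := this.tendsto 1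
    rw [torusScale_one] at h2
    exact h2.mono_left nhdsWithin_le_nhds
  refine mem_closure_of_tendsto h1 ?_
  filter_upwards [Ioo_mem_nhdsLT (zero_lt_one' ℝ)] with s hs
  have h0 : 0 ≤ torusFun n x := (sq_nonneg _).trans (sq_axisDist_sub_one_le x)
  have h2 : s ^ 2 < 1 := by nlinarith [hs.1, hs.2]
  have h3 : s ^ 2 * torusFun n x < 1 / 4 := by nlinarith
  simpa only [Set.mem_ofPred_eq, torusFun_torusScale hax (torusScale_nonneg_aux h3.le).le]

lemma mem_frontier_torus {x : EuclideanSpace ℝ (Fin (n + 1))} (hx : torusFun n x = 1 / 4) :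
    x ∈ frontier {p | torusFun n p < 1 / 4} := by
  rw [(isOpen_lt continuous_torusFun continuous_const).frontier_eq]
  exact ⟨mem_closure_torus hx.le, by simp [hx]⟩

lemma mssMetric_eq_graphGram
    (F : EuclideanSpace ℝ (Fin (n + 1)) → EuclideanSpace ℝ (Fin (m + 1)))
    (x : EuclideanSpace ℝ (Fin (n + 1))) : mssMetric F x = graphGram (jac F x) := by
  ext i j
  simp [mssMetric, graphGram, jac, Matrix.mul_apply, Matrix.one_apply]

lemma IsMSSolution.isWeakMSS {Ω : Set (EuclideanSpace ℝ (Fin (n + 1)))} (hΩ : IsOpen Ω)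
    {f F G : EuclideanSpace ℝ (Fin (n + 1)) → EuclideanSpace ℝ (Fin (m + 1))}
    (h : IsMSSolution n m Ω f F) (hFG : Set.EqOn F G Ω) : IsWeakMSS Ω G := by
  intro φ hφ hφc hφΩ k
  have hjac : ∀ x ∈ Ω, jac G x = jac F x := fun x hx => by
    have : G =ᶠ[𝓝 x] F := by
      filter_upwards [hΩ.mem_nhds hx] with y hy using (hFG hy).symm
    rw [jac, jac, this.fderiv_eq]
  obtain ⟨h1, h2⟩ := h.2.2.2 φ hφ hφc hφΩ
  cases k with
  | inl j =>
    rw [← h1 j]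
    refine setIntegral_congr_fun hΩ.measurableSet fun x hx => ?_
    simp only [hjac x hx, mssMetric_eq_graphGram, graphMap, Matrix.mul_apply,
      Matrix.transpose_apply, fromRows_apply_inl, Matrix.one_apply]
    simp
  | inr b =>
    rw [← h2 b]
    refine setIntegral_congr_fun hΩ.measurableSet fun x hx => ?_
    simp only [hjac x hx, mssMetric_eq_graphGram, graphMap, Matrix.mul_apply,
      Matrix.transpose_apply, fromRows_apply_inr, Finset.mul_sum, Finset.sum_mul]
    refine Finset.sum_congr rfl fun i _ => Finset.sum_congr rfl fun j _ => ?_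
    simp only [jac, Matrix.of_apply]
    ring

lemma rank_jac (F : EuclideanSpace ℝ (Fin (n + 1)) → EuclideanSpace ℝ (Fin (m + 1)))
    (x : EuclideanSpace ℝ (Fin (n + 1))) :
    (jac F x).rank = Module.finrank ℝ (LinearMap.range
      (fderiv ℝ F x : EuclideanSpace ℝ (Fin (n + 1)) →ₗ[ℝ] EuclideanSpace ℝ (Fin (m + 1)))) := by
  have h : (jac F x).mulVecLin = (WithLp.linearEquiv 2 ℝ (Fin (m + 1) → ℝ)).toLinearMap ∘ₗ
      (fderiv ℝ F x : EuclideanSpace ℝ (Fin (n + 1)) →ₗ[ℝ] EuclideanSpace ℝ (Fin (m + 1))) ∘ₗ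
      (WithLp.linearEquiv 2 ℝ (Fin (n + 1) → ℝ)).symm.toLinearMap := by
    refine LinearMap.ext fun v => ?_
    exact (fderiv_eq_jac_mulVec F x (WithLp.toLp 2 v)).symm
  rw [Matrix.rank, h, LinearMap.range_comp, LinearEquiv.finrank_map_eq,
    LinearMap.range_comp_of_range_eq_top _ (LinearEquiv.range _)]

end TorusDefining

section TorusTopology
open Filter Topology unitInterval

lemma nullhomotopic_of_circle {N : Type*} [TopologicalSpace N] [SimplyConnectedSpace N]
    (ψ : C(Circle, N)) : ψ.Nullhomotopic := by
  have h1 : Circle.exp (2 * Real.pi * 1) = 1 := by rw [mul_one, Circle.exp_two_pi]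
  let γ : Path (ψ 1) (ψ 1) :=
    { toFun := fun t => ψ (Circle.exp (2 * Real.pi * t))
      continuous_toFun := by fun_prop
      source' := by simp
      target' := by simp }
  obtain ⟨H⟩ := SimplyConnectedSpace.paths_homotopic γ (Path.refl (ψ 1))
  let k : ℝ → C(I, N) := fun t => ⟨fun s => H (s, Set.projIcc 0 1 zero_le_one t), by fun_prop⟩
  have hk : Continuous k := ContinuousMap.continuous_of_continuous_uncurry _ (by
    change Continuous fun q : ℝ × I => H (q.2, Set.projIcc 0 1 zero_le_one q.1)
    exact H.continuous.comp (continuous_snd.prodMk (continuous_projIcc.comp continuous_fst)))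
  have hk01 : k 0 = k (0 + 1) := by
    ext s
    simp [k]
  let L : UnitAddCircle → C(I, N) := AddCircle.liftIco 1 0 k
  have hL : Continuous L := AddCircle.liftIco_continuous hk01 hk.continuousOn
  have hLk : ∀ w : UnitAddCircle, ∃ t : I, L w = k t ∧
      AddCircle.homeomorphCircle one_ne_zero w = Circle.exp (2 * Real.pi * t) := fun w => by
    obtain ⟨⟨t, ht⟩, rfl⟩ := (AddCircle.equivIco 1 0).symm.surjective w
    rw [zero_add] at ht
    refine ⟨⟨t, ht.1, ht.2.le⟩, AddCircle.liftIco_coe_apply (by simpa using ht), ?_⟩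
    rw [AddCircle.homeomorphCircle_apply]
    change AddCircle.toCircle (t : UnitAddCircle) = _
    rw [AddCircle.toCircle_apply_mk]
    simp
  have hkt : ∀ t s : I, k t s = H (s, t) := fun t s => by simp [k]
  refine ⟨ψ 1, ⟨⟨⟨fun q => L ((AddCircle.homeomorphCircle one_ne_zero).symm q.2) q.1, ?_⟩,
    fun z => ?_, fun z => ?_⟩⟩⟩
  · have h2 : Continuous fun q : I × Circle =>
        L ((AddCircle.homeomorphCircle one_ne_zero).symm q.2) :=
      hL.comp ((AddCircle.homeomorphCircle one_ne_zero).symm.continuous.comp continuous_snd)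
    exact continuous_eval.comp (h2.prodMk continuous_fst)
  · obtain ⟨t, ht, hz⟩ := hLk ((AddCircle.homeomorphCircle one_ne_zero).symm z)
    rw [Homeomorph.apply_symm_apply] at hz
    change L _ 0 = ψ z
    rw [ht, hkt, H.apply_zero, hz]
    rfl
  · obtain ⟨t, ht, -⟩ := hLk ((AddCircle.homeomorphCircle one_ne_zero).symm z)
    change L _ 1 = ψ 1
    rw [ht, hkt, H.apply_one]
    rfl

variable {n : ℕ}

/-- The standard parametrization of the core circle of the solid torus. -/
noncomputable def coreCircle (n : ℕ) (z : Circle) : EuclideanSpace ℝ (Fin (n + 1)) :=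
  WithLp.toLp 2 fun i => if (i : ℕ) < n - 1 then 0 else
    if (i : ℕ) = n - 1 then (z : ℂ).re else (z : ℂ).im

lemma continuous_coreCircle : Continuous (coreCircle n) := by
  unfold coreCircle
  refine (PiLp.continuous_toLp 2 _).comp (continuous_pi fun i => ?_)
  split_ifs
  · exact continuous_const
  · exact Complex.continuous_re.comp continuous_subtype_val
  · exact Complex.continuous_im.comp continuous_subtype_val

lemma torusFun_coreCircle (hn : 1 ≤ n) (z : Circle) : torusFun n (coreCircle n z) = 0 := by
  have h : (z : ℂ).re ^ 2 + (z : ℂ).im ^ 2 = 1 := by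
    have := Circle.normSq_coe z
    rw [Complex.normSq_apply] at this
    linarith
  have h1 : ¬ n < n - 1 := by omega
  have h2 : n ≠ n - 1 := by omega
  simp [torusFun, coreCircle, h1, h2, h]

lemma exists_coreCircle_eq (hn : 1 ≤ n) : ∃ q : C({p | torusFun n p = 1 / 4}, Circle),
    ∀ x, coreCircle n (q x) = torusCore n x := by
  have hax : ∀ x : {p | torusFun n p = 1 / 4}, 0 < axisDist n x := fun x => by
    have := half_le_axisDist (p := (x : EuclideanSpace ℝ (Fin (n + 1)))) x.2.le
    linarith
  let w : {p | torusFun n p = 1 / 4} → ℂ := fun x =>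
    ⟨x.1 ⟨n - 1, by omega⟩ / axisDist n x, x.1 ⟨n, by omega⟩ / axisDist n x⟩
  have hw : ∀ x, ‖w x‖ = 1 := fun x => by
    rw [Complex.norm_def, Complex.normSq_apply, Real.sqrt_eq_one]
    have h1 := axisDist_sq (n := n) x
    have h2 := (hax x).ne'
    simp only [w]
    field_simp
    linarith
  have hwc : Continuous w := by
    have h1 : Continuous fun x : {p | torusFun n p = 1 / 4} => axisDist n x :=
      continuous_axisDist.comp continuous_subtype_val
    have h2 : ∀ i : Fin (n + 1), Continuous fun x : {p | torusFun n p = 1 / 4} =>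
        x.1 i / axisDist n x := fun i =>
      Continuous.div (by fun_prop) h1 fun x => (hax x).ne'
    exact Complex.equivRealProdCLM.symm.continuous.comp ((h2 _).prodMk (h2 _))
  have hmem : ∀ x, w x ∈ Submonoid.unitSphere ℂ := fun x => by simp [Submonoid.unitSphere, hw x]
  refine ⟨⟨fun x => ⟨w x, hmem x⟩, hwc.subtype_mk hmem⟩, fun x => ?_⟩
  ext i
  simp only [coreCircle, torusCore]
  split_ifs with h1 h2
  · rfl
  · exact congrArg (fun j => x.1 j / axisDist n x)
      (Fin.ext h2.symm : (⟨n - 1, by omega⟩ : Fin (n + 1)) = i)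
  · exact congrArg (fun j => x.1 j / axisDist n x)
      (Fin.ext (by have := i.2; simp; omega) : (⟨n, by omega⟩ : Fin (n + 1)) = i)

lemma exists_nullhomotopic_of_extension (hn : 1 ≤ n) {Y : Type*} [TopologicalSpace Y] {N : Set Y}
    [SimplyConnectedSpace N] {Ψ : EuclideanSpace ℝ (Fin (n + 1)) → Y}
    (hΨ : ContinuousOn Ψ {p | torusFun n p ≤ 1 / 4})
    (hN : Set.MapsTo Ψ {p | torusFun n p ≤ 1 / 4} N) :
    ∃ g : C({p | torusFun n p = 1 / 4}, N), (∀ x, (g x : Y) = Ψ x) ∧ g.Nullhomotopic := by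
  have hrest : Continuous fun x : {p | torusFun n p ≤ 1 / 4} => (⟨Ψ x, hN x.2⟩ : N) :=
    (continuousOn_iff_continuous_domRestrict.1 hΨ).subtype_mk _
  obtain ⟨q, hq⟩ := exists_coreCircle_eq hn
  have hax : ∀ x : {p | torusFun n p = 1 / 4}, axisDist n x ≠ 0 := fun x => by
    have := half_le_axisDist (p := (x : EuclideanSpace ℝ (Fin (n + 1)))) x.2.le
    linarith
  have hmem : ∀ (s : I) (x : {p | torusFun n p = 1 / 4}),
      torusFun n (torusScale n (1 - s) x) ≤ 1 / 4 := fun s x => by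
    have hx : torusFun n x = 1 / 4 := x.2
    have h1 : (1 - (s : ℝ)) ^ 2 * torusFun n x ≤ 1 / 4 := by
      rw [hx]
      nlinarith [s.2.1, s.2.2]
    rwa [torusFun_torusScale (hax x) (torusScale_nonneg_aux h1).le]
  let g : C({p | torusFun n p = 1 / 4}, N) :=
    ⟨fun x => ⟨Ψ x, hN x.2.le⟩,
      hrest.comp (Continuous.subtype_mk continuous_subtype_val fun x => x.2.le)⟩
  have hcirc : ∀ z, coreCircle n z ∈ {p | torusFun n p ≤ 1 / 4} := fun z => by
    simp [torusFun_coreCircle hn]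
  let ψ : C(Circle, N) :=
    ⟨fun z => ⟨Ψ (coreCircle n z), hN (hcirc z)⟩,
      hrest.comp (Continuous.subtype_mk continuous_coreCircle hcirc)⟩
  have hscale : Continuous fun y : I × {p | torusFun n p = 1 / 4} =>
      torusScale n (1 - (y.1 : ℝ)) (y.2 : EuclideanSpace ℝ (Fin (n + 1))) := by
    have h1 : Continuous fun x : {p | torusFun n p = 1 / 4} => torusCore n x :=
      continuousOn_torusCore.comp_continuous continuous_subtype_val hax
    have h2 := h1.comp (continuous_snd (X := I))
    have h3 : Continuous fun y : I × {p | torusFun n p = 1 / 4} =>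
        (y.2 : EuclideanSpace ℝ (Fin (n + 1))) := by fun_prop
    have h4 : Continuous fun y : I × {p | torusFun n p = 1 / 4} => 1 - (y.1 : ℝ) := by fun_prop
    exact h2.add (h4.smul (h3.sub h2))
  have hhom : g.Homotopic (ψ.comp q) := by
    refine ⟨⟨⟨fun y => ⟨Ψ (torusScale n (1 - (y.1 : ℝ)) y.2), hN (hmem y.1 y.2)⟩,
      hrest.comp (hscale.subtype_mk fun y => hmem y.1 y.2)⟩, fun x => ?_, fun x => ?_⟩⟩
    · simp [g, torusScale_one]
    · simp [ψ, torusScale_zero, hq]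
  obtain ⟨y, hy⟩ := (nullhomotopic_of_circle ψ).comp_left q
  exact ⟨g, fun x => rfl, y, hhom.trans hy⟩

end TorusTopology

/-- Non-existence over the solid torus `T = D̄ⁿ(1/2) × S¹(1) ⊂ ℝ^{n+1}` of solutions of
the Dirichlet problem with strongly rescaled boundary data `R·f`, when `f(∂T)` is a simply
connected lower-dimensional retract and `f|_{∂T}` is not null-homotopic into its image. -/
theorem torus_nonexistence (n m l : ℕ) (hn : 2 ≤ n) (hm : 1 ≤ m) (hln : l < n)
    (f : EuclideanSpace ℝ (Fin (n+1)) → EuclideanSpace ℝ (Fin (m+1)))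
    (W : Set (EuclideanSpace ℝ (Fin (n+1)))) (hWopen : IsOpen W)
    (hSW : {p : EuclideanSpace ℝ (Fin (n+1)) | torusFun n p = 1/4} ⊆ W)
    (hfC2 : ContDiffOn ℝ 2 f W)
    -- (i) the image N = f(∂T) is path-connected and simply connected
    (hpath : PathConnectedSpace
      ↥(f '' {p : EuclideanSpace ℝ (Fin (n+1)) | torusFun n p = 1/4}))
    (hsc : SimplyConnectedSpace
      ↥(f '' {p : EuclideanSpace ℝ (Fin (n+1)) | torusFun n p = 1/4}))
    -- (ii) a continuous retraction of an ε₀-neighborhood of N onto N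
    (ε₀ : ℝ) (hε₀ : 0 < ε₀)
    (ρ : EuclideanSpace ℝ (Fin (m+1)) → EuclideanSpace ℝ (Fin (m+1)))
    (hρcont : ContinuousOn ρ (Metric.thickening ε₀
      (f '' {p : EuclideanSpace ℝ (Fin (n+1)) | torusFun n p = 1/4})))
    (hρmaps : ∀ y ∈ Metric.thickening ε₀
        (f '' {p : EuclideanSpace ℝ (Fin (n+1)) | torusFun n p = 1/4}),
      ρ y ∈ f '' {p : EuclideanSpace ℝ (Fin (n+1)) | torusFun n p = 1/4})
    (hρid : ∀ y ∈ f '' {p : EuclideanSpace ℝ (Fin (n+1)) | torusFun n p = 1/4}, ρ y = y)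
    -- (iii) rank of df_x at most l < n on ∂T
    (hrank : ∀ x ∈ {p : EuclideanSpace ℝ (Fin (n+1)) | torusFun n p = 1/4},
      Module.finrank ℝ
        (LinearMap.range ((fderiv ℝ f x : EuclideanSpace ℝ (Fin (n+1)) →L[ℝ]
          EuclideanSpace ℝ (Fin (m+1))) :
            EuclideanSpace ℝ (Fin (n+1)) →ₗ[ℝ] EuclideanSpace ℝ (Fin (m+1)))) ≤ l)
    -- (iv) f|_{∂T} is not null-homotopic as a map into N
    (hnotnull : ∀ g : C(↥{p : EuclideanSpace ℝ (Fin (n+1)) | torusFun n p = 1/4},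
        ↥(f '' {p : EuclideanSpace ℝ (Fin (n+1)) | torusFun n p = 1/4})),
      (∀ x, (g x : EuclideanSpace ℝ (Fin (m+1))) = f x) →
      ∀ y, ¬ g.Homotopic (ContinuousMap.const _ y)) :
    ∃ Rf > (0:ℝ), ∀ R ≥ Rf,
      ¬ ∃ F, IsMSSolution n m {p : EuclideanSpace ℝ (Fin (n+1)) | torusFun n p < 1/4}
        (fun x => R • f x) F := by
  have hn1 : 1 ≤ n := by omega
  obtain ⟨c, hd, hc8, hcW⟩ := exists_isDefining_torus hn1 hWopen hSW
  have hfs : ∀ x, 0 ≤ 1 / 4 - torusFun n x → 1 / 4 - torusFun n x ≤ c → ContDiffAt ℝ 2 f x :=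
    fun x h0 h1 => hfC2.contDiffAt (hWopen.mem_nhds (hcW x h0 h1))
  obtain ⟨R₀, hR₀, hmain⟩ := hd.exists_scale_bound hfs (l := l) (by simpa using hln)
    (fun x hx => (rank_jac f x).trans_le (hrank x (by
      change torusFun n x = 1 / 4
      linarith))) hε₀
  refine ⟨R₀, hR₀, fun R hR => ?_⟩
  rintro ⟨F, hF⟩
  have hRpos : 0 < R := hR₀.trans_le hR
  have hΩ : IsOpen {p : EuclideanSpace ℝ (Fin (n + 1)) | torusFun n p < 1 / 4} :=
    isOpen_lt continuous_torusFun continuous_const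
  obtain ⟨K, hK⟩ := hF.2.1
  obtain ⟨G, hG, hFG⟩ := hK.extend_finite_dimension
  have hFGc := hFG.of_subset_closure hF.1 hG.continuous.continuousOn subset_closure subset_rfl
  have hGb : ∀ x, torusFun n x = 1 / 4 → G x = R • f x := fun x hx => by
    rw [← hFGc (mem_closure_torus hx.le), hF.2.2.1 x (mem_frontier_torus hx)]
  have hfar := hmain R hR G _ hG (hF.isWeakMSS hΩ hFG)
    (exists_torus_strip_bound hn1 hc8 hfs hG hGb)
  have hGcont := hG.continuous
  have hGf : ∀ x, torusFun n x = 1 / 4 → R⁻¹ • G x = f x := fun x hx => by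
    rw [hGb x hx, inv_smul_smul₀ hRpos.ne']
  by_cases hall : ∀ x, torusFun n x ≤ 1 / 4 → R⁻¹ • G x ∈ Metric.thickening ε₀
      (f '' {p : EuclideanSpace ℝ (Fin (n + 1)) | torusFun n p = 1 / 4})
  · obtain ⟨g, hg, y, hy⟩ := exists_nullhomotopic_of_extension hn1
      (N := f '' {p : EuclideanSpace ℝ (Fin (n + 1)) | torusFun n p = 1 / 4})
      (Ψ := fun x => ρ (R⁻¹ • G x))
      (hρcont.comp (f := fun x => R⁻¹ • G x)
        (show Continuous fun x => R⁻¹ • G x by fun_prop).continuousOn hall)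
      (fun x hx => hρmaps _ (hall x hx))
    refine hnotnull g (fun x => ?_) y hy
    have hx : torusFun n x = 1 / 4 := x.2
    rw [hg, hGf x hx]
    exact hρid _ (Set.mem_image_of_mem f x.2)
  · push Not at hall
    obtain ⟨x₀, hx₀, hx₀N⟩ := hall
    have hx₀' : torusFun n x₀ < 1 / 4 := hx₀.lt_of_ne fun h => hx₀N (by
      rw [hGf x₀ h]
      exact Metric.self_subset_thickening hε₀ _ (Set.mem_image_of_mem f h))
    obtain ⟨x, hx, hlt⟩ := hfar x₀ (by linarith)
    have hx' : torusFun n x = 1 / 4 := by linarith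
    refine hx₀N (Metric.mem_thickening_iff.2 ⟨f x, Set.mem_image_of_mem f hx', ?_⟩)
    rw [← hGf x hx', dist_comm, dist_eq_norm, ← smul_sub, norm_smul, norm_inv,
      Real.norm_of_nonneg hRpos.le, inv_mul_lt_iff₀ hRpos]
    exact hlt
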